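/- arXiv:2202.10127 — 2 statements merged into one kernel-verified Lean document; each statement's English description precedes it below -/
import Mathlib

section
/- If positive integers n1 ≥ n2 ≥ n3 ≥ n4 and a satisfy F_{n1} + F_{n2} + F_{n3} + F_{n4} = 2^a with n1 > 350, then (n1 − n3)·log α < 3.29 × 10^24 · (log n1)^2. -/
lemma det_bound {ι κ : Type*} [Fintype ι] [DecidableEq ι] [Fintype κ] [DecidableEq κ]
    (x : ι → κ → ℝ) (y : κ → ι → ℝ) (ρ : ι → ι → ℝ) (b τ : ℝ) (hb : 0 ≤ b) (hτ : 1 ≤ τ)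
    (e : κ → ℕ) (M0 : ℕ)
    (hxy : ∀ μ k c, |x μ k * y k c| ≤ b / τ ^ (e k))
    (hρ : ∀ μ c, |ρ μ c| ≤ b / τ ^ M0) :
    |(Matrix.of fun μ c => (∑ k, x μ k * y k c) + ρ μ c).det| ≤
      (Fintype.card ι).factorial * (Fintype.card κ + 1 : ℝ) ^ (Fintype.card ι) * b ^ (Fintype.card ι) *
        τ ^ (∑ k, (M0 - e k)) / τ ^ (Fintype.card ι * M0) := by
  have hτ0 : 0 < τ := by linarith
  let v : ι → Option κ → (ι → ℝ) := fun c o => match o with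
    | some k => fun μ => x μ k * y k c
    | none => fun μ => ρ μ c
  let e' : Option κ → ℕ := fun o => match o with
    | some k => e k
    | none => M0
  have hv : ∀ c o μ, |v c o μ| ≤ b / τ ^ (e' o) := by
    intro c o μ
    cases o with
    | none => exact hρ μ c
    | some k => exact hxy μ k c
  have h1 : (Matrix.of fun μ c => (∑ k, x μ k * y k c) + ρ μ c).det
      = ∑ f : ι → Option κ, Matrix.det (Matrix.of fun c => v c (f c)) := by
    rw [← Matrix.det_transpose]
    have := (Matrix.detRowAlternating (R := ℝ) (n := ι)).toMultilinearMap.map_sum (fun c (o : Option κ) => v c o)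
    rw [show (Matrix.of fun μ c => (∑ k, x μ k * y k c) + ρ μ c).transpose
      = Matrix.of (fun c => ∑ o : Option κ, v c o) from ?_]
    · exact this
    · ext c μ
      simp [v, Fintype.sum_option, add_comm]
  have h2 : ∀ f : ι → Option κ, |Matrix.det (Matrix.of fun c => v c (f c))| ≤
      (Fintype.card ι).factorial * (b ^ (Fintype.card ι) *
        τ ^ (∑ k, (M0 - e k)) / τ ^ (Fintype.card ι * M0)) := by
    intro f
    by_cases hf : ∃ c c' k, c ≠ c' ∧ f c = some k ∧ f c' = some k
    · obtain ⟨c, c', k, hne, h1, h2⟩ := hf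
      have : Matrix.det (Matrix.of fun c => v c (f c)) = 0 := by
        let sc : ι → ℝ := fun c => (f c).elim 1 (fun k => y k c)
        let A : Matrix ι ι ℝ := Matrix.of fun c μ => (f c).elim (ρ μ c) (fun k => x μ k)
        have hA : (Matrix.of fun c => v c (f c)) = Matrix.of fun i j => sc i * A i j := by
          ext i j
          simp only [Matrix.of_apply, sc, A, v]
          cases f i <;> simp [mul_comm]
        rw [hA, Matrix.det_mul_column, Matrix.det_zero_of_row_eq hne, mul_zero]
        ext μ
        simp [A, h1, h2]
      rw [this, abs_zero]; positivity
    · push Not at hf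
      have hsum : Fintype.card ι * M0 ≤ (∑ c, e' (f c)) + ∑ k, (M0 - e k) := by
        have h3 : ∑ c, (M0 - e' (f c)) ≤ ∑ k, (M0 - e k) := by
          have : ∑ c, (M0 - e' (f c)) = ∑ c ∈ Finset.univ.filter (fun c => (f c).isSome), (M0 - e' (f c)) := by
            symm
            apply Finset.sum_subset (Finset.filter_subset _ _)
            intro c _ hc
            have : f c = none := by simpa using hc
            simp [this, e']
          rw [this]
          have h4 : ∑ o ∈ (Finset.univ.filter (fun c => (f c).isSome)).image f, (M0 - e' o) =
              ∑ c ∈ Finset.univ.filter (fun c => (f c).isSome), (M0 - e' (f c)) := by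
            apply Finset.sum_image
            intro c hc c' hc' hcc
            by_contra hne
            simp at hc
            obtain ⟨k, hk⟩ := Option.isSome_iff_exists.mp hc
            exact hf c c' k hne hk (hcc ▸ hk)
          rw [← h4]
          calc _ ≤ ∑ o : Option κ, (M0 - e' o) := Finset.sum_le_sum_of_subset (Finset.subset_univ _)
            _ = _ := by simp [Fintype.sum_option, e']
        have h5 : ∑ c : ι, M0 ≤ ∑ c, (e' (f c) + (M0 - e' (f c))) := by
          apply Finset.sum_le_sum; intros; omega
        rw [Finset.sum_add_distrib] at h5
        simp at h5
        omega
      rw [Matrix.det_apply]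
      calc _ ≤ ∑ σ : Equiv.Perm ι, |Equiv.Perm.sign σ • ∏ i, (Matrix.of fun c => v c (f c)) (σ i) i| :=
            Finset.abs_sum_le_sum_abs _ _
        _ ≤ ∑ σ : Equiv.Perm ι, (b ^ (Fintype.card ι) *
        τ ^ (∑ k, (M0 - e k)) / τ ^ (Fintype.card ι * M0)) := by
            apply Finset.sum_le_sum
            intro σ _
            have : |Equiv.Perm.sign σ • ∏ i, (Matrix.of fun c => v c (f c)) (σ i) i| = ∏ i, |v (σ i) (f (σ i)) i| := by
              rcases Int.units_eq_one_or (Equiv.Perm.sign σ) with h | h <;> simp [h, Finset.abs_prod]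
            rw [this]
            calc _ ≤ ∏ i, (b / τ ^ (e' (f (σ i)))) :=
                  Finset.prod_le_prod (fun _ _ => abs_nonneg _) (fun i _ => hv _ _ _)
              _ = ∏ i, (b / τ ^ (e' (f i))) := Equiv.prod_comp σ (fun i => b / τ ^ (e' (f i)))
              _ = b ^ (Fintype.card ι) / τ ^ (∑ i, e' (f i)) := by
                  rw [Finset.prod_div_distrib, Finset.prod_pow_eq_pow_sum]; simp
              _ ≤ _ := by
                  rw [div_le_div_iff₀ (by positivity) (by positivity), mul_assoc, ← pow_add]
                  gcongr
                  omega
        _ = _ := by simp [Fintype.card_perm]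
  rw [h1]
  calc _ ≤ ∑ f : ι → Option κ, |Matrix.det (Matrix.of fun c => v c (f c))| := Finset.abs_sum_le_sum_abs _ _
    _ ≤ ∑ f : ι → Option κ, _ := Finset.sum_le_sum (fun f _ => h2 f)
    _ = _ := by
      simp [Fintype.card_option]; ring


open MvPolynomial in
lemma finrank_V (N : ℕ) : Module.finrank ℝ (restrictTotalDegree (Fin 2) ℝ N) * 2 = (N+1)*(N+2) := by
  have h1 : Module.finrank ℝ (restrictTotalDegree (Fin 2) ℝ N) =
      Nat.card {s : Fin 2 →₀ ℕ | s.sum (fun _ e ↦ e) ≤ N} :=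
    Module.finrank_eq_nat_card_basis (basisRestrictSupport ℝ {s : Fin 2 →₀ ℕ | s.sum (fun _ e ↦ e) ≤ N})
  have hs : ∀ s : Fin 2 →₀ ℕ, s.sum (fun _ e ↦ e) = s 0 + s 1 := by
    intro s; rw [Finsupp.sum_fintype _ _ (fun _ => rfl)]; simp
  have h2 : Nat.card {s : Fin 2 →₀ ℕ | s.sum (fun _ e ↦ e) ≤ N} =
      Nat.card ((Finset.range (N+1)).sigma (fun s => Finset.range (s+1)) : Finset (Σ _ : ℕ, ℕ)) := by
    apply Nat.card_congr
    refine ⟨fun s => ⟨⟨s.1 0 + s.1 1, s.1 0⟩, ?_⟩, fun t => ⟨Finsupp.equivFunOnFinite.symm ![t.1.2, t.1.1 - t.1.2], ?_⟩, ?_, ?_⟩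
    · have := s.2; simp only [Set.mem_ofPred_eq, hs] at this; simp; omega
    · obtain ⟨⟨a, b⟩, h⟩ := t; simp at h; simp only [Set.mem_ofPred_eq, hs]; simp; omega
    · intro s; ext i; fin_cases i <;> simp
    · rintro ⟨⟨a, b⟩, h⟩
      simp at h
      simp; omega
  rw [h1, h2]
  rw [Nat.card_eq_fintype_card, Fintype.card_coe, Finset.card_sigma]
  simp only [Finset.card_range]
  clear h1 h2
  induction N with
  | zero => simp
  | succ n ih => rw [Finset.sum_range_succ]; linarith

open MvPolynomial in
lemma exists_interp (Z : Finset (Fin 2 → ℝ)) (z : Fin 2 → ℝ) (_hz : z ∈ Z) :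
    ∃ p : MvPolynomial (Fin 2) ℝ, p.totalDegree ≤ Z.card ∧ eval z p = 1 ∧ ∀ w ∈ Z, w ≠ z → eval w p = 0 := by
  have h1 : ∀ w : Fin 2 → ℝ, ∃ p : MvPolynomial (Fin 2) ℝ, p.totalDegree ≤ 1 ∧ eval z p = 1 ∧ (w ≠ z → eval w p = 0) := by
    intro w
    by_cases h : w = z
    · exact ⟨1, by simp, by simp, fun h' => absurd h h'⟩
    · have : ∃ i, w i ≠ z i := by by_contra hh; push Not at hh; exact h (funext hh)
      obtain ⟨i, hi⟩ := this
      have hi' : z i - w i ≠ 0 := sub_ne_zero.mpr (Ne.symm hi)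
      refine ⟨C (z i - w i)⁻¹ * (X i - C (w i)), ?_, ?_, ?_⟩
      · refine (totalDegree_mul _ _).trans ?_
        have := totalDegree_sub_C_le (X i : MvPolynomial (Fin 2) ℝ) (w i)
        simp at this ⊢; omega
      · simp [hi']
      · intro; simp
  choose p hp1 hp2 hp3 using h1
  refine ⟨∏ w ∈ Z, p w, ?_, ?_, ?_⟩
  · refine (totalDegree_finsetProd _ _).trans ((Finset.sum_le_sum (fun i _ => hp1 i)).trans (by simp))
  · simp [map_prod, hp2]
  · intro w hw hne
    rw [map_prod]
    exact Finset.prod_eq_zero hw (hp3 w hne)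

open MvPolynomial in
lemma bezout (g q : MvPolynomial (Fin 2) ℝ) (hg : Prime g) (hq : ¬ g ∣ q) (Z : Finset (Fin 2 → ℝ))
    (hZg : ∀ z ∈ Z, eval z g = 0) (hZq : ∀ z ∈ Z, eval z q = 0) :
    Z.card ≤ g.totalDegree * q.totalDegree := by
  set d := g.totalDegree with hd
  set e := q.totalDegree with he
  set m := Z.card with hm
  have hg0 : g ≠ 0 := hg.ne_zero
  have hq0 : q ≠ 0 := fun h => hq (h ▸ dvd_zero g)
  set N := d + e + m with hN
  let V := fun k => restrictTotalDegree (Fin 2) ℝ k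
  have mulmap : ∀ (f : MvPolynomial (Fin 2) ℝ) (k k' : ℕ), f.totalDegree + k ≤ k' →
      ∃ φ : V k →ₗ[ℝ] V k', ∀ a, (φ a : MvPolynomial (Fin 2) ℝ) = f * a := by
    intro f k k' hk
    refine ⟨((LinearMap.mulLeft ℝ f).comp (V k).subtype).codRestrict (V k') ?_, fun a => rfl⟩
    intro c
    have := (mem_restrictTotalDegree (Fin 2) k c.1).mp c.2
    refine (mem_restrictTotalDegree (Fin 2) k' _).mpr ?_
    refine (totalDegree_mul _ _).trans ?_
    simp; omega
  obtain ⟨φg, hφg⟩ := mulmap g (e+m) N (by omega)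
  obtain ⟨φq, hφq⟩ := mulmap q (d+m) N (by omega)
  obtain ⟨ψg, hψg⟩ := mulmap g m (d+m) (by omega)
  obtain ⟨ψq, hψq⟩ := mulmap q m (e+m) (by omega)
  let Φ : (V (e+m) × V (d+m)) →ₗ[ℝ] V N := φg.coprod φq
  let Ψ : V m →ₗ[ℝ] (V (e+m) × V (d+m)) := ψq.prod (-ψg)
  have hker : LinearMap.ker Φ ≤ LinearMap.range Ψ := by
    rintro ⟨A, B⟩ hAB
    have h1 : g * (A : MvPolynomial (Fin 2) ℝ) + q * B = 0 := by
      have := congrArg (Subtype.val) (LinearMap.mem_ker.mp hAB)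
      simpa [Φ, hφg, hφq] using this
    have h2 : g ∣ q * B := by
      refine ⟨-A, by linear_combination h1⟩
    obtain ⟨Cc, hC⟩ := (hg.dvd_or_dvd h2).resolve_left hq
    have h3 : (A : MvPolynomial (Fin 2) ℝ) = q * (-Cc) := by
      apply mul_left_cancel₀ hg0
      rw [hC] at h1
      linear_combination h1
    have hdeg : (-Cc).totalDegree ≤ m := by
      by_cases hc : Cc = 0
      · simp [hc]
      · have := (mem_restrictTotalDegree (Fin 2) _ _).mp A.2
        rw [h3, totalDegree_mul_of_isDomain hq0 (neg_ne_zero.mpr hc)] at this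
        omega
    refine ⟨⟨-Cc, (mem_restrictTotalDegree (Fin 2) _ _).mpr hdeg⟩, ?_⟩
    ext1
    · apply Subtype.ext
      simp [Ψ, hψq, h3]
    · apply Subtype.ext
      simp [Ψ, hψg, hC]
  let ev : V N →ₗ[ℝ] (Z → ℝ) := LinearMap.pi (fun z => (MvPolynomial.aeval (R := ℝ) z.1).toLinearMap.comp (V N).subtype)
  have hev : ∀ (p : V N) (z : Z), ev p z = eval z.1 p.1 := by
    intro p z; simp [ev, MvPolynomial.aeval_eq_eval]
  have hsurj : Function.Surjective ev := by
    intro u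
    choose p hp1 hp2 hp3 using exists_interp Z
    let P : V N := ∑ z : Z, u z • ⟨p z.1 z.2, (mem_restrictTotalDegree (Fin 2) _ _).mpr ((hp1 z.1 z.2).trans (by omega))⟩
    refine ⟨P, ?_⟩
    ext w
    rw [hev]
    have : (P : MvPolynomial (Fin 2) ℝ) = ∑ z : Z, u z • p z.1 z.2 := by
      simp [P, Submodule.coe_sum]
    rw [this, map_sum, Finset.sum_eq_single w]
    · simp [smul_eval, hp2]
    · intro z _ hzw
      rw [smul_eval, hp3 z.1 z.2 w.1 w.2 (fun h => hzw (Subtype.ext h.symm)), mul_zero]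
    · simp
  have hcomp : LinearMap.range Φ ≤ LinearMap.ker ev := by
    rintro _ ⟨⟨A, B⟩, rfl⟩
    rw [LinearMap.mem_ker]
    ext z
    rw [hev]
    simp [Φ, hφg, hφq, hZg z.1 z.2, hZq z.1 z.2]
  have r1 := LinearMap.finrank_range_add_finrank_ker Φ
  have r2 := LinearMap.finrank_range_add_finrank_ker ev
  rw [LinearMap.range_eq_top.mpr hsurj, finrank_top] at r2
  have r3 := Submodule.finrank_mono hcomp
  have r4 := Submodule.finrank_mono hker
  have r5 := LinearMap.finrank_range_le Ψ
  rw [Module.finrank_prod] at r1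
  simp only [Module.finrank_fintype_fun_eq_card, Fintype.card_coe] at r2
  have f1 := finrank_V N
  have f2 := finrank_V (e+m)
  have f3 := finrank_V (d+m)
  have f4 := finrank_V m
  change Module.finrank ℝ (V _) * 2 = _ at f1 f2 f3 f4
  have : 2 * Z.card + (e+m+1)*(e+m+2) + (d+m+1)*(d+m+2) ≤ (N+1)*(N+2) + (m+1)*(m+2) := by
    rw [← f1, ← f2, ← f3, ← f4]
    omega
  rw [hN] at this
  rw [← hm] at this
  nlinarith


open MvPolynomial in
lemma totalDegree_shift (p : MvPolynomial (Fin 2) ℝ) (v : Fin 2 → ℝ) :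
    (aeval (fun i => (X i + C (v i) : MvPolynomial (Fin 2) ℝ)) p).totalDegree ≤ p.totalDegree := by
  rw [aeval_def, eval₂_eq]
  refine totalDegree_finsetSum_le ?_
  intro s hs
  refine (totalDegree_mul _ _).trans ?_
  have h1 : (algebraMap ℝ (MvPolynomial (Fin 2) ℝ) (coeff s p)).totalDegree = 0 := totalDegree_C _
  rw [h1, zero_add]
  refine le_trans ?_ (le_totalDegree hs)
  refine (totalDegree_finsetProd _ _).trans ?_
  rw [Finsupp.sum]
  apply Finset.sum_le_sum
  intro i _
  refine (totalDegree_pow _ _).trans ?_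
  have : (X i + C (v i) : MvPolynomial (Fin 2) ℝ).totalDegree ≤ 1 := by
    refine (totalDegree_add _ _).trans ?_
    simp
  nlinarith

open MvPolynomial in
lemma eval_shift (p : MvPolynomial (Fin 2) ℝ) (v x : Fin 2 → ℝ) :
    eval x (aeval (fun i => (X i + C (v i) : MvPolynomial (Fin 2) ℝ)) p) = eval (x + v) p := by
  rw [← MvPolynomial.aeval_eq_eval, ← MvPolynomial.aeval_eq_eval]
  rw [← AlgHom.comp_apply, comp_aeval]
  congr 2
  ext i
  simp [MvPolynomial.aeval_eq_eval]

open MvPolynomial in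
lemma plane_count (S Δ : Finset (Fin 2 → ℝ)) (hΔ : ∀ x ∈ S, ∀ y ∈ S, y - x ∈ Δ) (A Q : ℕ)
    (hQ : Δ.card ≤ Q ^ 2) (hQA : Q + 1 ≤ A)
    (hline : ∀ a b c : ℝ, (a ≠ 0 ∨ b ≠ 0) → (S.filter (fun x => a * x 0 + b * x 1 = c)).card ≤ A)
    (f : MvPolynomial (Fin 2) ℝ) (hf : f ≠ 0) :
    (S.filter (fun x => eval x f = 0)).card ≤ f.totalDegree * A := by
  classical
  have hirr : ∀ g : MvPolynomial (Fin 2) ℝ, Prime g → (S.filter (fun x => eval x g = 0)).card ≤ g.totalDegree * A := by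
    intro g hg
    set Z := S.filter (fun x => eval x g = 0) with hZ
    set d := g.totalDegree with hd
    have hd1 : 1 ≤ d := by
      by_contra hcon
      have h0 : g.totalDegree = 0 := by omega
      rw [totalDegree_eq_zero_iff_eq_C] at h0
      apply hg.not_isUnit
      rw [h0]
      have : coeff 0 g ≠ 0 := by
        intro h1; rw [h1, C_0] at h0; exact hg.ne_zero h0
      exact (IsUnit.mk0 _ this).map C
    by_cases hv : ∃ v : Fin 2 → ℝ, v ≠ 0 ∧ g ∣ aeval (fun i => (X i + C (v i) : MvPolynomial (Fin 2) ℝ)) g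
    · obtain ⟨v, hv0, hdiv⟩ := hv
      have hinv : ∀ x, eval x g = 0 → eval (x + v) g = 0 := by
        intro x hx
        obtain ⟨c, hc⟩ := hdiv
        rw [← eval_shift, hc, map_mul, hx, zero_mul]
      rcases Z.eq_empty_or_nonempty with he | ⟨x0, hx0⟩
      · rw [he]; simp
      have hx0' : eval x0 g = 0 := (Finset.mem_filter.mp hx0).2
      have hk : ∀ k : ℕ, eval (x0 + (k:ℝ) • v) g = 0 := by
        intro k
        induction k with
        | zero => simpa using hx0'
        | succ k ih =>
          have := hinv _ ih
          rw [show x0 + ((k+1:ℕ):ℝ) • v = x0 + (k:ℝ) • v + v by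
            push_cast; rw [add_smul, one_smul, add_assoc]]
          exact this
      let ℓ : MvPolynomial (Fin 2) ℝ := C (v 1) * X 0 + C (-(v 0)) * X 1 - C (v 1 * x0 0 - v 0 * x0 1)
      have hℓ : ∀ x, eval x ℓ = v 1 * x 0 + (-(v 0)) * x 1 - (v 1 * x0 0 - v 0 * x0 1) := by
        intro x; simp [ℓ]
      have hgl : g ∣ ℓ := by
        by_contra hnd
        let B := g.totalDegree * ℓ.totalDegree
        have hinj : Function.Injective (fun k : ℕ => x0 + (k:ℝ) • v) := by
          intro k k' hkk
          simp only [add_right_inj] at hkk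
          have := smul_left_injective ℝ hv0 hkk
          exact_mod_cast this
        have := bezout g ℓ hg hnd ((Finset.range (B+1)).image (fun k : ℕ => x0 + (k:ℝ) • v))
          (by
            intro z hz
            obtain ⟨k, _, rfl⟩ := Finset.mem_image.mp hz
            exact hk k)
          (by
            intro z hz
            obtain ⟨k, _, rfl⟩ := Finset.mem_image.mp hz
            rw [hℓ]; simp; ring)
        rw [Finset.card_image_of_injective _ hinj, Finset.card_range] at this
        omega
      have hsub : Z ⊆ S.filter (fun x => v 1 * x 0 + (-(v 0)) * x 1 = v 1 * x0 0 - v 0 * x0 1) := by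
        intro x hx
        obtain ⟨h1, h2⟩ := Finset.mem_filter.mp hx
        refine Finset.mem_filter.mpr ⟨h1, ?_⟩
        obtain ⟨c, hc⟩ := hgl
        have := hℓ x
        rw [hc, map_mul, h2, zero_mul] at this
        linarith
      have h3 := (Finset.card_le_card hsub).trans (hline (v 1) (-(v 0)) _ (by
        by_contra hcon
        push Not at hcon
        apply hv0
        ext i
        fin_cases i
        · simpa using hcon.2
        · simpa using hcon.1))
      nlinarith
    · push Not at hv
      have h1 : ∀ v ∈ Δ.erase 0, (Z.filter (fun x => x + v ∈ Z)).card ≤ d * d := by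
        intro v hvΔ
        have hv0 := Finset.ne_of_mem_erase hvΔ
        refine (bezout g _ hg (hv v hv0) (Z.filter (fun x => x + v ∈ Z)) ?_ ?_).trans ?_
        · intro z hz
          exact (Finset.mem_filter.mp (Finset.mem_filter.mp hz).1).2
        · intro z hz
          rw [eval_shift]
          exact (Finset.mem_filter.mp (Finset.mem_filter.mp hz).2).2
        · exact Nat.mul_le_mul_left _ (totalDegree_shift g v)
      have h2 : Z.offDiag.card ≤ ∑ v ∈ Δ.erase 0, (Z.filter (fun x => x + v ∈ Z)).card := by
        rw [← Finset.card_sigma]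
        apply Finset.card_le_card_of_injOn (fun p => ⟨p.2 - p.1, p.1⟩)
        · rintro ⟨x, y⟩ hp
          simp only [Finset.coe_offDiag, Set.mem_offDiag, Finset.mem_coe] at hp
          obtain ⟨hx, hy, hne⟩ := hp
          simp only [Finset.coe_sigma, Set.mem_sigma_iff, Finset.mem_coe, Finset.mem_erase, Finset.mem_filter]
          refine ⟨⟨sub_ne_zero.mpr (Ne.symm hne), hΔ x (Finset.mem_filter.mp hx).1 y (Finset.mem_filter.mp hy).1⟩, hx, ?_⟩
          simpa using hy
        · rintro ⟨x, y⟩ _ ⟨x', y'⟩ _ hxy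
          simp only [Sigma.mk.injEq, heq_eq_eq] at hxy
          obtain ⟨h1, rfl⟩ := hxy
          simpa using h1
      have h3 : Z.offDiag.card ≤ Q ^ 2 * (d * d) := by
        refine h2.trans ((Finset.sum_le_sum h1).trans ?_)
        rw [Finset.sum_const, smul_eq_mul]
        exact Nat.mul_le_mul_right _ ((Finset.card_le_card (Finset.erase_subset _ _)).trans hQ)
      rw [Finset.offDiag_card] at h3
      have h4 : Z.card ≤ Q * d + 1 := by
        by_contra hcon
        push Not at hcon
        obtain ⟨w, hw⟩ : ∃ w, Z.card = Q * d + 2 + w := ⟨Z.card - (Q*d+2), by omega⟩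
        rw [hw] at h3
        have : (Q * d + 2 + w) * (Q * d + 2 + w) - (Q * d + 2 + w) = (Q*d+2+w) * (Q*d+1+w) := by
          rw [Nat.sub_eq_iff_eq_add (Nat.le_mul_self _)]; ring
        rw [this, show Q ^ 2 * (d * d) = (Q * d) * (Q * d) by ring] at h3
        clear this hw hcon
        generalize Q * d = u at h3 ⊢
        nlinarith
      nlinarith
  revert hf
  induction f using UniqueFactorizationMonoid.induction_on_prime with
  | h₁ => intro h; exact absurd rfl h
  | h₂ x hx =>
    intro _
    have : S.filter (fun z => eval z x = 0) = ∅ := by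
      apply Finset.filter_eq_empty_iff.mpr
      intro z _
      exact (hx.map (eval z)).ne_zero
    rw [this]; simp
  | h₃ a p ha hp ih =>
    intro _
    have h1 := ih ha
    rw [totalDegree_mul_of_isDomain hp.ne_zero ha, add_mul]
    refine le_trans ?_ (add_le_add (hirr p hp) h1)
    refine le_trans (Finset.card_le_card ?_) (Finset.card_union_le _ _)
    intro z hz
    simp only [Finset.mem_filter, map_mul, mul_eq_zero, Finset.mem_union] at hz ⊢
    tauto


lemma det_pow_ne {R : Type*} [CommRing R] [IsDomain R] (k : ℕ) (u : Fin k → R) (hu : Function.Injective u) :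
    (Matrix.of fun (m j : Fin k) => u j ^ (m : ℕ)).det ≠ 0 := by
  have : (Matrix.of fun (m j : Fin k) => u j ^ (m : ℕ)) = (Matrix.vandermonde u).transpose := by
    ext i j; simp [Matrix.vandermonde]
  rw [this, Matrix.det_transpose]
  exact Matrix.det_vandermonde_ne_zero_iff.mpr hu

open Polynomial in
lemma elim_ne {R : Type*} [CommRing R] [IsDomain R] (k : ℕ) (p : Fin k → R[X]) (hp : ∀ j, p j ≠ 0)
    (u : Fin k → R) (hu : Function.Injective u) :
    (Matrix.of fun (m j : Fin k) => ((p j).comp (X + C ((m : ℕ) : R))) * C (u j ^ (m : ℕ))).det ≠ 0 := by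
  set M := (Matrix.of fun (m j : Fin k) => ((p j).comp (X + C ((m : ℕ) : R))) * C (u j ^ (m : ℕ))) with hM
  let D := ∑ j, (p j).natDegree
  have hD : ∀ j, (p j).natDegree ≤ D := fun j => Finset.single_le_sum (f := fun j => (p j).natDegree) (fun _ _ => Nat.zero_le _) (Finset.mem_univ j)
  have hdeg : ∀ m j, (X ^ (D - (p j).natDegree) * M m j).natDegree ≤ D := by
    intro m j
    refine natDegree_mul_le.trans ?_
    have h1 : (M m j).natDegree ≤ (p j).natDegree := by
      simp only [hM, Matrix.of_apply]
      refine (natDegree_mul_C_le _ _).trans ?_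
      rw [natDegree_comp, natDegree_X_add_C, mul_one]
    have := hD j
    rw [natDegree_X_pow]; omega
  have hco : ∀ m j : Fin k, (X ^ (D - (p j).natDegree) * M m j).coeff D = (p j).leadingCoeff * u j ^ (m : ℕ) := by
    intro m j
    have h2 : D = (p j).natDegree + (D - (p j).natDegree) := by have := hD j; omega
    conv_lhs => rw [h2]
    simp only [Nat.add_sub_cancel_left]
    rw [coeff_X_pow_mul]
    simp only [hM, Matrix.of_apply]
    rw [coeff_mul_C]
    congr 1
    have := coeff_comp_degree_mul_degree (p := p j) (q := X + C ((m : ℕ) : R)) (by rw [natDegree_X_add_C]; exact one_ne_zero)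
    rw [natDegree_X_add_C, mul_one] at this
    rw [this, leadingCoeff_X_add_C, one_pow, mul_one]
  have h3 : (Matrix.of fun m j => X ^ (D - (p j).natDegree) * M m j).det = (∏ j, X ^ (D - (p j).natDegree)) * M.det :=
    Matrix.det_mul_row _ _
  have h4 : ((Matrix.of fun m j => X ^ (D - (p j).natDegree) * M m j).det).coeff (k * D) =
      (Matrix.of fun (m j : Fin k) => (p j).leadingCoeff * u j ^ (m : ℕ)).det := by
    rw [Matrix.det_apply, Matrix.det_apply, finsetSum_coeff]
    apply Finset.sum_congr rfl
    intro σ _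
    rw [coeff_smul]
    congr 1
    have := coeff_prod_of_natDegree_le (s := (Finset.univ : Finset (Fin k))) (fun i => (Matrix.of fun m j => X ^ (D - (p j).natDegree) * M m j) (σ i) i) D (fun i _ => by simpa using hdeg (σ i) i)
    simp only [Finset.card_univ, Fintype.card_fin] at this
    rw [this]
    apply Finset.prod_congr rfl
    intro i _
    simpa using hco (σ i) i
  intro h0
  rw [h3, h0, mul_zero, coeff_zero] at h4
  have h5 := Matrix.det_mul_row (fun j => (p j).leadingCoeff) (Matrix.of fun (m j : Fin k) => u j ^ (m : ℕ))
  simp only [Matrix.of_apply] at h5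
  rw [h5] at h4
  have h6 : ∏ j, (p j).leadingCoeff ≠ 0 := Finset.prod_ne_zero_iff.mpr (fun j _ => leadingCoeff_ne_zero.mpr (hp j))
  exact mul_ne_zero h6 (det_pow_ne k u hu) h4.symm

lemma det_zero_of_sum {k : ℕ} (M : Matrix (Fin k) (Fin k) ℝ) (hk : 0 < k) (w : Fin k → ℝ) (hw : ∀ j, w j ≠ 0)
    (h : ∀ m, ∑ j, M m j * w j = 0) : M.det = 0 := by
  apply Matrix.exists_mulVec_eq_zero_iff.mp
  refine ⟨w, fun h0 => hw ⟨0, hk⟩ (congrFun h0 _), ?_⟩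
  ext m
  simpa [Matrix.mulVec, dotProduct] using h m

lemma pow_inj_aux {y : ℝ} (hy : 0 < y) (hy1 : y ≠ 1) : Function.Injective (fun l : ℕ => y ^ l) :=
  pow_right_injective₀ hy hy1

open Polynomial in
lemma lemmaU (L K : ℕ) (hK : 0 < K) (p : ℕ → ℝ[X]) (hdeg : ∀ l < L, (p l).natDegree < K)
    (y : ℝ) (hy : 0 < y) (hy1 : y ≠ 1) (T : Finset ℝ) (θ : ℝ → ℝ) (hθ : ∀ t, 0 < θ t)
    (hT : (K - 1) * L < T.card)
    (h : ∀ t ∈ T, ∀ m < L, ∑ l ∈ Finset.range L, (p l).eval (t + m) * (y ^ m * θ t) ^ l = 0) :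
    ∀ l < L, p l = 0 := by
  classical
  by_contra hcon
  push Not at hcon
  let I := (Finset.range L).filter (fun l => p l ≠ 0)
  have hI : I.Nonempty := by
    obtain ⟨l, h1, h2⟩ := hcon
    exact ⟨l, by simp [I, h1, h2]⟩
  set k := I.card with hk
  have hk0 : 0 < k := Finset.card_pos.mpr hI
  have hkL : k ≤ L := (Finset.card_le_card (Finset.filter_subset _ _)).trans (by simp)
  let e := I.orderEmbOfFin hk.symm
  have he : ∀ j, e j < L ∧ p (e j) ≠ 0 := by
    intro j
    have := I.orderEmbOfFin_mem hk.symm j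
    have := Finset.mem_filter.mp this
    exact ⟨Finset.mem_range.mp this.1, this.2⟩
  have hsum : ∀ (g : ℕ → ℝ), (∀ l < L, p l = 0 → g l = 0) → ∑ l ∈ Finset.range L, g l = ∑ j : Fin k, g (e j) := by
    intro g hg
    have h1 : ∑ l ∈ I, g l = ∑ l ∈ Finset.range L, g l := by
      apply Finset.sum_subset (Finset.filter_subset _ _)
      intro l hl hl'
      apply hg l (by simpa using hl)
      by_contra h0
      exact hl' (Finset.mem_filter.mpr ⟨hl, h0⟩)
    rw [← h1]
    have h2 : Finset.univ.map e.toEmbedding = I := Finset.map_orderEmbOfFin_univ I hk.symm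
    conv_lhs => rw [← h2, Finset.sum_map]
    rfl
  have hu : Function.Injective (fun j : Fin k => y ^ (e j)) :=
    (pow_inj_aux hy hy1).comp e.injective
  have hne := elim_ne k (fun j => p (e j)) (fun j => (he j).2) _ hu
  set f := (Matrix.of fun (m j : Fin k) => ((p (e j)).comp (X + C ((m : ℕ) : ℝ))) * C ((y ^ (e j)) ^ (m : ℕ))).det with hf
  have hfdeg : f.natDegree ≤ (K - 1) * L := by
    rw [hf, Matrix.det_apply]
    apply natDegree_sum_le_of_forall_le
    intro σ _
    have h1 : ∀ (z : ℤˣ) (q : ℝ[X]), (z • q).natDegree ≤ q.natDegree := by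
      intro z q
      rcases Int.units_eq_one_or z with h | h <;> simp [h]
    refine (h1 _ _).trans ((natDegree_prod_le _ _).trans ?_)
    calc _ ≤ ∑ i : Fin k, (K - 1) := by
          apply Finset.sum_le_sum
          intro i _
          simp only [Matrix.of_apply]
          refine (natDegree_mul_C_le _ _).trans ?_
          rw [natDegree_comp, natDegree_X_add_C, mul_one]
          have := hdeg _ (he i).1
          omega
      _ ≤ _ := by simp; rw [mul_comm]; exact Nat.mul_le_mul_left _ hkL
  have hroots : T ⊆ f.roots.toFinset := by
    intro t ht
    rw [Multiset.mem_toFinset, mem_roots hne, IsRoot.def, hf]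
    rw [← coe_evalRingHom, RingHom.map_det]
    apply det_zero_of_sum _ hk0 (fun j => θ t ^ (e j)) (fun j => (pow_pos (hθ t) _).ne')
    intro m
    have := h t ht m (by omega)
    rw [hsum _ (fun l _ h0 => by simp [h0])] at this
    rw [← this]
    apply Finset.sum_congr rfl
    intro j _
    simp [eval_comp]
    ring
  have := (Finset.card_le_card hroots).trans ((Multiset.toFinset_card_le _).trans (card_roots' f))
  omega

lemma finSucc_shift (p : MvPolynomial (Fin 2) ℝ) (m : ℝ) :
    MvPolynomial.finSuccEquiv ℝ 1 (MvPolynomial.aeval (fun i => (MvPolynomial.X i + MvPolynomial.C ((![m, 0] : Fin 2 → ℝ) i) : MvPolynomial (Fin 2) ℝ)) p)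
    = (MvPolynomial.finSuccEquiv ℝ 1 p).comp (Polynomial.X + Polynomial.C (MvPolynomial.C m)) := by
  induction p using MvPolynomial.induction_on with
  | C a => simp [MvPolynomial.finSuccEquiv_apply]
  | add p q hp hq => simp only [map_add, Polynomial.add_comp, hp, hq]
  | mul_X p i hp =>
    have key : MvPolynomial.finSuccEquiv ℝ 1 (MvPolynomial.X i + MvPolynomial.C ((![m, 0] : Fin 2 → ℝ) i))
        = (MvPolynomial.finSuccEquiv ℝ 1 (MvPolynomial.X i)).comp (Polynomial.X + Polynomial.C (MvPolynomial.C m)) := by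
      revert i
      rw [Fin.forall_fin_two]
      constructor
      · rw [map_add, MvPolynomial.finSuccEquiv_X_zero, Polynomial.X_comp]
        simp [MvPolynomial.finSuccEquiv_apply]
      · rw [show (1 : Fin 2) = Fin.succ (0 : Fin 1) from rfl, map_add, MvPolynomial.finSuccEquiv_X_succ, Polynomial.C_comp]
        simp
    rw [map_mul, MvPolynomial.aeval_X, map_mul, map_mul, Polynomial.mul_comp, hp, key]

open MvPolynomial in
lemma elim2 (L K : ℕ) (hK : 0 < K) (P : ℕ → MvPolynomial (Fin 2) ℝ) (hdeg : ∀ l < L, (P l).totalDegree < K)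
    (y : ℝ) (hy : 0 < y) (hy1 : y ≠ 1) (hcon : ∃ l < L, P l ≠ 0) :
    ∃ f : MvPolynomial (Fin 2) ℝ, f ≠ 0 ∧ f.totalDegree ≤ (K - 1) * L ∧
      ∀ (x : Fin 2 → ℝ) (θ : ℝ), 0 < θ →
        (∀ m < L, ∑ l ∈ Finset.range L, eval (x + ![(m : ℝ), 0]) (P l) * (y ^ m * θ) ^ l = 0) → eval x f = 0 := by
  classical
  let I := (Finset.range L).filter (fun l => P l ≠ 0)
  have hI : I.Nonempty := by
    obtain ⟨l, h1, h2⟩ := hcon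
    exact ⟨l, by simp [I, h1, h2]⟩
  set k := I.card with hk
  have hk0 : 0 < k := Finset.card_pos.mpr hI
  have hkL : k ≤ L := (Finset.card_le_card (Finset.filter_subset _ _)).trans (by simp)
  let e := I.orderEmbOfFin hk.symm
  have he : ∀ j, e j < L ∧ P (e j) ≠ 0 := by
    intro j
    have := I.orderEmbOfFin_mem hk.symm j
    have := Finset.mem_filter.mp this
    exact ⟨Finset.mem_range.mp this.1, this.2⟩
  have hsum : ∀ (g : ℕ → ℝ), (∀ l < L, P l = 0 → g l = 0) → ∑ l ∈ Finset.range L, g l = ∑ j : Fin k, g (e j) := by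
    intro g hg
    have h1 : ∑ l ∈ I, g l = ∑ l ∈ Finset.range L, g l := by
      apply Finset.sum_subset (Finset.filter_subset _ _)
      intro l hl hl'
      apply hg l (by simpa using hl)
      by_contra h0
      exact hl' (Finset.mem_filter.mpr ⟨hl, h0⟩)
    rw [← h1]
    have h2 : Finset.univ.map e.toEmbedding = I := Finset.map_orderEmbOfFin_univ I hk.symm
    conv_lhs => rw [← h2, Finset.sum_map]
    rfl
  let M : Matrix (Fin k) (Fin k) (MvPolynomial (Fin 2) ℝ) := Matrix.of fun (m j : Fin k) =>
    (aeval (fun i => (X i + C ((![((m : ℕ) : ℝ), 0] : Fin 2 → ℝ) i) : MvPolynomial (Fin 2) ℝ)) (P (e j))) * C ((y ^ (e j)) ^ (m : ℕ))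
  refine ⟨M.det, ?_, ?_, ?_⟩
  · have hu : Function.Injective (fun j : Fin k => (C (y ^ (e j)) : MvPolynomial (Fin 1) ℝ)) :=
      (C_injective (Fin 1) ℝ).comp ((pow_inj_aux hy hy1).comp e.injective)
    have hne := elim_ne k (fun j => finSuccEquiv ℝ 1 (P (e j))) (fun j => by simpa using (he j).2) _ hu
    intro h0
    apply hne
    have h1 := AlgEquiv.map_det (finSuccEquiv ℝ 1) M
    rw [h0, map_zero] at h1
    rw [h1]
    congr 1
    ext1 m j
    simp only [M, Matrix.of_apply, AlgEquiv.mapMatrix_apply, Matrix.map_apply, map_mul, finSucc_shift]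
    congr 1
    simp [finSuccEquiv_apply]
  · rw [Matrix.det_apply]
    apply totalDegree_finsetSum_le
    intro σ _
    have h1 : ∀ (z : ℤˣ) (q : MvPolynomial (Fin 2) ℝ), (z • q).totalDegree ≤ q.totalDegree := by
      intro z q
      rcases Int.units_eq_one_or z with h | h <;> simp [h]
    refine (h1 _ _).trans ((totalDegree_finsetProd _ _).trans ?_)
    calc _ ≤ ∑ i : Fin k, (K - 1) := by
          apply Finset.sum_le_sum
          intro i _
          simp only [M, Matrix.of_apply]
          refine (totalDegree_mul _ _).trans ?_
          have h2 := totalDegree_shift (P (e i)) ![(((σ i : Fin k) : ℕ) : ℝ), 0]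
          have := hdeg _ (he i).1
          rw [totalDegree_C, add_zero]
          refine le_trans h2 ?_
          omega
      _ ≤ _ := by simp; rw [mul_comm]; exact Nat.mul_le_mul_left _ hkL
  · intro x θ hθ h
    rw [RingHom.map_det]
    apply det_zero_of_sum _ hk0 (fun j => θ ^ (e j)) (fun j => (pow_pos hθ _).ne')
    intro m
    have := h m (by omega)
    rw [hsum _ (fun l _ h0 => by simp [h0])] at this
    rw [← this]
    apply Finset.sum_congr rfl
    intro j _
    simp only [M, RingHom.mapMatrix_apply, Matrix.map_apply, Matrix.of_apply, map_mul, eval_shift, eval_C]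
    ring


lemma restrict_line (P : MvPolynomial (Fin 2) ℝ) (z v : Fin 2 → ℝ) :
    ∃ p : Polynomial ℝ, p.natDegree ≤ P.totalDegree ∧ ∀ τ : ℝ, p.eval τ = MvPolynomial.eval (z + τ • v) P := by
  refine ⟨MvPolynomial.aeval (fun i => Polynomial.C (z i) + Polynomial.C (v i) * Polynomial.X) P, ?_, ?_⟩
  · rw [MvPolynomial.aeval_def, MvPolynomial.eval₂_eq]
    apply Polynomial.natDegree_sum_le_of_forall_le
    intro s hs
    refine Polynomial.natDegree_mul_le.trans ?_
    have h1 : (algebraMap ℝ (Polynomial ℝ) (MvPolynomial.coeff s P)).natDegree = 0 := Polynomial.natDegree_C _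
    rw [h1, zero_add]
    refine le_trans ?_ (MvPolynomial.le_totalDegree hs)
    refine (Polynomial.natDegree_prod_le _ _).trans ?_
    rw [Finsupp.sum]
    apply Finset.sum_le_sum
    intro i _
    refine Polynomial.natDegree_pow_le.trans ?_
    have : (Polynomial.C (z i) + Polynomial.C (v i) * Polynomial.X).natDegree ≤ 1 := by
      refine (Polynomial.natDegree_add_le _ _).trans ?_
      simp only [Polynomial.natDegree_C, zero_le, sup_of_le_right]
      simpa using Polynomial.natDegree_C_mul_X_pow_le (v i) 1
    nlinarith
  · intro τ
    have h1 : ∀ q : Polynomial ℝ, q.eval τ = Polynomial.aeval τ q := fun q => (Polynomial.coe_aeval_eq_eval τ ▸ rfl)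
    rw [h1, ← MvPolynomial.aeval_eq_eval, ← AlgHom.comp_apply, MvPolynomial.comp_aeval]
    congr 2
    ext i
    simp
    ring

lemma vanish_of_lines (P : MvPolynomial (Fin 2) ℝ) (K : ℕ) (hdeg : P.totalDegree < K) (d0 d1 : ℝ)
    (hd : d0 ≠ 0 ∨ d1 ≠ 0) (T : Finset ℝ) (hT : K ≤ T.card)
    (h : ∀ c ∈ T, ∀ x : Fin 2 → ℝ, d1 * x 0 - d0 * x 1 = c → MvPolynomial.eval x P = 0) : P = 0 := by
  apply MvPolynomial.funext
  intro x
  rw [map_zero]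
  have hN : 0 < d0 ^ 2 + d1 ^ 2 := by
    rcases hd with h | h <;> positivity
  obtain ⟨p, hp1, hp2⟩ := restrict_line P x ![d1 / (d0^2+d1^2), -d0/(d0^2+d1^2)]
  have hp0 : p = 0 := by
    by_contra hne
    let T' := T.image (fun c => c - (d1 * x 0 - d0 * x 1))
    have hT' : T'.card = T.card := Finset.card_image_of_injective _ (fun a b hab => by simpa using hab)
    have hsub : T' ⊆ p.roots.toFinset := by
      intro t ht
      obtain ⟨c, hc, rfl⟩ := Finset.mem_image.mp ht
      rw [Multiset.mem_toFinset, Polynomial.mem_roots hne, Polynomial.IsRoot.def, hp2]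
      apply h c hc
      simp
      field_simp
      ring
    have := (Finset.card_le_card hsub).trans ((Multiset.toFinset_card_le _).trans (Polynomial.card_roots' p))
    omega
  have := hp2 0
  rw [hp0] at this
  simpa using this.symm

lemma farey_aux (n a B x y : ℤ) (hB : 0 < B) (h1 : B ≤ 193 * n - 278 * a) (h2 : B ≤ 955 * a - 663 * n)
    (hy : |y| < 1000) (hxy : x ≠ 0 ∨ y ≠ 0) : B ≤ |x * n + y * a| := by
  obtain ⟨U, hU⟩ : ∃ U, U = 193 * n - 278 * a := ⟨_, rfl⟩
  obtain ⟨W, hW⟩ : ∃ W, W = 955 * a - 663 * n := ⟨_, rfl⟩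
  obtain ⟨i, hi⟩ : ∃ i, i = 955 * x + 663 * y := ⟨_, rfl⟩
  obtain ⟨j, hj⟩ : ∃ j, j = 278 * x + 193 * y := ⟨_, rfl⟩
  have e1 : x * n + y * a = U * i + W * j := by
    rw [hU, hW, hi, hj]; ring
  rw [← hU] at h1
  rw [← hW] at h2
  rw [abs_lt] at hy
  have hy2 : y = 955 * j - 278 * i := by rw [hi, hj]; ring
  have hx2 : x = 193 * i - 663 * j := by rw [hi, hj]; ring
  rw [e1]
  rcases lt_trichotomy i 0 with hi0 | hi0 | hi0
  · have hj0 : j ≤ 0 := by omega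
    apply le_trans _ (neg_le_abs _)
    nlinarith
  · rcases lt_trichotomy j 0 with hj0 | hj0 | hj0
    · apply le_trans _ (neg_le_abs _)
      rw [hi0]; nlinarith
    · exfalso
      rcases hxy with h | h <;> apply h
      · rw [hx2, hi0, hj0]; ring
      · rw [hy2, hi0, hj0]; ring
    · apply le_trans _ (le_abs_self _)
      rw [hi0]; nlinarith
  · have hj0 : 0 ≤ j := by omega
    apply le_trans _ (le_abs_self _)
    nlinarith

lemma coprime_div (c d x y : ℤ) (hcop : IsCoprime c d) (h : d * x = c * y) (hx : |x| < |c|) : x = 0 := by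
  have : c ∣ d * x := ⟨y, h⟩
  have h2 : c ∣ x := hcop.dvd_of_dvd_mul_left this
  exact Int.eq_zero_of_abs_lt_dvd ((abs_dvd c x).mpr h2) hx

set_option linter.constructorNameAsVariable false in
lemma line_values (n a : ℤ) (w H : ℕ) (hw : 10 ≤ w) (hH : 1 ≤ H)
    (h1 : 210000 * (H : ℤ) ≤ 193 * n - 278 * a) (h2 : 210000 * (H : ℤ) ≤ 955 * a - 663 * n)
    (cr cs : ℤ) (hcop : IsCoprime cr cs) :
    ∃ F : Finset (ℤ × ℤ × ℤ), 420000 * (w * H) ≤ F.card ∧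
      (∀ e ∈ F, |e.1| ≤ 315 * (w * H : ℕ) ∧ |e.2.1| ≤ 210 * (w * H : ℕ) ∧ |e.2.2| ≤ 1000 * (w : ℕ)) ∧
      Set.InjOn (fun e : ℤ × ℤ × ℤ => cs * (e.1 + n * e.2.2) - cr * (e.2.1 - a * e.2.2)) F := by
  have hwH : (10 : ℤ) ≤ w * H := by
    have : (10:ℤ) ≤ w := by exact_mod_cast hw
    have : (1:ℤ) ≤ H := by exact_mod_cast hH
    nlinarith
  have hHw : (H : ℤ) * 10 ≤ w * H := by
    have : (10:ℤ) ≤ w := by exact_mod_cast hw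
    have : (1:ℤ) ≤ H := by exact_mod_cast hH
    nlinarith
  by_cases hq : 1000 ≤ |cr|
  · refine ⟨(Finset.Ico 0 1000) ×ˢ (Finset.Icc (-(210 * (w * H : ℕ) : ℤ)) (210 * (w * H : ℕ))) ×ˢ {0}, ?_, ?_, ?_⟩
    · simp only [Finset.card_product, Int.card_Ico, Int.card_Icc, Finset.card_singleton]
      have : ((210 * ((w * H : ℕ) : ℤ) + 1 - -(210 * ((w * H : ℕ):ℤ))).toNat) = 420 * (w * H) + 1 := by
        push_cast; omega
      rw [this]; simp; omega
    · rintro ⟨r, s, t⟩ he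
      simp only [Finset.mem_product, Finset.mem_Ico, Finset.mem_Icc, Finset.mem_singleton] at he
      obtain ⟨⟨h1, h2⟩, ⟨h3, h4⟩, h5⟩ := he
      refine ⟨?_, ?_, ?_⟩
      · simp only [abs_le]; push_cast; constructor <;> omega
      · simp only [abs_le]; constructor <;> omega
      · simp [h5]
    · rintro ⟨r, s, t⟩ he ⟨r', s', t'⟩ he' heq
      simp only [Finset.coe_product, Set.mem_prod, Finset.mem_coe, Finset.mem_Ico, Finset.mem_Icc, Finset.mem_singleton] at he he'
      obtain ⟨⟨h1, h2⟩, ⟨h3, h4⟩, rfl⟩ := he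
      obtain ⟨⟨h1', h2'⟩, ⟨h3', h4'⟩, rfl⟩ := he'
      simp only [mul_zero, add_zero, sub_zero] at heq
      have hr : r - r' = 0 := coprime_div cr cs (r - r') (s - s') hcop (by linear_combination heq) (by
        refine lt_of_lt_of_le ?_ hq
        rw [abs_lt]; constructor <;> omega)
      have hr' : r = r' := by omega
      subst hr'
      have hs : cr * (s - s') = 0 := by linear_combination - heq
      have hcr : cr ≠ 0 := by intro h; rw [h] at hq; simp at hq
      have := (mul_eq_zero.mp hs).resolve_left hcr
      have : s = s' := by omega
      rw [this]
  · push Not at hq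
    have hne : cs ≠ 0 ∨ cr ≠ 0 := by
      by_contra hcon
      push Not at hcon
      rw [hcon.1, hcon.2] at hcop
      simp [isCoprime_zero_left] at hcop
    have hX := farey_aux n a (210000 * H) cs cr (by positivity) h1 h2 hq hne
    have hcard : 420000 * (w * H) ≤ 210 * H * (2000 * w + 1) := by nlinarith
    have htn : ((1000 * ((w : ℕ) : ℤ) + 1 - -(1000 * ((w : ℕ):ℤ))).toNat) = 2000 * w + 1 := by omega
    have hsn : ((210 * (H : ℤ) - 0).toNat) = 210 * H := by omega
    have key : ∀ c z t : ℤ, |c| < 1000 → c ≠ 0 → |z| < 210 * H → c * z = (cs * n + cr * a) * t → z = 0 ∧ t = 0 := by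
      intro c z t hc hc0 hz he
      have ht : t = 0 := by
        by_contra ht0
        have h3 : |c * z| = |cs * n + cr * a| * |t| := by rw [he, abs_mul]
        rw [abs_mul] at h3
        have h4 : 1 ≤ |t| := Int.one_le_abs ht0
        have h5 : |c| * |z| < 1000 * (210 * H) := by
          have := abs_nonneg c
          have := abs_nonneg z
          nlinarith
        nlinarith
      rw [ht, mul_zero] at he
      exact ⟨(mul_eq_zero.mp he).resolve_left hc0, ht⟩
    by_cases hcr : cr = 0
    · have hcs : |cs| < 1000 ∧ cs ≠ 0 := by
        rw [hcr, isCoprime_zero_left, Int.isUnit_iff] at hcop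
        rcases hcop with h | h <;> rw [h] <;> norm_num
      refine ⟨(Finset.Ico 0 (210 * (H : ℤ))) ×ˢ {0} ×ˢ (Finset.Icc (-(1000 * (w : ℕ) : ℤ)) (1000 * (w : ℕ))), ?_, ?_, ?_⟩
      · simp only [Finset.card_product, Int.card_Ico, Int.card_Icc, Finset.card_singleton, htn, hsn]
        simpa using hcard
      · rintro ⟨r, s, t⟩ he
        simp only [Finset.mem_product, Finset.mem_Ico, Finset.mem_Icc, Finset.mem_singleton] at he
        obtain ⟨⟨h1, h2⟩, h5, ⟨h3, h4⟩⟩ := he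
        refine ⟨?_, ?_, ?_⟩
        · simp only [abs_le]; push_cast; constructor <;> omega
        · simp only [h5, abs_zero]; positivity
        · simp only [abs_le]; constructor <;> omega
      · rintro ⟨r, s, t⟩ he ⟨r', s', t'⟩ he' heq
        simp only [Finset.coe_product, Set.mem_prod, Finset.mem_coe, Finset.mem_Ico, Finset.mem_Icc, Finset.mem_singleton] at he he'
        obtain ⟨⟨h1, h2⟩, rfl, ⟨h3, h4⟩⟩ := he
        obtain ⟨⟨h1', h2'⟩, rfl, ⟨h3', h4'⟩⟩ := he'
        simp only at heq
        have := key cs (r - r') (t' - t) hcs.1 hcs.2 (by rw [abs_lt]; constructor <;> omega) (by linear_combination heq)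
        ext <;> simp <;> omega
    · refine ⟨{0} ×ˢ (Finset.Ico 0 (210 * (H : ℤ))) ×ˢ (Finset.Icc (-(1000 * (w : ℕ) : ℤ)) (1000 * (w : ℕ))), ?_, ?_, ?_⟩
      · simp only [Finset.card_product, Int.card_Ico, Int.card_Icc, Finset.card_singleton, htn, hsn]
        simpa using hcard
      · rintro ⟨r, s, t⟩ he
        simp only [Finset.mem_product, Finset.mem_Ico, Finset.mem_Icc, Finset.mem_singleton] at he
        obtain ⟨h5, ⟨h1, h2⟩, ⟨h3, h4⟩⟩ := he
        refine ⟨?_, ?_, ?_⟩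
        · simp only [h5, abs_zero]; positivity
        · simp only [abs_le]; push_cast; constructor <;> omega
        · simp only [abs_le]; constructor <;> omega
      · rintro ⟨r, s, t⟩ he ⟨r', s', t'⟩ he' heq
        simp only [Finset.coe_product, Set.mem_prod, Finset.mem_coe, Finset.mem_Ico, Finset.mem_Icc, Finset.mem_singleton] at he he'
        obtain ⟨rfl, ⟨h1, h2⟩, ⟨h3, h4⟩⟩ := he
        obtain ⟨rfl, ⟨h1', h2'⟩, ⟨h3', h4'⟩⟩ := he'
        simp only at heq
        have := key cr (s - s') (t - t') hq hcr (by rw [abs_lt]; constructor <;> omega) (by linear_combination - heq)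
        ext <;> simp <;> omega


noncomputable def ptE (n a : ℤ) (e : ℤ × ℤ × ℤ) : Fin 2 → ℝ := ![((e.1 + n * e.2.2 : ℤ) : ℝ), ((e.2.1 - a * e.2.2 : ℤ) : ℝ)]

noncomputable def thE (γ : ℝ) (e : ℤ × ℤ × ℤ) : ℝ := Real.goldenRatio ^ e.1 * 2 ^ e.2.1 * γ ^ e.2.2

noncomputable def boxE (R S T : ℕ) : Finset (ℤ × ℤ × ℤ) :=
  Finset.Icc (-(R : ℤ)) R ×ˢ Finset.Icc (-(S : ℤ)) S ×ˢ Finset.Icc (-(T : ℤ)) T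

lemma mem_boxE {R S T : ℕ} {e : ℤ × ℤ × ℤ} : e ∈ boxE R S T ↔ |e.1| ≤ R ∧ |e.2.1| ≤ S ∧ |e.2.2| ≤ T := by
  simp only [boxE, Finset.mem_product, Finset.mem_Icc, abs_le]

lemma card_boxE (R S T : ℕ) : (boxE R S T).card = (2 * R + 1) * ((2 * S + 1) * (2 * T + 1)) := by
  have h : ∀ k : ℕ, ((k : ℤ) + 1 - -(k : ℤ)).toNat = 2 * k + 1 := by intro k; omega
  simp only [boxE, Finset.card_product, Int.card_Icc, h]

lemma ptE_add (n a : ℤ) (e e' : ℤ × ℤ × ℤ) : ptE n a (e + e') = ptE n a e + ptE n a e' := by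
  ext i
  fin_cases i <;> simp [ptE] <;> ring

lemma ptE_sub (n a : ℤ) (e e' : ℤ × ℤ × ℤ) : ptE n a (e - e') = ptE n a e - ptE n a e' := by
  ext i
  fin_cases i <;> simp [ptE] <;> ring

lemma thE_pos {γ : ℝ} (hγ : 0 < γ) (e : ℤ × ℤ × ℤ) : 0 < thE γ e := by
  have := Real.goldenRatio_pos
  unfold thE; positivity

lemma thE_add {γ : ℝ} (hγ : 0 < γ) (e e' : ℤ × ℤ × ℤ) : thE γ (e + e') = thE γ e * thE γ e' := by
  have := Real.goldenRatio_ne_zero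
  simp only [thE, Prod.fst_add, Prod.snd_add]
  rw [zpow_add₀ this, zpow_add₀ two_ne_zero, zpow_add₀ hγ.ne']
  ring

lemma ptE_inj {n a : ℤ} {R S T : ℕ} (hn : 2 * (R : ℤ) < n) {e e' : ℤ × ℤ × ℤ} (he : e ∈ boxE R S T) (he' : e' ∈ boxE R S T)
    (h : ptE n a e = ptE n a e') : e = e' := by
  obtain ⟨r, s, t⟩ := e
  obtain ⟨r', s', t'⟩ := e'
  have h0 := congrFun h 0
  have h1 := congrFun h 1
  simp only [ptE, Matrix.cons_val_zero, Matrix.cons_val_one] at h0 h1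
  have h0' : r + n * t = r' + n * t' := by exact_mod_cast h0
  have h1' : s - a * t = s' - a * t' := by exact_mod_cast h1
  rw [mem_boxE] at he he'
  simp only [abs_le] at he he'
  have ht : t' - t = 0 := by
    by_contra h0
    have h3 : 1 ≤ |t' - t| := Int.one_le_abs h0
    have h4 : r - r' = n * (t' - t) := by linear_combination h0'
    have h5 : |r - r'| = n * |t' - t| := by rw [h4, abs_mul, abs_of_pos (by omega)]
    have h6 : |r - r'| ≤ 2 * R := by rw [abs_le]; constructor <;> omega
    nlinarith
  have ht' : t' = t := by omega
  subst ht'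
  have h2 : r = r' := by omega
  have h3 : s = s' := by omega
  rw [h2, h3]

lemma golden_indep (r s : ℤ) (h : r ≠ 0 ∨ s ≠ 0) : Real.goldenRatio ^ r * (2 : ℝ) ^ s ≠ 1 := by
  have key : ∀ (k : ℕ) (s : ℤ), 0 < k → Real.goldenRatio ^ (k : ℤ) * (2 : ℝ) ^ s ≠ 1 := by
    intro k s hk h
    obtain ⟨m, rfl⟩ : ∃ m, k = m + 1 := ⟨k - 1, by omega⟩
    rw [zpow_natCast, ← Real.goldenRatio_mul_fib_succ_add_fib] at h
    have h2 : (2 : ℝ) ^ s ≠ 0 := by positivity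
    have hf : (Nat.fib (m+1) : ℝ) ≠ 0 := by exact_mod_cast (Nat.fib_pos.mpr (by omega)).ne'
    apply Real.goldenRatio_irrational
    refine ⟨(((2 : ℚ) ^ s)⁻¹ - Nat.fib m) / Nat.fib (m+1), ?_⟩
    push_cast
    generalize Real.goldenRatio = f at h ⊢
    rw [div_eq_iff hf]
    apply mul_right_cancel₀ h2
    rw [sub_mul, inv_mul_cancel₀ h2]
    linear_combination -h
  intro h1
  rcases lt_trichotomy r 0 with hr | hr | hr
  · obtain ⟨k, hk⟩ := Int.eq_ofNat_of_zero_le (show 0 ≤ -r by omega)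
    apply key k (-s) (by omega)
    rw [← hk, zpow_neg, zpow_neg, ← mul_inv, h1, inv_one]
  · rw [hr, zpow_zero, one_mul] at h1
    rcases h with h | h
    · exact h hr
    · have := zpow_right_injective₀ (a := (2 : ℝ)) (by norm_num) (by norm_num) (h1.trans (zpow_zero 2).symm)
      exact h this
  · obtain ⟨k, hk⟩ := Int.eq_ofNat_of_zero_le (show 0 ≤ r by omega)
    apply key k s (by omega)
    rw [← hk, h1]

lemma line_case (b H : ℕ) (hb : 87 ≤ b) (hH : 23 ≤ H) (n a : ℤ) (u : ℕ) (hu : u = b ^ 2 * H)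
    (hn : 21000 * (u : ℤ) < n)
    (h1 : 210000 * (H : ℤ) ≤ 193 * n - 278 * a) (h2 : 210000 * (H : ℤ) ≤ 955 * a - 663 * n)
    (γ : ℝ) (hγ : 0 < γ) (P : ℕ → MvPolynomial (Fin 2) ℝ)
    (hdeg : ∀ l < 6 * b + 1, (P l).totalDegree < 420000 * u)
    (hz : ∀ e ∈ boxE (10500 * u) (7000 * u) (100000 * b ^ 2),
      ∑ l ∈ Finset.range (6 * b + 1), MvPolynomial.eval (ptE n a e) (P l) * (thE γ e) ^ l = 0)
    (a0 b0 c0 : ℝ) (hab : a0 ≠ 0 ∨ b0 ≠ 0) (E1 : Finset (ℤ × ℤ × ℤ))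
    (hE1 : ∀ e ∈ E1, e ∈ boxE (9975 * u) (6650 * u) (99000 * b ^ 2))
    (hE1l : ∀ e ∈ E1, a0 * ptE n a e 0 + b0 * ptE n a e 1 = c0)
    (hcard : 20502000 * (u * b) < E1.card)
    (e1 : ℤ × ℤ × ℤ) (he1 : e1 ∈ E1) (δr δs : ℤ) (hδ : δr ≠ 0 ∨ δs ≠ 0)
    (hpar : a0 * δr + b0 * δs = 0) (hδr : (6 * b + 1) * |δr| ≤ 210 * u) (hδs : (6 * b + 1) * |δs| ≤ 140 * u) :
    ∀ l < 6 * b + 1, P l = 0 := by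
  classical
  set L := 6 * b + 1 with hL
  set K := 420000 * u with hK
  have hb2 : 87 * b ≤ b ^ 2 := by nlinarith
  have hu1 : 87 * b * 23 ≤ u := by rw [hu]; exact Nat.mul_le_mul hb2 hH
  have hg : 0 < Int.gcd δr δs := by
    rw [Nat.pos_iff_ne_zero]
    intro h0
    rw [Int.gcd_eq_zero_iff] at h0
    rcases hδ with h | h
    · exact h h0.1
    · exact h h0.2
  obtain ⟨cr, cs, hcop, hcr, hcs⟩ := Int.exists_gcd_one hg
  set g := Int.gcd δr δs with hgdef
  obtain ⟨F, hF1, hF2, hF3⟩ := line_values n a (b ^ 2) H (by nlinarith) (by omega) h1 h2 cr cs (Int.isCoprime_iff_gcd_eq_one.mpr hcop)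
  rw [← hu] at hF1 hF2
  set v : Fin 2 → ℝ := ![(δr : ℝ), (δs : ℝ)] with hv
  have hδR : (δr : ℝ) ≠ 0 ∨ (δs : ℝ) ≠ 0 := by
    rcases hδ with h | h
    · left; exact_mod_cast h
    · right; exact_mod_cast h
  have hN : 0 < (δr : ℝ) ^ 2 + (δs : ℝ) ^ 2 := by rcases hδR with h | h <;> positivity
  let τ : (ℤ × ℤ × ℤ) → ℝ := fun e => ((ptE n a e 0 - ptE n a e1 0) * δr + (ptE n a e 1 - ptE n a e1 1) * δs) / ((δr : ℝ) ^ 2 + (δs : ℝ) ^ 2)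
  have hlin : ∀ x y : ℝ, x * δs - y * δr = 0 →
      x = ((x * δr + y * δs) / ((δr : ℝ) ^ 2 + (δs : ℝ) ^ 2)) * δr ∧ y = ((x * δr + y * δs) / ((δr : ℝ) ^ 2 + (δs : ℝ) ^ 2)) * δs := by
    intro x y hxy
    constructor
    · field_simp; linear_combination δs * hxy
    · field_simp; linear_combination - δr * hxy
  have hτ : ∀ e ∈ E1, ptE n a e = ptE n a e1 + τ e • v := by
    intro e he
    have q1 := hE1l e he
    have q2 := hE1l e1 he1
    have q3 : (ptE n a e 0 - ptE n a e1 0) * δs - (ptE n a e 1 - ptE n a e1 1) * δr = 0 := by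
      have q4 : a0 * (ptE n a e 0 - ptE n a e1 0) + b0 * (ptE n a e 1 - ptE n a e1 1) = 0 := by linarith
      rcases hab with h | h
      · apply mul_left_cancel₀ h
        linear_combination δs * q4 - (ptE n a e 1 - ptE n a e1 1) * hpar
      · apply mul_left_cancel₀ h
        linear_combination - δr * q4 + (ptE n a e 0 - ptE n a e1 0) * hpar
    have := hlin _ _ q3
    ext i
    fin_cases i
    · simp [v, τ]; linarith [this.1]
    · simp [v, τ]; linarith [this.2]
  have hτinj : Set.InjOn τ E1 := by
    intro e he e' he' hee
    have q1 := hτ e he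
    have q2 := hτ e' he'
    rw [hee] at q1
    exact ptE_inj (by push_cast; omega) (hE1 e he) (hE1 e' he') (q1.trans q2.symm)
  let TT := E1.image τ
  have hTT : TT.card = E1.card := Finset.card_image_of_injOn hτinj
  have hch : ∀ t : ℝ, ∃ e, t ∈ TT → e ∈ E1 ∧ τ e = t := by
    intro t
    by_cases ht : t ∈ TT
    · obtain ⟨e, he, het⟩ := Finset.mem_image.mp ht
      exact ⟨e, fun _ => ⟨he, het⟩⟩
    · exact ⟨0, fun h => absurd h ht⟩
  choose ε hε using hch
  have hKL : (K - 1) * L < TT.card := by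
    rw [hTT]
    refine lt_of_le_of_lt ?_ hcard
    calc (K - 1) * L ≤ K * L := Nat.mul_le_mul_right _ (by omega)
      _ ≤ 420000 * u * (7 * b) := by rw [hK, hL]; exact Nat.mul_le_mul_left _ (by omega)
      _ ≤ _ := by nlinarith [Nat.zero_le (u * b)]
  have hvan : ∀ e ∈ F, ∀ l < L, ∀ t : ℝ, MvPolynomial.eval (ptE n a e1 + ptE n a e + t • v) (P l) = 0 := by
    intro e he
    choose p hp1 hp2 using fun l => restrict_line (P l) (ptE n a e1 + ptE n a e) v
    have := lemmaU L K (by omega) p (fun l hl => (hp1 l).trans_lt (hdeg l hl)) (Real.goldenRatio ^ δr * 2 ^ δs)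
      (by have := Real.goldenRatio_pos; positivity) (golden_indep δr δs hδ) TT (fun t => thE γ (ε t + e)) (fun t => thE_pos hγ _) hKL
      (by
        intro t ht m hm
        obtain ⟨q1, q2⟩ := hε t ht
        have q3 := hτ _ q1
        rw [q2] at q3
        have hmem : ε t + e + (m * δr, m * δs, 0) ∈ boxE (10500 * u) (7000 * u) (100000 * b ^ 2) := by
          have m1 := mem_boxE.mp (hE1 _ q1)
          have m2 := hF2 e he
          rw [mem_boxE]
          simp only [Prod.fst_add, Prod.snd_add]
          have a1 : |(m : ℤ) * δr| ≤ 210 * u := by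
            rw [abs_mul, Nat.abs_cast]
            refine le_trans (mul_le_mul_of_nonneg_right ?_ (abs_nonneg _)) hδr
            have : (m : ℤ) < (L : ℤ) := by exact_mod_cast hm
            rw [hL] at this; push_cast at this; omega
          have a2 : |(m : ℤ) * δs| ≤ 140 * u := by
            rw [abs_mul, Nat.abs_cast]
            refine le_trans (mul_le_mul_of_nonneg_right ?_ (abs_nonneg _)) hδs
            have : (m : ℤ) < (L : ℤ) := by exact_mod_cast hm
            rw [hL] at this; push_cast at this; omega
          generalize (m : ℤ) * δr = x1 at a1 ⊢
          generalize (m : ℤ) * δs = x2 at a2 ⊢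
          simp only [abs_le] at m1 m2 a1 a2 ⊢
          generalize b ^ 2 = w at *
          push_cast at *
          omega
        have := hz _ hmem
        rw [← this]
        apply Finset.sum_congr rfl
        intro l _
        rw [hp2]
        congr 2
        · rw [ptE_add, ptE_add, q3]
          have : ptE n a (m * δr, m * δs, 0) = (m : ℝ) • v := by
            ext i; fin_cases i <;> simp [ptE, v]
          rw [this, add_smul]
          congr 1
          abel
        · rw [thE_add hγ (ε t + e), mul_comm]
          congr 1
          simp only [thE, zpow_zero, mul_one]
          rw [mul_pow, ← zpow_natCast, ← zpow_natCast, ← zpow_mul, ← zpow_mul, mul_comm δr, mul_comm δs])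
    intro l hl t
    rw [← hp2, this l hl, Polynomial.eval_zero]
  intro l hl
  let ℓ : (ℤ × ℤ × ℤ) → ℝ := fun e => δs * (ptE n a e1 + ptE n a e) 0 - δr * (ptE n a e1 + ptE n a e) 1
  have hℓinj : Set.InjOn ℓ F := by
    intro e he e' he' hee
    apply hF3 he he'
    simp only [ℓ, ptE, Pi.add_apply, Matrix.cons_val_zero, Matrix.cons_val_one] at hee
    have hee' : δs * (e1.1 + n * e1.2.2 + (e.1 + n * e.2.2)) - δr * (e1.2.1 - a * e1.2.2 + (e.2.1 - a * e.2.2))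
      = δs * (e1.1 + n * e1.2.2 + (e'.1 + n * e'.2.2)) - δr * (e1.2.1 - a * e1.2.2 + (e'.2.1 - a * e'.2.2)) := by exact_mod_cast hee
    have hg0 : (g : ℤ) ≠ 0 := by exact_mod_cast hg.ne'
    apply mul_left_cancel₀ hg0
    simp only
    rw [hcr, hcs] at hee'
    linear_combination hee'
  refine vanish_of_lines (P l) K (hdeg l hl) δr δs hδR (F.image ℓ) ?_ ?_
  · rw [Finset.card_image_of_injOn hℓinj]; exact hF1
  · intro c hc x hx
    obtain ⟨e, he, rfl⟩ := Finset.mem_image.mp hc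
    have q := hlin (x 0 - (ptE n a e1 + ptE n a e) 0) (x 1 - (ptE n a e1 + ptE n a e) 1) (by simp only [ℓ] at hx; linear_combination hx)
    have := hvan e he l hl (((x 0 - (ptE n a e1 + ptE n a e) 0) * δr + (x 1 - (ptE n a e1 + ptE n a e) 1) * δs) / ((δr : ℝ) ^ 2 + (δs : ℝ) ^ 2))
    rw [← this]
    congr 1
    congr 1
    ext i
    fin_cases i
    · simp only [Fin.zero_eta, Pi.add_apply, Pi.smul_apply, v, Matrix.cons_val_zero, smul_eq_mul] at q ⊢
      linarith [q.1]
    · simp only [Fin.mk_one, Pi.add_apply, Pi.smul_apply, v, Matrix.cons_val_one, Matrix.cons_val_zero, smul_eq_mul] at q ⊢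
      linarith [q.2]


lemma same_sign (a0 b0 x y σ : ℝ) (hab : a0 ≠ 0 ∨ b0 ≠ 0) (h : a0 * x + b0 * y = 0)
    (hσ : (σ = 1 ∧ a0 * b0 ≤ 0) ∨ (σ = -1 ∧ 0 < a0 * b0)) : 0 ≤ x * (σ * y) := by
  by_cases ha : a0 = 0
  · have hb : b0 ≠ 0 := by rcases hab with h | h; exact absurd ha h; exact h
    rw [ha, zero_mul, zero_add] at h
    rw [(mul_eq_zero.mp h).resolve_left hb]; simp
  have hx : x = - b0 * y / a0 := by field_simp; linarith
  have : x * (σ * y) = (- (σ * (a0 * b0))) * (y / a0) ^ 2 := by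
    rw [hx]; field_simp
  rw [this]
  apply mul_nonneg _ (sq_nonneg _)
  rcases hσ with ⟨h1, h2⟩ | ⟨h1, h2⟩ <;> rw [h1] <;> linarith

lemma abs_of_same_sign (p q x y c : ℤ) (hp : 0 ≤ p) (hq : 0 ≤ q) (h : 0 ≤ x * y) (hc : |p * x + q * y| < c) :
    p * |x| < c ∧ q * |y| < c := by
  rcases le_total 0 x with hx | hx <;> rcases le_total 0 y with hy | hy
  · rw [abs_of_nonneg hx, abs_of_nonneg hy]
    have := (abs_lt.mp hc).2
    have := mul_nonneg hp hx
    have := mul_nonneg hq hy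
    constructor <;> linarith
  · have h0 : x * y = 0 := le_antisymm (mul_nonpos_of_nonneg_of_nonpos hx hy) h
    have hh := abs_lt.mp hc
    rcases mul_eq_zero.mp h0 with h1 | h1 <;> subst h1 <;> simp only [abs_zero, mul_zero, zero_add, add_zero] at * 
    · rw [abs_of_nonpos hy]; constructor <;> linarith
    · rw [abs_of_nonneg hx]; constructor <;> linarith
  · have h0 : x * y = 0 := le_antisymm (mul_nonpos_of_nonpos_of_nonneg hx hy) h
    have hh := abs_lt.mp hc
    rcases mul_eq_zero.mp h0 with h1 | h1 <;> subst h1 <;> simp only [abs_zero, mul_zero, zero_add, add_zero] at * 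
    · rw [abs_of_nonneg hy]; constructor <;> linarith
    · rw [abs_of_nonpos hx]; constructor <;> linarith
  · rw [abs_of_nonpos hx, abs_of_nonpos hy]
    have := (abs_lt.mp hc).1
    have := mul_nonpos_of_nonneg_of_nonpos hp hx
    have := mul_nonpos_of_nonneg_of_nonpos hq hy
    constructor <;> linarith

lemma pigeon (b H : ℕ) (hb : 87 ≤ b) (hH : 23 ≤ H) (n a : ℤ) (u : ℕ) (hu : u = b ^ 2 * H)
    (a0 b0 c0 : ℝ) (hab : a0 ≠ 0 ∨ b0 ≠ 0) (E1 : Finset (ℤ × ℤ × ℤ))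
    (hE1 : ∀ e ∈ E1, e ∈ boxE (9975 * u) (6650 * u) (99000 * b ^ 2))
    (hE1l : ∀ e ∈ E1, a0 * ptE n a e 0 + b0 * ptE n a e 1 = c0)
    (hcard : 20502000 * (u * b) < E1.card) :
    ∃ e1 ∈ E1, ∃ δr δs : ℤ, (δr ≠ 0 ∨ δs ≠ 0) ∧ a0 * δr + b0 * δs = 0 ∧
      (6 * b + 1) * |δr| ≤ 210 * u ∧ (6 * b + 1) * |δs| ≤ 140 * u := by
  have hb2 : 87 * b ≤ b ^ 2 := by nlinarith
  have hu1 : 87 * b * 23 ≤ u := by rw [hu]; exact Nat.mul_le_mul hb2 hH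
  have hu2 : 23 * b ^ 2 ≤ u := by rw [hu, mul_comm]; exact Nat.mul_le_mul_left _ hH
  obtain ⟨σ, hσ⟩ : ∃ σ : ℤ, (σ = 1 ∧ a0 * b0 ≤ 0) ∨ (σ = -1 ∧ 0 < a0 * b0) := by
    rcases le_or_gt (a0 * b0) 0 with h | h
    · exact ⟨1, Or.inl ⟨rfl, h⟩⟩
    · exact ⟨-1, Or.inr ⟨rfl, h⟩⟩
  have hσ1 : σ = 1 ∨ σ = -1 := by tauto
  set L : ℤ := 6 * b + 1 with hL
  have hLpos : 0 < L := by omega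
  have hLu : L ≤ u := by omega
  have hu0 : (1 : ℤ) ≤ u := by omega
  set c : ℤ := 1396500 * (u : ℤ) ^ 2 / L with hc
  have hc1 : L * c ≤ 1396500 * (u : ℤ) ^ 2 := Int.mul_ediv_self_le hLpos.ne'
  have hc2 : 1396500 * (u : ℤ) ^ 2 < L * c + L := by
    have := Int.lt_mul_ediv_self_add (x := 1396500 * (u : ℤ) ^ 2) hLpos
    linarith
  have huu : (u : ℤ) ≤ (u : ℤ) ^ 2 := by nlinarith
  have hc0 : 0 < c := by
    by_contra hcon
    push Not at hcon
    nlinarith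
  let φ : ℤ × ℤ × ℤ → ℤ := fun e => (6650 * u) * e.1 + (9975 * u) * (σ * e.2.1)
  have hφ : ∀ e ∈ E1, |φ e| ≤ 132667500 * (u : ℤ) ^ 2 := by
    intro e he
    have := mem_boxE.mp (hE1 e he)
    obtain ⟨q1, q2, -⟩ := this
    push_cast at q1 q2
    have q3 : |σ * e.2.1| ≤ 6650 * u := by
      rcases hσ1 with h | h <;> simp [h] <;> exact q2
    calc |φ e| ≤ |(6650 * u) * e.1| + |(9975 * u) * (σ * e.2.1)| := abs_add_le _ _
      _ = (6650 * u) * |e.1| + (9975 * u) * |σ * e.2.1| := by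
        rw [abs_mul, abs_mul (9975 * (u:ℤ)), abs_of_nonneg (by positivity), abs_of_nonneg (by positivity : (0:ℤ) ≤ 9975 * u)]
      _ ≤ (6650 * u) * (9975 * u) + (9975 * u) * (6650 * u) := by gcongr
      _ = _ := by ring
  let M : ℤ := 191 * L
  let tgt : Finset (ℤ × ℤ) := Finset.Icc (-(99000 * b ^ 2 : ℤ)) (99000 * b ^ 2) ×ˢ Finset.Icc 0 M
  let f : ℤ × ℤ × ℤ → ℤ × ℤ := fun e => (e.2.2, (φ e + 132667500 * (u : ℤ) ^ 2) / c)
  have htgt : tgt.card = (198000 * b ^ 2 + 1) * (191 * (6 * b + 1) + 1) := by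
    simp only [tgt, Finset.card_product, Int.card_Icc]
    have t1 : (99000 * (b : ℤ) ^ 2 + 1 - -(99000 * (b : ℤ) ^ 2)).toNat = 198000 * b ^ 2 + 1 := by
      have : ((b ^ 2 : ℕ) : ℤ) = (b : ℤ) ^ 2 := by push_cast; rfl
      omega
    have t2 : (M + 1 - 0).toNat = 191 * (6 * b + 1) + 1 := by simp only [M, hL]; omega
    rw [t1, t2]
  have hlt : tgt.card < E1.card := by
    rw [htgt]
    refine lt_of_le_of_lt ?_ hcard
    calc _ ≤ (198001 * b ^ 2) * (1150 * b) := Nat.mul_le_mul (by nlinarith) (by omega)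
      _ = 227701150 * (b ^ 2 * b) := by ring
      _ ≤ 20502000 * (23 * b ^ 2 * b) := by nlinarith [Nat.zero_le (b^2*b)]
      _ ≤ _ := by gcongr
  have hmaps : ∀ e ∈ E1, f e ∈ tgt := by
    intro e he
    have h1 := abs_le.mp (hφ e he)
    have h2 := abs_le.mp (mem_boxE.mp (hE1 e he)).2.2
    simp only [tgt, f, Finset.mem_product, Finset.mem_Icc]
    push_cast at h2
    refine ⟨h2, Int.ediv_nonneg (by linarith) hc0.le, ?_⟩
    have : (φ e + 132667500 * (u : ℤ) ^ 2) < (M + 1) * c := by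
      have : M * c = 191 * (L * c) := by simp only [M]; ring
      nlinarith
    have := Int.ediv_lt_of_lt_mul hc0 this
    omega
  obtain ⟨e, he, e', he', hne, hfe⟩ := Finset.exists_ne_map_eq_of_card_lt_of_maps_to hlt hmaps
  simp only [f, Prod.mk.injEq] at hfe
  obtain ⟨ht, hcell⟩ := hfe
  have hlin : a0 * ((e.1 - e'.1 : ℤ) : ℝ) + b0 * ((e.2.1 - e'.2.1 : ℤ) : ℝ) = 0 := by
    have q1 := hE1l e he
    have q2 := hE1l e' he'
    simp only [ptE, Matrix.cons_val_zero, Matrix.cons_val_one] at q1 q2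
    rw [ht] at q1
    push_cast at q1 q2 ⊢
    linarith
  have hdiff : |φ e - φ e'| < c := by
    have d1 := Int.mul_ediv_self_le (x := φ e + 132667500 * (u : ℤ) ^ 2) hc0.ne'
    have d2 := Int.lt_mul_ediv_self_add (x := φ e + 132667500 * (u : ℤ) ^ 2) hc0
    have d3 := Int.mul_ediv_self_le (x := φ e' + 132667500 * (u : ℤ) ^ 2) hc0.ne'
    have d4 := Int.lt_mul_ediv_self_add (x := φ e' + 132667500 * (u : ℤ) ^ 2) hc0
    rw [hcell] at d1 d2
    rw [abs_lt]; constructor <;> linarith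
  have hsgn : 0 ≤ (e.1 - e'.1) * (σ * (e.2.1 - e'.2.1)) := by
    have := same_sign a0 b0 _ _ (σ : ℝ) hab hlin (by
      rcases hσ with ⟨h, h'⟩ | ⟨h, h'⟩
      · left; exact ⟨by rw [h]; norm_num, h'⟩
      · right; exact ⟨by rw [h]; norm_num, h'⟩)
    exact_mod_cast this
  have hfin := abs_of_same_sign (6650 * u) (9975 * u) (e.1 - e'.1) (σ * (e.2.1 - e'.2.1)) c (by positivity) (by positivity) hsgn (by
    rw [show (6650 * (u:ℤ)) * (e.1 - e'.1) + (9975 * u) * (σ * (e.2.1 - e'.2.1)) = φ e - φ e' by simp only [φ]; ring]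
    exact hdiff)
  have habs : |σ * (e.2.1 - e'.2.1)| = |e.2.1 - e'.2.1| := by
    rcases hσ1 with h | h
    · rw [h, one_mul]
    · rw [h, neg_one_mul, abs_neg]
  rw [habs] at hfin
  refine ⟨e', he', e.1 - e'.1, e.2.1 - e'.2.1, ?_, hlin, ?_, ?_⟩
  · by_contra hcon
    push Not at hcon
    apply hne
    ext
    · omega
    · omega
    · exact ht
  · have := hfin.1
    have h5 : (6650 * (u:ℤ)) * (L * |e.1 - e'.1|) ≤ (6650 * (u:ℤ)) * (210 * u) := by nlinarith
    exact le_of_mul_le_mul_left h5 (by positivity)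
  · have := hfin.2
    have h5 : (9975 * (u:ℤ)) * (L * |e.2.1 - e'.2.1|) ≤ (9975 * (u:ℤ)) * (140 * u) := by nlinarith
    exact le_of_mul_le_mul_left h5 (by positivity)

lemma zero_lemma (b H : ℕ) (hb : 87 ≤ b) (hH : 23 ≤ H) (n a : ℤ) (u : ℕ) (hu : u = b ^ 2 * H)
    (hn : 21000 * (u : ℤ) < n)
    (h1 : 210000 * (H : ℤ) ≤ 193 * n - 278 * a) (h2 : 210000 * (H : ℤ) ≤ 955 * a - 663 * n)
    (γ : ℝ) (hγ : 0 < γ) (P : ℕ → MvPolynomial (Fin 2) ℝ)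
    (hdeg : ∀ l < 6 * b + 1, (P l).totalDegree < 420000 * u)
    (hz : ∀ e ∈ boxE (10500 * u) (7000 * u) (100000 * b ^ 2),
      ∑ l ∈ Finset.range (6 * b + 1), MvPolynomial.eval (ptE n a e) (P l) * (thE γ e) ^ l = 0) :
    ∀ l < 6 * b + 1, P l = 0 := by
  classical
  by_contra hcon
  have hcon' : ∃ l < 6 * b + 1, P l ≠ 0 := by push Not at hcon; exact hcon
  have hb2 : 87 * b ≤ b ^ 2 := by nlinarith
  have hu1 : 87 * b * 23 ≤ u := by rw [hu]; exact Nat.mul_le_mul hb2 hH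
  set E := boxE (9975 * u) (6650 * u) (99000 * b ^ 2) with hE
  set S := E.image (ptE n a) with hS
  have hinj : Set.InjOn (ptE n a) E := by
    intro e he e' he' h
    exact ptE_inj (by push_cast; omega) he he' h
  have hSc : S.card = E.card := Finset.card_image_of_injOn hinj
  have hline : ∀ a0 b0 c0 : ℝ, (a0 ≠ 0 ∨ b0 ≠ 0) → (S.filter (fun x => a0 * x 0 + b0 * x 1 = c0)).card ≤ 20502000 * (u * b) + 1 := by
    intro a0 b0 c0 hab
    by_contra hgt
    push Not at hgt
    apply hcon
    set E1 := E.filter (fun e => a0 * ptE n a e 0 + b0 * ptE n a e 1 = c0) with hE1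
    have hE1c : (S.filter (fun x => a0 * x 0 + b0 * x 1 = c0)).card ≤ E1.card := by
      rw [hS, Finset.filter_image]
      exact Finset.card_image_le
    have q1 : ∀ e ∈ E1, e ∈ E := fun e he => (Finset.mem_filter.mp he).1
    have q2 : ∀ e ∈ E1, a0 * ptE n a e 0 + b0 * ptE n a e 1 = c0 := fun e he => (Finset.mem_filter.mp he).2
    obtain ⟨e1, he1, δr, δs, q3, q4, q5, q6⟩ := pigeon b H hb hH n a u hu a0 b0 c0 hab E1 q1 q2 (by omega)
    exact line_case b H hb hH n a u hu hn h1 h2 γ hγ P hdeg hz a0 b0 c0 hab E1 q1 q2 (by omega) e1 he1 δr δs q3 q4 q5 q6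
  obtain ⟨f, hf0, hfdeg, hfv⟩ := elim2 (6 * b + 1) (420000 * u) (by omega) P hdeg Real.goldenRatio Real.goldenRatio_pos
    Real.one_lt_goldenRatio.ne' hcon'
  set Δ := (boxE (19950 * u) (13300 * u) (198000 * b ^ 2)).image (ptE n a) with hΔ
  have hΔc : Δ.card ≤ (20502000 * (u * b)) ^ 2 := by
    refine Finset.card_image_le.trans ?_
    rw [card_boxE]
    calc (2 * (19950 * u) + 1) * ((2 * (13300 * u) + 1) * (2 * (198000 * b ^ 2) + 1))
        ≤ (39901 * u) * ((26601 * u) * (396001 * b ^ 2)) := by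
          apply Nat.mul_le_mul (by omega)
          apply Nat.mul_le_mul (by omega)
          nlinarith
      _ = 39901 * 26601 * 396001 * (u ^ 2 * b ^ 2) := by ring
      _ ≤ 20502000 ^ 2 * (u ^ 2 * b ^ 2) := Nat.mul_le_mul_right _ (by norm_num)
      _ = _ := by ring
  have hcount := plane_count S Δ (by
    intro x hx y hy
    obtain ⟨e, he, rfl⟩ := Finset.mem_image.mp hx
    obtain ⟨e', he', rfl⟩ := Finset.mem_image.mp hy
    rw [← ptE_sub]
    apply Finset.mem_image_of_mem
    have m1 := mem_boxE.mp he
    have m2 := mem_boxE.mp he'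
    rw [mem_boxE]
    generalize b ^ 2 = w at *
    simp only [abs_le, Prod.fst_sub, Prod.snd_sub] at m1 m2 ⊢
    push_cast at m1 m2 ⊢
    omega) (20502000 * (u * b) + 1) (20502000 * (u * b)) hΔc le_rfl hline f hf0
  have hall : S.filter (fun x => MvPolynomial.eval x f = 0) = S := by
    apply Finset.filter_true_of_mem
    intro x hx
    obtain ⟨e, he, rfl⟩ := Finset.mem_image.mp hx
    apply hfv _ (thE γ e) (thE_pos hγ e)
    intro m hm
    have hmem : e + ((m : ℤ), 0, 0) ∈ boxE (10500 * u) (7000 * u) (100000 * b ^ 2) := by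
      have m1 := mem_boxE.mp he
      rw [mem_boxE]
      generalize b ^ 2 = w at *
      simp only [abs_le, Prod.fst_add, Prod.snd_add] at m1 ⊢
      push_cast at m1 ⊢
      omega
    refine Eq.trans ?_ (hz _ hmem)
    apply Finset.sum_congr rfl
    intro l _
    congr 2
    · rw [ptE_add]
      congr 1
      congr 1
      ext i; fin_cases i <;> simp [ptE]
    · rw [thE_add hγ, mul_comm]
      simp [thE]
  rw [hall, hSc, hE, card_boxE] at hcount
  have hc1 : (2 * (9975 * u)) * ((2 * (6650 * u)) * (2 * (99000 * b ^ 2))) ≤ (2 * (9975 * u) + 1) * ((2 * (6650 * u) + 1) * (2 * (99000 * b ^ 2) + 1)) := by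
    gcongr <;> omega
  have hc2 : f.totalDegree * (20502000 * (u * b) + 1) ≤ (420000 * u * (6 * b + 1)) * (20502000 * (u * b) + 1) := by
    apply Nat.mul_le_mul_right
    refine hfdeg.trans (Nat.mul_le_mul_right _ (by omega))
  have hub : 87 ≤ u * b := by nlinarith
  have hc3 : (420000 * u * (6 * b + 1)) * (20502000 * (u * b) + 1) < (2 * (9975 * u)) * ((2 * (6650 * u)) * (2 * (99000 * b ^ 2))) := by
    have e1 : 87 * (6 * b + 1) ≤ 523 * b := by omega
    have e2 : (20502000 * (u * b) + 1) ≤ 20502001 * (u * b) := by omega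
    have e3 : 87 * ((420000 * u * (6 * b + 1)) * (20502000 * (u * b) + 1)) ≤ 420000 * 523 * 20502001 * ((u * b) * (u * b)) := by
      calc _ = 420000 * u * ((87 * (6 * b + 1)) * (20502000 * (u * b) + 1)) := by ring
        _ ≤ 420000 * u * ((523 * b) * (20502001 * (u * b))) := by gcongr
        _ = _ := by ring
    have e4 : (2 * (9975 * u)) * ((2 * (6650 * u)) * (2 * (99000 * b ^ 2))) = 52536330000000 * ((u * b) * (u * b)) := by ring
    rw [e4]
    generalize (u * b) * (u * b) = z at *
    have : 0 < z := by
      by_contra h0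
      have : z = 0 := by omega
      subst this
      simp at e3
      omega
    omega
  omega


theorem exists_minor {ι E : Type*} [Fintype ι] [DecidableEq ι] (S : Finset E) (A : E → ι → ℝ)
    (h : ∀ v : ι → ℝ, (∀ e ∈ S, ∑ c, A e c * v c = 0) → v = 0) :
    ∃ μ : ι → E, (∀ i, μ i ∈ S) ∧ (Matrix.of fun i c => A (μ i) c).det ≠ 0 := by
  classical
  have htop : Submodule.span ℝ (A '' (S : Set E)) = ⊤ := by
    by_contra hne
    obtain ⟨f, hf, hle⟩ := Submodule.exists_le_ker_of_lt_top _ (lt_top_iff_ne_top.mpr hne)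
    apply hf
    have hv := h (fun c => f (Pi.single c 1)) (by
      intro e he
      have h1 : f (A e) = 0 := by
        have := hle (Submodule.subset_span ⟨e, he, rfl⟩)
        simpa using this
      rw [← h1]
      conv_rhs => rw [pi_eq_sum_univ' (A e)]
      rw [map_sum]
      apply Finset.sum_congr rfl
      intro c _
      rw [map_smul, smul_eq_mul]
      try rfl)
    apply LinearMap.pi_ext'
    intro i
    ext
    simpa using congrFun hv i
  obtain ⟨b, hb, hspan, hli⟩ := exists_linearIndependent ℝ (A '' (S : Set E))
  let B := Module.Basis.mk hli (by rw [Subtype.range_coe, hspan, htop])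
  have : Finite b := Module.Finite.finite_basis B
  have : Fintype b := Fintype.ofFinite b
  have hcard : Fintype.card ι = Fintype.card b := by
    rw [← Module.finrank_eq_card_basis B]; simp
  let σ : ι ≃ b := Fintype.equivOfCardEq hcard
  choose g hg using fun i : ι => hb (σ i).2
  refine ⟨g, fun i => (hg i).1, ?_⟩
  have hrow : LinearIndependent ℝ (Matrix.of fun i c => A (g i) c).row := by
    have : (Matrix.of fun i c => A (g i) c).row = (Subtype.val : b → ι → ℝ) ∘ σ := by
      funext i
      exact (hg i).2
    rw [this]
    exact hli.comp _ σ.injective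
  have := Matrix.linearIndependent_rows_iff_isUnit.mp hrow
  exact ((Matrix.isUnit_iff_isUnit_det _).mp this).ne_zero

open Polynomial in
theorem liouville_gold (F : ℤ[X]) (hF : aeval Real.goldenRatio F ≠ 0) :
    1 ≤ |aeval Real.goldenRatio F| * |aeval Real.goldenConj F| := by
  have hm : (X ^ 2 - X - 1 : ℤ[X]).Monic := by monicity!
  set Q : ℤ[X] := X ^ 2 - X - 1 with hQ
  have hd : Q.natDegree = 2 := by rw [hQ]; compute_degree!
  set r := F %ₘ Q with hr
  have hrd : r.natDegree < 2 := by
    rw [← hd]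
    exact natDegree_modByMonic_lt _ hm (by intro h; rw [h] at hd; simp at hd)
  have hx : r = C (r.coeff 1) * X + C (r.coeff 0) := by
    exact eq_X_add_C_of_natDegree_le_one (by omega)
  set p := r.coeff 1
  set q := r.coeff 0
  have h1 : aeval Real.goldenRatio F = p * Real.goldenRatio + q := by
    conv_lhs => rw [← modByMonic_add_div F Q]
    have : aeval Real.goldenRatio Q = 0 := by
      simp [hQ, Real.goldenRatio_sq]
    rw [map_add, map_mul, this, zero_mul, add_zero, ← hr, hx]
    simp
  have h2 : aeval Real.goldenConj F = p * Real.goldenConj + q := by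
    conv_lhs => rw [← modByMonic_add_div F Q]
    have : aeval Real.goldenConj Q = 0 := by
      simp [hQ, Real.goldenConj_sq]
    rw [map_add, map_mul, this, zero_mul, add_zero, ← hr, hx]
    simp
  have hprod : aeval Real.goldenRatio F * aeval Real.goldenConj F = ((q ^ 2 + p * q - p ^ 2 : ℤ) : ℝ) := by
    rw [h1, h2]
    push_cast
    have e1 := Real.goldenRatio_mul_goldenConj
    have e2 := Real.goldenRatio_add_goldenConj
    linear_combination (p : ℝ) ^ 2 * e1 + (p : ℝ) * q * e2
  rw [← abs_mul, hprod, ← Int.cast_abs]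
  have hne : (q ^ 2 + p * q - p ^ 2 : ℤ) ≠ 0 := by
    intro h0
    rw [h0, Int.cast_zero] at hprod
    rcases mul_eq_zero.mp hprod with h | h
    · exact hF h
    · have hirr := Real.goldenConj_irrational
      rw [h2] at h
      by_cases hp : p = 0
      · rw [hp] at h h1
        simp at h
        apply hF; rw [h1, h]; simp
      · apply hirr
        refine ⟨-(q : ℚ) / p, ?_⟩
        push_cast
        have : (p : ℝ) ≠ 0 := by exact_mod_cast hp
        rw [div_eq_iff this]
        linarith
  exact_mod_cast Int.one_le_abs hne


noncomputable def yc (κ l2 : ℝ) (M0 i j : ℕ) (lam : ℝ) (p m' : ℕ) : ℝ :=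
  ∑ q ∈ Finset.range (j + 1), ∑ m ∈ Finset.range M0,
    if i + q = p ∧ j - q + m = m' then (l2⁻¹) ^ j * (j.choose q) * (-κ) ^ q * (lam ^ m / m.factorial) else 0

theorem yc_expand (κ l2 : ℝ) (hl2 : l2 ≠ 0) (M0 i j K : ℕ) (hij : i + j < K) (lam V Z w : ℝ)
    (hZ : l2 * Z = w - κ * V) :
    ∑ k : Fin K × Fin (M0 + K), (V ^ (k.1 : ℕ) * w ^ (k.2 : ℕ)) * yc κ l2 M0 i j lam k.1 k.2
      = V ^ i * Z ^ j * ∑ m ∈ Finset.range M0, (lam * w) ^ m / m.factorial := by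
  have hZ' : Z = l2⁻¹ * ((-κ * V) + w) := by
    rw [eq_inv_mul_iff_mul_eq₀ hl2, hZ]; ring
  have h1 : V ^ i * Z ^ j * ∑ m ∈ Finset.range M0, (lam * w) ^ m / m.factorial
      = ∑ q ∈ Finset.range (j + 1), ∑ m ∈ Finset.range M0,
        (V ^ (i + q) * w ^ (j - q + m)) * ((l2⁻¹) ^ j * (j.choose q) * (-κ) ^ q * (lam ^ m / m.factorial)) := by
    rw [hZ', mul_pow, add_pow, Finset.mul_sum (Finset.range (j + 1)), Finset.mul_sum (Finset.range (j + 1)), Finset.sum_mul]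
    apply Finset.sum_congr rfl
    intro q _
    rw [Finset.mul_sum]
    apply Finset.sum_congr rfl
    intro m _
    rw [mul_pow, mul_pow, pow_add, pow_add]
    ring
  rw [h1]
  simp only [yc, Finset.mul_sum]
  rw [Finset.sum_comm]
  apply Finset.sum_congr rfl
  intro q hq
  rw [Finset.sum_comm]
  apply Finset.sum_congr rfl
  intro m hm
  have hq' := Finset.mem_range.mp hq
  have hm' := Finset.mem_range.mp hm
  rw [Finset.sum_eq_single (⟨⟨i + q, by omega⟩, ⟨j - q + m, by omega⟩⟩ : Fin K × Fin (M0 + K))]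
  · simp
  · rintro ⟨p, m'⟩ _ hne
    rw [if_neg, mul_zero]
    rintro ⟨h1, h2⟩
    apply hne
    ext
    · exact h1.symm
    · exact h2.symm
  · simp

theorem exp_sum_le (x : ℝ) (hx : 0 ≤ x) (M : ℕ) : ∑ m ∈ Finset.range M, x ^ m / m.factorial ≤ Real.exp x :=
  Real.sum_le_exp_of_nonneg hx M

theorem yc_bound (κ l2 : ℝ) (hκ0 : 0 ≤ κ) (hκ1 : κ ≤ 1) (hl2 : 2 / 3 ≤ l2) (M0 i j K : ℕ) (hij : i + j < K)
    (lam V w Vm W L τ : ℝ) (hlam : |lam| ≤ L) (hV : |V| ≤ Vm) (hVm : 1 ≤ Vm) (hw : |w| ≤ W)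
    (hτ : 0 < τ) (hW : τ * W ≤ Vm) (p m' : ℕ) :
    |V ^ p * w ^ m' * yc κ l2 M0 i j lam p m'| ≤ (3 * Vm) ^ K * Real.exp (τ * (L * W)) / τ ^ m' := by
  have hW0 : 0 ≤ W := (abs_nonneg _).trans hw
  have hL0 : 0 ≤ L := (abs_nonneg _).trans hlam
  rw [le_div_iff₀ (by positivity)]
  have hinv : l2⁻¹ ≤ 3 / 2 := by
    rw [inv_le_comm₀ (by linarith) (by norm_num)]; linarith
  have hinv0 : 0 ≤ l2⁻¹ := by positivity
  have step : |V ^ p * w ^ m' * yc κ l2 M0 i j lam p m'| * τ ^ m' ≤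
      ∑ q ∈ Finset.range (j + 1), ∑ m ∈ Finset.range M0,
        ((3 / 2) ^ j * Vm ^ (i + j) * (j.choose q)) * ((τ * (L * W)) ^ m / m.factorial) := by
    rw [yc, Finset.mul_sum]
    have : |τ ^ m'| = τ ^ m' := abs_of_pos (by positivity)
    rw [← this, ← abs_mul, Finset.sum_mul]
    refine (Finset.abs_sum_le_sum_abs _ _).trans (Finset.sum_le_sum fun q hq => ?_)
    rw [Finset.mul_sum, Finset.sum_mul]
    refine (Finset.abs_sum_le_sum_abs _ _).trans (Finset.sum_le_sum fun m hm => ?_)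
    have hq' := Finset.mem_range.mp hq
    split_ifs with hc
    · obtain ⟨rfl, rfl⟩ := hc
      rw [abs_mul, abs_mul, abs_mul, abs_mul, abs_mul, abs_mul, abs_div, abs_pow, abs_pow, abs_pow, abs_pow,
        abs_pow, abs_pow, abs_neg, abs_of_nonneg hκ0, abs_of_nonneg hinv0, abs_of_pos hτ, Nat.abs_cast, Nat.abs_cast]
      have e1 : |V| ^ (i + q) ≤ Vm ^ (i + q) := by gcongr
      have e2 : |w| ^ (j - q + m) ≤ W ^ (j - q + m) := by gcongr
      have e3 : κ ^ q ≤ 1 := pow_le_one₀ hκ0 hκ1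
      have e4 : |lam| ^ m ≤ L ^ m := by gcongr
      have e5 : l2⁻¹ ^ j ≤ (3 / 2) ^ j := by gcongr
      have e6 : (τ * W) ^ (j - q) ≤ Vm ^ (j - q) := by gcongr
      calc |V| ^ (i + q) * |w| ^ (j - q + m) * (l2⁻¹ ^ j * (j.choose q) * κ ^ q * (|lam| ^ m / m.factorial)) * τ ^ (j - q + m)
          ≤ Vm ^ (i + q) * W ^ (j - q + m) * ((3 / 2) ^ j * (j.choose q) * 1 * (L ^ m / m.factorial)) * τ ^ (j - q + m) := by
            gcongr
        _ = (3 / 2) ^ j * (j.choose q) * Vm ^ (i + q) * ((τ * W) ^ (j - q)) * ((τ * (L * W)) ^ m / m.factorial) := by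
            rw [pow_add, pow_add, pow_add, mul_pow, mul_pow, mul_pow]; ring
        _ ≤ (3 / 2) ^ j * (j.choose q) * Vm ^ (i + q) * (Vm ^ (j - q)) * ((τ * (L * W)) ^ m / m.factorial) := by
            gcongr
        _ = _ := by
            have : i + j = (i + q) + (j - q) := by omega
            rw [this, pow_add _ (i + q)]; ring
    · simp only [mul_zero, zero_mul, abs_zero]
      positivity
  refine step.trans ?_
  have h2 : ∀ q, ∑ m ∈ Finset.range M0,
        ((3 / 2 : ℝ) ^ j * Vm ^ (i + j) * (j.choose q)) * ((τ * (L * W)) ^ m / m.factorial)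
        ≤ ((3 / 2 : ℝ) ^ j * Vm ^ (i + j) * (j.choose q)) * Real.exp (τ * (L * W)) := by
    intro q
    rw [← Finset.mul_sum]
    have := exp_sum_le (τ * (L * W)) (by positivity) M0
    gcongr
  refine (Finset.sum_le_sum fun q _ => h2 q).trans ?_
  rw [← Finset.sum_mul, ← Finset.mul_sum]
  have h3 : ∑ q ∈ Finset.range (j + 1), ((j.choose q : ℕ) : ℝ) = 2 ^ j := by
    rw [← Nat.cast_sum, Nat.sum_range_choose]; simp
  rw [h3]
  have h4 : (3 / 2 : ℝ) ^ j * Vm ^ (i + j) * 2 ^ j ≤ (3 * Vm) ^ K := by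
    calc (3 / 2 : ℝ) ^ j * Vm ^ (i + j) * 2 ^ j = 3 ^ j * Vm ^ (i + j) := by
          have : (3 : ℝ) ^ j = (3 / 2) ^ j * 2 ^ j := by rw [← mul_pow]; norm_num
          rw [this]; ring
      _ ≤ 3 ^ K * Vm ^ K := by
          gcongr
          · norm_num
          · omega
      _ = _ := by rw [mul_pow]
  gcongr

theorem exp_tail (x τ : ℝ) (hτ : 1 ≤ τ) (M : ℕ) :
    |Real.exp x - ∑ m ∈ Finset.range M, x ^ m / m.factorial| ≤ Real.exp (τ * |x|) / τ ^ M := by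
  have hs : ∀ y : ℝ, HasSum (fun m : ℕ => y ^ m / m.factorial) (Real.exp y) := by
    intro y
    rw [Real.exp_eq_exp_ℝ]
    exact NormedSpace.expSeries_div_hasSum_exp y
  have h1 := (hasSum_nat_add_iff' M).mpr (hs x)
  have h2 := (hasSum_nat_add_iff' M).mpr (hs (τ * |x|))
  have h3 := h2.mul_right (1 / τ ^ M)
  have h4 : ∀ m : ℕ, ‖x ^ (m + M) / ((m + M).factorial : ℝ)‖ ≤ (τ * |x|) ^ (m + M) / ((m + M).factorial : ℝ) * (1 / τ ^ M) := by
    intro m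
    rw [norm_div, norm_pow, Real.norm_eq_abs, Real.norm_eq_abs, Nat.abs_cast, mul_pow]
    have : τ ^ (m + M) = τ ^ m * τ ^ M := pow_add _ _ _
    rw [this]
    have h0 : (0 : ℝ) < τ ^ M := by positivity
    have : τ ^ m * τ ^ M * |x| ^ (m + M) / ((m + M).factorial : ℝ) * (1 / τ ^ M) = τ ^ m * (|x| ^ (m + M) / ((m + M).factorial : ℝ)) := by
      field_simp
    rw [this]
    apply le_mul_of_one_le_left (by positivity)
    exact one_le_pow₀ hτ
  have h5 := tsum_of_norm_bounded h3 h4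
  rw [h1.tsum_eq, Real.norm_eq_abs] at h5
  refine h5.trans ?_
  rw [mul_one_div]
  gcongr
  have : 0 ≤ ∑ m ∈ Finset.range M, (τ * |x|) ^ m / (m.factorial : ℝ) := Finset.sum_nonneg fun _ _ => by positivity
  linarith

theorem det_upper {ι : Type*} [Fintype ι] [DecidableEq ι] (K M0 : ℕ) (hK : 0 < K) (ci cj : ι → ℕ) (hc : ∀ c, ci c + cj c < K)
    (lam : ι → ℝ) (L : ℝ) (hlam : ∀ c, |lam c| ≤ L) (V Z w ω : ι → ℝ) (κ l2 : ℝ) (hκ0 : 0 ≤ κ) (hκ1 : κ ≤ 1)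
    (hl2 : 2 / 3 ≤ l2) (hZ : ∀ μ, l2 * Z μ = w μ - κ * V μ) (Vm W : ℝ) (hV : ∀ μ, |V μ| ≤ Vm) (hZm : ∀ μ, |Z μ| ≤ Vm)
    (hVm : 1 ≤ Vm) (hw : ∀ μ, |w μ| ≤ W) (τ : ℝ) (hτ : 1 ≤ τ) (hW : τ * W ≤ Vm)
    (hp : ∀ μ, ∀ c, |lam c * (ω μ - w μ)| ≤ 1 / τ ^ M0 / 2) :
    |(Matrix.of fun μ c => V μ ^ ci c * Z μ ^ cj c * Real.exp (lam c * ω μ)).det| ≤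
      (Fintype.card ι).factorial * ((K * (M0 + K) : ℕ) + 1 : ℝ) ^ Fintype.card ι *
        ((3 * Vm) ^ K * Real.exp (τ * (L * W))) ^ Fintype.card ι *
        τ ^ (K * ∑ m ∈ Finset.range M0, (M0 - m)) / τ ^ (Fintype.card ι * M0) := by
  have key := det_bound (ι := ι) (κ := Fin K × Fin (M0 + K)) (fun μ k => V μ ^ (k.1 : ℕ) * w μ ^ (k.2 : ℕ))
    (fun k c => yc κ l2 M0 (ci c) (cj c) (lam c) k.1 k.2)
    (fun μ c => V μ ^ ci c * Z μ ^ cj c * (Real.exp (lam c * ω μ) - ∑ m ∈ Finset.range M0, (lam c * w μ) ^ m / m.factorial))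
    ((3 * Vm) ^ K * Real.exp (τ * (L * W))) τ (by positivity) hτ (fun k => k.2) M0
    (fun μ k c => yc_bound κ l2 hκ0 hκ1 hl2 M0 _ _ K (hc c) _ _ _ Vm W L τ (hlam c) (hV μ) hVm (hw μ) (by linarith) hW _ _)
    (by
      intro μ c
      have hW0 : 0 ≤ W := (abs_nonneg _).trans (hw μ)
      have hL0 : 0 ≤ L := (abs_nonneg _).trans (hlam c)
      have hx : |lam c * w μ| ≤ L * W := by
        rw [abs_mul]; exact mul_le_mul (hlam c) (hw μ) (abs_nonneg _) hL0
      have t1 := exp_tail (lam c * w μ) τ hτ M0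
      have t1' : Real.exp (τ * |lam c * w μ|) / τ ^ M0 ≤ Real.exp (τ * (L * W)) / τ ^ M0 := by gcongr
      have t2 : |Real.exp (lam c * ω μ) - Real.exp (lam c * w μ)| ≤ Real.exp (τ * (L * W)) / τ ^ M0 := by
        have : Real.exp (lam c * ω μ) - Real.exp (lam c * w μ) = Real.exp (lam c * w μ) * (Real.exp (lam c * (ω μ - w μ)) - 1) := by
          rw [mul_sub, ← Real.exp_add, mul_one]; ring_nf
        rw [this, abs_mul, Real.abs_exp]
        have hle1 : 1 / τ ^ M0 ≤ 1 := by
          rw [div_le_one (by positivity)]; exact one_le_pow₀ hτ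
        have h1 : |Real.exp (lam c * (ω μ - w μ)) - 1| ≤ 2 * |lam c * (ω μ - w μ)| :=
          Real.abs_exp_sub_one_le (by linarith [hp μ c])
        have h2 : Real.exp (lam c * w μ) ≤ Real.exp (τ * (L * W)) := by
          apply Real.exp_le_exp.mpr
          have := le_abs_self (lam c * w μ)
          have : L * W ≤ τ * (L * W) := le_mul_of_one_le_left (by positivity) hτ
          linarith
        calc _ ≤ Real.exp (τ * (L * W)) * (1 / τ ^ M0) := by
              apply mul_le_mul h2 _ (abs_nonneg _) (Real.exp_pos _).le
              linarith [hp μ c]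
          _ = _ := by ring
      have t3 : |Real.exp (lam c * ω μ) - ∑ m ∈ Finset.range M0, (lam c * w μ) ^ m / m.factorial| ≤ 2 * (Real.exp (τ * (L * W)) / τ ^ M0) := by
        have := abs_sub_le (Real.exp (lam c * ω μ)) (Real.exp (lam c * w μ)) (∑ m ∈ Finset.range M0, (lam c * w μ) ^ m / m.factorial)
        linarith
      have t4 : |V μ ^ ci c * Z μ ^ cj c| ≤ Vm ^ K := by
        rw [abs_mul, abs_pow, abs_pow]
        calc |V μ| ^ ci c * |Z μ| ^ cj c ≤ Vm ^ ci c * Vm ^ cj c := by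
              have := hV μ
              have := hZm μ
              gcongr
          _ = Vm ^ (ci c + cj c) := by rw [pow_add]
          _ ≤ Vm ^ K := pow_le_pow_right₀ hVm (hc c).le
      rw [abs_mul]
      have h3K : (2 : ℝ) ≤ 3 ^ K := by
        calc (2 : ℝ) ≤ 3 ^ 1 := by norm_num
          _ ≤ 3 ^ K := pow_le_pow_right₀ (by norm_num) hK
      calc _ ≤ Vm ^ K * (2 * (Real.exp (τ * (L * W)) / τ ^ M0)) := mul_le_mul t4 t3 (abs_nonneg _) (by positivity)
        _ = 2 * Vm ^ K * Real.exp (τ * (L * W)) / τ ^ M0 := by ring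
        _ ≤ 3 ^ K * Vm ^ K * Real.exp (τ * (L * W)) / τ ^ M0 := by gcongr
        _ = _ := by rw [mul_pow])
  have hmat : (Matrix.of fun μ c => (∑ k : Fin K × Fin (M0 + K), (V μ ^ (k.1 : ℕ) * w μ ^ (k.2 : ℕ)) * yc κ l2 M0 (ci c) (cj c) (lam c) k.1 k.2) +
      V μ ^ ci c * Z μ ^ cj c * (Real.exp (lam c * ω μ) - ∑ m ∈ Finset.range M0, (lam c * w μ) ^ m / m.factorial))
      = Matrix.of fun μ c => V μ ^ ci c * Z μ ^ cj c * Real.exp (lam c * ω μ) := by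
    ext μ c
    simp only [Matrix.of_apply]
    rw [yc_expand κ l2 (by linarith) M0 _ _ K (hc c) _ _ _ _ (hZ μ)]
    ring
  rw [hmat] at key
  have hcard : Fintype.card (Fin K × Fin (M0 + K)) = K * (M0 + K) := by simp
  have hsum : ∑ k : Fin K × Fin (M0 + K), (M0 - (k.2 : ℕ)) = K * ∑ m ∈ Finset.range M0, (M0 - m) := by
    rw [Fintype.sum_prod_type]
    simp only [Finset.sum_const, Finset.card_univ, Fintype.card_fin, smul_eq_mul]
    congr 1
    rw [Fin.sum_univ_eq_sum_range (fun m => M0 - m) (M0 + K), Finset.sum_range_add]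
    simp
  rw [hcard, hsum] at key
  exact key


theorem pow_toNat_eq (x : ℝ) (k : ℤ) (hk : 0 ≤ k) : x ^ k.toNat = x ^ k := by
  rw [← zpow_natCast, Int.toNat_of_nonneg hk]

theorem abs_mul_le_nat {r l : ℤ} {R L : ℕ} (hr : |r| ≤ R) (hl : |l| ≤ L) : |r * l| ≤ ((R * L : ℕ) : ℤ) := by
  rw [abs_mul]; push_cast
  exact mul_le_mul hr hl (abs_nonneg _) (by positivity)

open Polynomial in
noncomputable def entP (η : ℤ[X]) (R S T L : ℕ) (V Z r s t : ℤ) (i j : ℕ) (l : ℤ) : ℤ[X] :=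
  C (V ^ i * Z ^ j * 2 ^ (((S * L : ℕ) : ℤ) + s * l).toNat) * X ^ (((R * L : ℕ) : ℤ) + r * l).toNat *
    (2 * X - 1) ^ (((T * L : ℕ) : ℤ) + t * l).toNat * η ^ (((T * L : ℕ) : ℤ) - t * l).toNat

open Polynomial in
theorem entP_alpha (η : ℤ[X]) (R S T L : ℕ) (V Z r s t : ℤ) (i j : ℕ) (l : ℤ)
    (hr : |r| ≤ R) (hs : |s| ≤ S) (ht : |t| ≤ T) (hl : |l| ≤ L) (hη : 0 < aeval Real.goldenRatio η) :
    aeval Real.goldenRatio (entP η R S T L V Z r s t i j l) =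
      (Real.goldenRatio ^ R * 2 ^ S * (√5 * aeval Real.goldenRatio η) ^ T) ^ L *
      ((V : ℝ) ^ i * (Z : ℝ) ^ j * (Real.goldenRatio ^ r * 2 ^ s * (√5 / aeval Real.goldenRatio η) ^ t) ^ l) := by
  have h1 := abs_le.mp (abs_mul_le_nat hr hl)
  have h2 := abs_le.mp (abs_mul_le_nat hs hl)
  have h3 := abs_le.mp (abs_mul_le_nat ht hl)
  have hxi : 2 * Real.goldenRatio - 1 = √5 := by rw [Real.goldenRatio]; ring
  have h5 : (0 : ℝ) < √5 := by positivity
  have hφ := Real.goldenRatio_pos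
  simp only [entP, map_mul, map_pow, aeval_C, aeval_X, map_sub, map_one, map_ofNat]
  rw [hxi]
  set y := aeval Real.goldenRatio η
  have e0 : (algebraMap ℤ ℝ) 2 = 2 := by simp
  rw [pow_toNat_eq _ _ (by linarith), pow_toNat_eq _ _ (by linarith), pow_toNat_eq _ _ (by linarith), pow_toNat_eq _ _ (by linarith)]
  rw [zpow_add₀ (by norm_num), zpow_add₀ hφ.ne', zpow_add₀ h5.ne', zpow_sub₀ hη.ne']
  rw [zpow_natCast, zpow_natCast, zpow_natCast, zpow_natCast, zpow_mul, zpow_mul, zpow_mul, zpow_mul]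
  rw [pow_mul, pow_mul, pow_mul, pow_mul]
  simp only [mul_pow, mul_zpow, div_zpow, algebraMap_int_eq, eq_intCast, Int.cast_ofNat]
  ring

open Polynomial in
theorem entP_beta (η : ℤ[X]) (R S T L K : ℕ) (V Z r s t : ℤ) (i j : ℕ) (l : ℤ)
    (hr : |r| ≤ R) (hs : |s| ≤ S) (ht : |t| ≤ T) (hl : |l| ≤ L) (E Vm : ℝ) (hE : 4 ≤ E)
    (hη : |aeval Real.goldenConj η| ≤ E) (hVm : 1 ≤ Vm) (hV : |(V : ℝ)| ≤ Vm) (hZ : |(Z : ℝ)| ≤ Vm) (hij : i + j < K) :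
    |aeval Real.goldenConj (entP η R S T L V Z r s t i j l)| ≤
      Vm ^ K * 2 ^ (2 * (S * L)) * E ^ (2 * (T * L)) := by
  have h1 := abs_le.mp (abs_mul_le_nat hr hl)
  have h2 := abs_le.mp (abs_mul_le_nat hs hl)
  have h3 := abs_le.mp (abs_mul_le_nat ht hl)
  have hxi : 2 * Real.goldenConj - 1 = -√5 := by rw [Real.goldenConj]; ring
  have h5 : √5 ≤ E := by
    have : √5 ≤ 4 := by rw [Real.sqrt_le_left (by norm_num)]; norm_num
    linarith
  have hψ : |Real.goldenConj| ≤ 1 := by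
    rw [abs_le]; constructor <;> linarith [Real.goldenConj_neg, Real.neg_one_lt_goldenConj]
  simp only [entP, map_mul, map_pow, aeval_C, aeval_X, map_sub, map_one, map_ofNat]
  rw [hxi]
  simp only [abs_mul, abs_pow, abs_neg, abs_of_nonneg (Real.sqrt_nonneg 5)]
  simp only [algebraMap_int_eq, eq_intCast, Int.cast_ofNat, abs_two]
  set y := aeval Real.goldenConj η
  have e1 : |(V : ℝ)| ^ i * |(Z : ℝ)| ^ j ≤ Vm ^ K := by
    calc _ ≤ Vm ^ i * Vm ^ j := by gcongr
      _ = Vm ^ (i + j) := by rw [pow_add]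
      _ ≤ _ := pow_le_pow_right₀ hVm hij.le
  have e2 : (2 : ℝ) ^ (((S * L : ℕ) : ℤ) + s * l).toNat ≤ 2 ^ (2 * (S * L)) := by
    apply pow_le_pow_right₀ (by norm_num)
    omega
  have e3 : |Real.goldenConj| ^ (((R * L : ℕ) : ℤ) + r * l).toNat ≤ 1 := pow_le_one₀ (abs_nonneg _) hψ
  have e4 : √5 ^ (((T * L : ℕ) : ℤ) + t * l).toNat * |y| ^ (((T * L : ℕ) : ℤ) - t * l).toNat ≤ E ^ (2 * (T * L)) := by
    calc _ ≤ E ^ (((T * L : ℕ) : ℤ) + t * l).toNat * E ^ (((T * L : ℕ) : ℤ) - t * l).toNat := by gcongr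
      _ = _ := by
        rw [← pow_add]; congr 1; omega
  have hE0 : 0 ≤ E := by linarith
  calc _ = (|(V : ℝ)| ^ i * |(Z : ℝ)| ^ j) * (2 : ℝ) ^ (((S * L : ℕ) : ℤ) + s * l).toNat * |Real.goldenConj| ^ (((R * L : ℕ) : ℤ) + r * l).toNat *
      (√5 ^ (((T * L : ℕ) : ℤ) + t * l).toNat * |y| ^ (((T * L : ℕ) : ℤ) - t * l).toNat) := by ring
    _ ≤ Vm ^ K * 2 ^ (2 * (S * L)) * 1 * E ^ (2 * (T * L)) := by gcongr
    _ = _ := by ring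

open Polynomial in
theorem det_lower {ι : Type*} [Fintype ι] [DecidableEq ι] (η : ℤ[X]) (R S T L K : ℕ) (V Z r s t : ι → ℤ) (ci cj : ι → ℕ) (lam : ι → ℤ)
    (hr : ∀ μ, |r μ| ≤ R) (hs : ∀ μ, |s μ| ≤ S) (ht : ∀ μ, |t μ| ≤ T) (hl : ∀ c, |lam c| ≤ L) (E Vm : ℝ) (hE : 4 ≤ E)
    (hη1 : 1 ≤ aeval Real.goldenRatio η) (hη4 : aeval Real.goldenRatio η ≤ 4)
    (hη : |aeval Real.goldenConj η| ≤ E) (hVm : 1 ≤ Vm) (hV : ∀ μ, |(V μ : ℝ)| ≤ Vm) (hZ : ∀ μ, |(Z μ : ℝ)| ≤ Vm)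
    (hc : ∀ c, ci c + cj c < K)
    (hdet : (Matrix.of fun μ c => (V μ : ℝ) ^ ci c * (Z μ : ℝ) ^ cj c *
      (Real.goldenRatio ^ r μ * 2 ^ s μ * (√5 / aeval Real.goldenRatio η) ^ t μ) ^ lam c).det ≠ 0) :
    1 ≤ ((Real.goldenRatio ^ R * 2 ^ S * (√5 * 4) ^ T) ^ L) ^ Fintype.card ι *
      |(Matrix.of fun μ c => (V μ : ℝ) ^ ci c * (Z μ : ℝ) ^ cj c *
      (Real.goldenRatio ^ r μ * 2 ^ s μ * (√5 / aeval Real.goldenRatio η) ^ t μ) ^ lam c).det| *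
      ((Fintype.card ι).factorial * (Vm ^ K * 2 ^ (2 * (S * L)) * E ^ (2 * (T * L))) ^ Fintype.card ι) := by
  set D : ℝ := (Real.goldenRatio ^ R * 2 ^ S * (√5 * aeval Real.goldenRatio η) ^ T) ^ L with hD
  set A := (Matrix.of fun μ c => (V μ : ℝ) ^ ci c * (Z μ : ℝ) ^ cj c *
      (Real.goldenRatio ^ r μ * 2 ^ s μ * (√5 / aeval Real.goldenRatio η) ^ t μ) ^ lam c) with hA
  have hφ := Real.goldenRatio_pos
  have hy0 : 0 < aeval Real.goldenRatio η := by linarith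
  have hD0 : 0 < D := by positivity
  set P : Matrix ι ι ℤ[X] := Matrix.of fun μ c => entP η R S T L (V μ) (Z μ) (r μ) (s μ) (t μ) (ci c) (cj c) (lam c) with hP
  have ha : aeval Real.goldenRatio P.det = D ^ Fintype.card ι * A.det := by
    rw [AlgHom.map_det, ← Matrix.det_smul]
    congr 1
    ext μ c
    simp only [hP, hA, AlgHom.mapMatrix_apply, Matrix.map_apply, Matrix.of_apply, Matrix.smul_apply, smul_eq_mul]
    exact entP_alpha η R S T L _ _ _ _ _ _ _ _ (hr μ) (hs μ) (ht μ) (hl c) hy0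
  have hb : |aeval Real.goldenConj P.det| ≤ (Fintype.card ι).factorial * (Vm ^ K * 2 ^ (2 * (S * L)) * E ^ (2 * (T * L))) ^ Fintype.card ι := by
    rw [AlgHom.map_det]
    have := Matrix.det_le (A := (aeval Real.goldenConj).mapMatrix P) (abv := AbsoluteValue.abs)
      (x := Vm ^ K * 2 ^ (2 * (S * L)) * E ^ (2 * (T * L))) (by
        intro μ c
        simp only [hP, AlgHom.mapMatrix_apply, Matrix.map_apply, Matrix.of_apply, AbsoluteValue.abs_apply]
        exact entP_beta η R S T L K _ _ _ _ _ _ _ _ (hr μ) (hs μ) (ht μ) (hl c) E Vm hE hη hVm (hV μ) (hZ μ) (hc c))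
    simpa [nsmul_eq_mul] using this
  have hL := liouville_gold P.det (by rw [ha]; exact mul_ne_zero (by positivity) hdet)
  rw [ha, abs_mul, abs_of_pos (by positivity : 0 < D ^ Fintype.card ι)] at hL
  refine hL.trans ?_
  have hDD : D ≤ (Real.goldenRatio ^ R * 2 ^ S * (√5 * 4) ^ T) ^ L := by
    rw [hD]; gcongr
  gcongr


abbrev Col (K L : ℕ) : Type := (Σ s : Fin K, Fin ((s : ℕ) + 1)) × Fin L

def Col.i {K L : ℕ} (c : Col K L) : ℕ := (c.1.1 : ℕ) - (c.1.2 : ℕ)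
def Col.j {K L : ℕ} (c : Col K L) : ℕ := (c.1.2 : ℕ)
def Col.l {K L : ℕ} (c : Col K L) : ℕ := (c.2 : ℕ)

theorem Col.ij {K L : ℕ} (c : Col K L) : c.i + c.j < K := by
  have h1 := c.1.2.isLt
  have h2 := c.1.1.isLt
  simp only [Col.i, Col.j]; omega

theorem Col.card (K L : ℕ) : 2 * Fintype.card (Col K L) = K * (K + 1) * L := by
  have h1 : Fintype.card (Col K L) = (∑ s ∈ Finset.range K, (s + 1)) * L := by
    rw [Fintype.card_prod, Fintype.card_sigma]
    simp only [Fintype.card_fin]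
    rw [Fin.sum_univ_eq_sum_range (fun s => s + 1) K]
  have h2 : ∀ K : ℕ, 2 * ∑ s ∈ Finset.range K, (s + 1) = K * (K + 1) := by
    intro K
    induction K with
    | zero => simp
    | succ k ih => rw [Finset.sum_range_succ, mul_add, ih]; ring
  rw [h1, ← mul_assoc, h2]

theorem indep_cols (b H : ℕ) (hb : 87 ≤ b) (hH : 23 ≤ H) (n a : ℤ) (u : ℕ) (hu : u = b ^ 2 * H)
    (hn : 21000 * (u : ℤ) < n) (h1 : 210000 * (H : ℤ) ≤ 193 * n - 278 * a) (h2 : 210000 * (H : ℤ) ≤ 955 * a - 663 * n)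
    (γ : ℝ) (hγ : 0 < γ) (v : Col (420000 * u) (6 * b + 1) → ℝ)
    (hv : ∀ e ∈ boxE (10500 * u) (7000 * u) (100000 * b ^ 2),
      ∑ c, ((ptE n a e 0) ^ c.i * (ptE n a e 1) ^ c.j * (thE γ e) ^ ((c.l : ℤ) - 3 * b)) * v c = 0) : v = 0 := by
  classical
  let P : ℕ → MvPolynomial (Fin 2) ℝ := fun l =>
    if h : l < 6 * b + 1 then ∑ k : (Σ s : Fin (420000 * u), Fin ((s : ℕ) + 1)),
      MvPolynomial.monomial (Finsupp.single 0 ((k.1 : ℕ) - (k.2 : ℕ)) + Finsupp.single 1 (k.2 : ℕ)) (v (k, ⟨l, h⟩)) else 0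
  have hP := zero_lemma b H hb hH n a u hu hn h1 h2 γ hγ P (by
    intro l hl
    simp only [P, dif_pos hl]
    have hK : 0 < 420000 * u := by
      have : 0 < u := by rw [hu]; positivity
      omega
    refine lt_of_le_of_lt (MvPolynomial.totalDegree_finsetSum_le (d := 420000 * u - 1) ?_) (by omega)
    intro k _
    refine (MvPolynomial.totalDegree_monomial_le _ _).trans ?_
    have h1 := k.2.isLt
    have h2 := k.1.isLt
    rw [Finsupp.sum_add_index' (by simp) (by simp), Finsupp.sum_single_index rfl, Finsupp.sum_single_index rfl]
    simp only [id]
    omega) (by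
    intro e he
    have h0 := hv e he
    have hθ := thE_pos hγ e
    have h3 : ∑ l ∈ Finset.range (6 * b + 1), MvPolynomial.eval (ptE n a e) (P l) * (thE γ e) ^ l =
        (thE γ e) ^ (3 * b) * ∑ c : Col (420000 * u) (6 * b + 1), ((ptE n a e 0) ^ c.i * (ptE n a e 1) ^ c.j * (thE γ e) ^ ((c.l : ℤ) - 3 * b)) * v c := by
      rw [Fintype.sum_prod_type_right, Finset.mul_sum, ← Fin.sum_univ_eq_sum_range (fun l => MvPolynomial.eval (ptE n a e) (P l) * (thE γ e) ^ l)]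
      apply Finset.sum_congr rfl
      intro l _
      simp only [P, dif_pos l.isLt, map_sum, Finset.sum_mul, Finset.mul_sum]
      apply Finset.sum_congr rfl
      intro k _
      rw [MvPolynomial.eval_monomial]
      simp only [Col.i, Col.j, Col.l]
      rw [Finsupp.prod_add_index' (by simp) (by intros; rw [pow_add])]
      simp only [pow_zero, Finsupp.prod_single_index]
      rw [zpow_sub₀ hθ.ne', zpow_natCast]
      have : (thE γ e) ^ (3 * (b : ℤ)) = (thE γ e) ^ (3 * b) := by
        rw [← zpow_natCast]; push_cast; rfl
      rw [this]
      have h5 : (thE γ e) ^ (3 * b) ≠ 0 := by positivity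
      field_simp
    rw [h3, h0, mul_zero])
  funext c
  obtain ⟨⟨s, j⟩, l⟩ := c
  have h3 := hP l l.isLt
  simp only [P, dif_pos l.isLt] at h3
  have h4 := congrArg (MvPolynomial.coeff (Finsupp.single 0 ((s : ℕ) - (j : ℕ)) + Finsupp.single 1 (j : ℕ))) h3
  rw [MvPolynomial.coeff_sum, Finset.sum_eq_single (⟨s, j⟩ : Σ s : Fin (420000 * u), Fin ((s : ℕ) + 1))] at h4
  · simpa using h4
  · rintro ⟨s', j'⟩ _ hne
    rw [MvPolynomial.coeff_monomial, if_neg]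
    intro heq
    apply hne
    have q0 := DFunLike.congr_fun heq 0
    have q1 := DFunLike.congr_fun heq 1
    simp at q0 q1
    have i1 := j.isLt
    have i2 := j'.isLt
    have hs : s' = s := by
      apply Fin.ext; omega
    subst hs
    have hj : j' = j := Fin.ext q1
    rw [hj]
  · simp


theorem gold_lt : Real.goldenRatio < 1.61803399 := by
  have : √5 < 2.23606798 := by rw [Real.sqrt_lt' (by norm_num)]; norm_num
  rw [Real.goldenRatio]; linarith

theorem gold_gt : 1.61803398 < Real.goldenRatio := by
  have : 2.23606797 < √5 := by rw [Real.lt_sqrt (by norm_num)]; norm_num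
  rw [Real.goldenRatio]; linarith

theorem powgold_le (n : ℕ) (B : ℝ) (h : 1.61803399 * (Nat.fib (n + 1) : ℝ) + Nat.fib n ≤ B) : Real.goldenRatio ^ (n + 1) ≤ B := by
  rw [← Real.goldenRatio_mul_fib_succ_add_fib]
  refine le_trans ?_ h
  have := gold_lt.le
  gcongr

theorem powgold_ge (n : ℕ) (B : ℝ) (h : B ≤ 1.61803398 * (Nat.fib (n + 1) : ℝ) + Nat.fib n) : B ≤ Real.goldenRatio ^ (n + 1) := by
  rw [← Real.goldenRatio_mul_fib_succ_add_fib]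
  refine le_trans h ?_
  have := gold_gt.le
  gcongr

theorem lognum_aux1 (k m : ℕ) (h1 : Real.goldenRatio ^ k ≤ 2 ^ m / 1.0002) :
    k * Real.log Real.goldenRatio + 0.0001 ≤ m * Real.log 2 := by
  have hφ := Real.goldenRatio_pos
  have h3 := Real.log_le_log (by positivity) h1
  rw [Real.log_div (by positivity) (by norm_num), Real.log_pow, Real.log_pow] at h3
  have h4 := Real.one_sub_inv_le_log_of_pos (show (0 : ℝ) < 1.0002 by norm_num)
  norm_num at h3 h4 ⊢
  linarith

theorem lognum_aux2 (k m : ℕ) (h1 : 2 ^ m * 1.0002 ≤ Real.goldenRatio ^ k) :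
    m * Real.log 2 + 0.0001 ≤ k * Real.log Real.goldenRatio := by
  have hφ := Real.goldenRatio_pos
  have h3 := Real.log_le_log (by positivity) h1
  rw [Real.log_mul (by positivity) (by norm_num), Real.log_pow, Real.log_pow] at h3
  have h4 := Real.one_sub_inv_le_log_of_pos (show (0 : ℝ) < 1.0002 by norm_num)
  norm_num at h3 h4 ⊢
  linarith

set_option exponentiation.threshold 2000 in
theorem lognum1 : 278 * Real.log Real.goldenRatio + 0.0001 ≤ 193 * Real.log 2 := by
  have := lognum_aux1 278 193 (powgold_le 277 _ (by norm_num))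
  exact_mod_cast this

set_option exponentiation.threshold 2000 in
theorem lognum2 : 663 * Real.log 2 + 0.0001 ≤ 955 * Real.log Real.goldenRatio := by
  have := lognum_aux2 955 663 (powgold_ge 954 _ (by norm_num))
  exact_mod_cast this

theorem loggold_lt : Real.log Real.goldenRatio < 0.481214 := by
  have := lognum1
  have := Real.log_two_lt_d9
  norm_num at *
  linarith

theorem loggold_gt : 0.48121 < Real.log Real.goldenRatio := by
  have := lognum2
  have := Real.log_two_gt_d9
  norm_num at *
  linarith

theorem logsqrt5 : Real.log √5 ≤ 0.80868 ∧ Real.log 2 ≤ Real.log √5 := by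
  have h1 : Real.log √5 = Real.log 5 / 2 := by rw [Real.log_sqrt (by norm_num)]
  have h2 : 3 * Real.log 5 ≤ 7 * Real.log 2 := by
    have := Real.log_le_log (by norm_num) (show (5 : ℝ) ^ 3 ≤ 2 ^ 7 by norm_num)
    rw [Real.log_pow, Real.log_pow] at this
    exact_mod_cast this
  have h3 : 2 * Real.log 2 ≤ Real.log 5 := by
    have := Real.log_le_log (by norm_num) (show (2 : ℝ) ^ 2 ≤ 5 by norm_num)
    rw [Real.log_pow] at this
    exact_mod_cast this
  have := Real.log_two_lt_d9
  rw [h1]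
  norm_num at *
  constructor <;> linarith

theorem exp3_lt : Real.exp 3 < 20.0856 := by
  have h : Real.exp 3 = Real.exp 1 ^ 3 := by rw [← Real.exp_nat_mul]; norm_num
  have h1 := Real.exp_one_lt_d9
  rw [h]
  calc Real.exp 1 ^ 3 < 2.7182818286 ^ 3 := by gcongr
    _ < _ := by norm_num

theorem ml_num (b H d u κ l2 τ c5 T : ℝ) (hb : 87 ≤ b) (hd : 0 ≤ d) (hdH : d + 23 ≤ H) (hu : u = b ^ 2 * H) (hT : T = 100000 * b ^ 2)
    (hκ0 : 0 ≤ κ) (hκ : κ ≤ 0.481214) (hl0 : 0 ≤ l2) (hl : l2 ≤ 0.693148) (hτ0 : 0 ≤ τ) (hτ : τ ≤ 20.0856) (hc : c5 ≤ 2.195) :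
    10 * b + (420000 * u * b + τ * (3 * b * (10500 * u * κ + 7000 * u * l2 + 0.82 * T))) +
      3 * b * (10500 * u * κ + 7000 * u * l2 + T * c5) +
      (420000 * u * b + 2 * (7000 * u * (3 * b)) * l2 + 2 * (T * (3 * b)) * (2 * l2 + d * κ))
      < 1.5 * (210000 * u * (6 * b + 1) - 1) := by
  have hu0 : 0 < u := by rw [hu]; have : 0 < H := by linarith
                         positivity
  have hub : 0 < u * b := by positivity
  have hT0 : 0 < T := by rw [hT]; positivity
  have hTb : 0 < T * b := by positivity
  have a1 : τ * κ ≤ 9.6656 := by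
    calc τ * κ ≤ 20.0856 * 0.481214 := by gcongr
      _ ≤ _ := by norm_num
  have a2 : τ * l2 ≤ 13.9224 := by
    calc τ * l2 ≤ 20.0856 * 0.693148 := by gcongr
      _ ≤ _ := by norm_num
  have b1 : (u * b) * (τ * κ) ≤ (u * b) * 9.6656 := by gcongr
  have b2 : (u * b) * (τ * l2) ≤ (u * b) * 13.9224 := by gcongr
  have b3 : (u * b) * κ ≤ (u * b) * 0.481214 := by gcongr
  have b4 : (u * b) * l2 ≤ (u * b) * 0.693148 := by gcongr
  have b5 : (T * b) * (τ * 0.82 + c5 + 4 * l2 + 2 * d * κ) ≤ (T * b) * H := by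
    have : 2 * d * κ ≤ 2 * d * 0.481214 := by gcongr
    gcongr
    norm_num at *
    linarith
  have b6 : (T * b) * H = 100000 * (u * b) := by rw [hT, hu]; ring
  have b7 : b ≤ u * b := by
    have : 1 ≤ u := by
      rw [hu]; nlinarith
    nlinarith
  norm_num at *
  linarith


theorem two_sum_sub (M0 : ℕ) : 2 * ∑ m ∈ Finset.range M0, (M0 - m) = M0 * (M0 + 1) := by
  have h : ∑ m ∈ Finset.range M0, (M0 - m) = ∑ m ∈ Finset.range M0, (m + 1) := by
    rw [← Finset.sum_range_reflect]
    apply Finset.sum_congr rfl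
    intro m hm
    have := Finset.mem_range.mp hm
    omega
  rw [h]
  clear h
  induction M0 with
  | zero => simp
  | succ k ih => rw [Finset.sum_range_succ, mul_add, ih]; ring

theorem ml_contra (N K M0 : ℕ) (hN : N = (K + 1) * M0) (hN0 : 0 < N) (C B Q b0 Dt c1 c2 c3 c4 c5 : ℝ)
    (hC0 : 0 ≤ C) (hB0 : 0 ≤ B) (hQ0 : 0 ≤ Q) (hb00 : 0 ≤ b0)
    (hC : C ≤ Real.exp c1) (hB : B ≤ Real.exp c2) (hNe : (N : ℝ) ≤ Real.exp c3) (hQ : Q ≤ Real.exp c4) (hb0 : b0 ≤ Real.exp c5)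
    (hlow : 1 ≤ C ^ N * Dt * (N.factorial * B ^ N))
    (hup : Dt ≤ N.factorial * Q ^ N * b0 ^ N * Real.exp 3 ^ (K * ∑ m ∈ Finset.range M0, (M0 - m)) / Real.exp 3 ^ (N * M0))
    (hneg : 2 * c3 + c4 + c5 + c1 + c2 < 1.5 * ((M0 : ℝ) - 1)) : False := by
  have hf : (N.factorial : ℝ) ≤ Real.exp (N * c3) := by
    have h1 : (N.factorial : ℝ) ≤ (N : ℝ) ^ N := by exact_mod_cast Nat.factorial_le_pow N
    refine h1.trans ?_
    rw [Real.exp_nat_mul]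
    gcongr
  set s := ∑ m ∈ Finset.range M0, (M0 - m) with hs
  have hs2 : 2 * (s : ℝ) = M0 * (M0 + 1) := by exact_mod_cast two_sum_sub M0
  have hpw : ∀ x c : ℝ, 0 ≤ x → x ≤ Real.exp c → x ^ N ≤ Real.exp (N * c) := by
    intro x c h0 h
    rw [Real.exp_nat_mul]; gcongr
  have hτ : Real.exp 3 ^ (K * s) / Real.exp 3 ^ (N * M0) = Real.exp (3 * (K * s) - 3 * (N * M0)) := by
    rw [Real.exp_sub, ← Real.exp_nat_mul, ← Real.exp_nat_mul]
    push_cast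
    ring_nf
  rw [mul_div_assoc, hτ] at hup
  have e1 := hpw C c1 hC0 hC
  have e2 := hpw B c2 hB0 hB
  have e3 := hpw Q c4 hQ0 hQ
  have e4 := hpw b0 c5 hb00 hb0
  have : (1 : ℝ) ≤ Real.exp (N * c1) * (Real.exp (N * c3) * Real.exp (N * c4) * Real.exp (N * c5) * Real.exp (3 * (K * s) - 3 * (N * M0))) * (Real.exp (N * c3) * Real.exp (N * c2)) := by
    refine hlow.trans ?_
    calc C ^ N * Dt * (N.factorial * B ^ N) ≤ C ^ N * (N.factorial * Q ^ N * b0 ^ N * Real.exp (3 * (K * s) - 3 * (N * M0))) * (N.factorial * B ^ N) := by gcongr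
      _ ≤ _ := by gcongr
  simp only [← Real.exp_add] at this
  rw [Real.one_le_exp_iff] at this
  have hNr : (N : ℝ) = (K + 1) * M0 := by exact_mod_cast hN
  have hN0r : (0 : ℝ) < N := by exact_mod_cast hN0
  have h7 : 2 * ((K : ℝ) * s) ≤ N * (M0 + 1) := by
    have : 2 * ((K : ℝ) * s) = K * M0 * (M0 + 1) := by linear_combination (K : ℝ) * hs2
    rw [this, hNr]
    have : (0 : ℝ) ≤ M0 := by positivity
    nlinarith
  have h8 : (N : ℝ) * (2 * c3 + c4 + c5 + c1 + c2) < N * (1.5 * ((M0 : ℝ) - 1)) := by gcongr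
  norm_num at h8
  nlinarith


theorem zz_aux (n a : ℕ) (κ l2 : ℝ) (H : ℕ) (hn0 : (0 : ℝ) ≤ n) (hn : 3000000000000 * (H : ℝ) ≤ n) (hH : (23 : ℝ) ≤ H)
    (hl : 0.6 < l2) (hl' : l2 < 1) (h1 : 278 * κ + 0.0001 ≤ 193 * l2) (h2 : 663 * l2 + 0.0001 ≤ 955 * κ)
    (hX : |n * κ - a * l2| ≤ 0.82) :
    210000 * (H : ℤ) ≤ 193 * (n : ℤ) - 278 * a ∧ 210000 * (H : ℤ) ≤ 955 * (a : ℤ) - 663 * n := by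
  have hX' := abs_le.mp hX
  have e2 : l2 * (210000 * (H : ℝ)) ≤ 1 * (210000 * (H : ℝ)) := by gcongr
  have hl0 : 0 < l2 := by linarith
  constructor
  · have e1 : (n : ℝ) * (278 * κ + 0.0001) ≤ n * (193 * l2) := by gcongr
    have : 210000 * (H : ℝ) ≤ 193 * (n : ℝ) - 278 * a := by
      refine le_of_mul_le_mul_left ?_ hl0
      linarith
    exact_mod_cast this
  · have e1 : (n : ℝ) * (663 * l2 + 0.0001) ≤ n * (955 * κ) := by gcongr
    have : 210000 * (H : ℝ) ≤ 955 * (a : ℝ) - 663 * n := by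
      refine le_of_mul_le_mul_left ?_ hl0
      linarith
    exact_mod_cast this

set_option maxHeartbeats 2000000 in
open Polynomial in
theorem ML (b H n a d : ℕ) (hb : 87 ≤ b) (hdH : d + 23 ≤ H) (han : a ≤ n) (hn : 420000000 * (b ^ 2 * H) ≤ n)
    (η : ℤ[X]) (hη1 : 1 ≤ aeval Real.goldenRatio η) (hη4 : aeval Real.goldenRatio η ≤ 4)
    (hηβ : |aeval Real.goldenConj η| ≤ 4 * Real.goldenRatio ^ d)
    (hbn : 3 * ((n : ℝ) * (100000 * b ^ 2 + 1)) ≤ Real.exp b)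
    (hΛ : 600000 * (b : ℝ) ^ 3 * |a * Real.log 2 - n * Real.log Real.goldenRatio + Real.log (√5 / aeval Real.goldenRatio η)|
      ≤ Real.exp (-(630000 * (b ^ 2 * H) * (6 * b + 1)))) : False := by
  obtain ⟨u, hu⟩ : ∃ u, u = b ^ 2 * H := ⟨_, rfl⟩
  have hur : (u : ℝ) = (b : ℝ) ^ 2 * H := by rw [hu]; push_cast; ring
  rw [← hu] at hn
  rw [← hur] at hΛ
  set y := aeval Real.goldenRatio η with hy
  set κ := Real.log Real.goldenRatio with hκ
  set l2 := Real.log 2 with hl2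
  set γ := √5 / y with hγd
  set Λ := a * l2 - n * κ + Real.log γ with hΛd
  have hκlt := loggold_lt
  have hκgt := loggold_gt
  have hl2lt := Real.log_two_lt_d9
  have hl2gt := Real.log_two_gt_d9
  have hs5 := logsqrt5
  rw [← hκ] at hκlt hκgt
  rw [← hl2] at hl2lt hl2gt hs5
  have hφ := Real.goldenRatio_pos
  have hy0 : 0 < y := by linarith
  have h5 : (0 : ℝ) < √5 := by positivity
  have hγ : 0 < γ := by positivity
  have hH : 23 ≤ H := by omega
  have hu1 : 87 ^ 2 * 23 ≤ u := by rw [hu]; gcongr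
  have hbr : (87 : ℝ) ≤ b := by exact_mod_cast hb
  have hnr : 420000000 * (u : ℝ) ≤ n := by exact_mod_cast hn
  have hu1r : (174087 : ℝ) ≤ u := by exact_mod_cast hu1
  have hlogγ : Real.log γ = Real.log √5 - Real.log y := Real.log_div h5.ne' hy0.ne'
  have hly0 : 0 ≤ Real.log y := Real.log_nonneg hη1
  have hly4 : Real.log y ≤ 2 * l2 := by
    have := Real.log_le_log hy0 hη4
    rw [show (4 : ℝ) = 2 ^ 2 by norm_num, Real.log_pow] at this
    exact_mod_cast this
  have hΛ1 : |Λ| ≤ 0.000001 := by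
    have h1 : Real.exp (-(630000 * (u : ℝ) * (6 * b + 1))) ≤ 1 := by
      rw [Real.exp_le_one_iff]
      have : 0 ≤ 630000 * (u : ℝ) * (6 * b + 1) := by positivity
      linarith
    have h2 : (1 : ℝ) ≤ b ^ 3 := one_le_pow₀ (by linarith)
    have h3 : 600000 * 1 * |Λ| ≤ 600000 * (b : ℝ) ^ 3 * |Λ| := by gcongr
    have h4 : 1000000 * |Λ| ≤ 1 := by
      have h2 : (87 : ℝ) ^ 3 ≤ b ^ 3 := by gcongr
      have h3 : 600000 * 87 ^ 3 * |Λ| ≤ 600000 * (b : ℝ) ^ 3 * |Λ| := by gcongr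
      linarith [abs_nonneg Λ]
    norm_num; linarith
  have hΛ2 := abs_le.mp hΛ1
  have hX : |n * κ - a * l2| ≤ 0.82 := by
    have : n * κ - a * l2 = Real.log γ - Λ := by rw [hΛd]; ring
    rw [this, hlogγ, abs_le]
    constructor <;> linarith
  have hX' := abs_le.mp hX
  have ln1 := lognum1
  have ln2 := lognum2
  rw [← hκ, ← hl2] at ln1 ln2
  have hHu : 7569 * (H : ℝ) ≤ u := by
    rw [hur]
    have : (87 : ℝ) ^ 2 ≤ b ^ 2 := by gcongr
    norm_num at this
    gcongr
  have hHr : (23 : ℝ) ≤ H := by exact_mod_cast hH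
  obtain ⟨hz1, hz2⟩ := zz_aux n a κ l2 H (by positivity) (by linarith) hHr (by linarith) (by linarith) ln1 ln2 hX
  obtain ⟨μ, hμ, hdet⟩ := exists_minor (boxE (10500 * u) (7000 * u) (100000 * b ^ 2))
    (fun e (c : Col (420000 * u) (6 * b + 1)) => (ptE n a e 0) ^ c.i * (ptE n a e 1) ^ c.j * (thE γ e) ^ ((c.l : ℤ) - 3 * b))
    (fun v hv => indep_cols b H hb hH n a u hu (by omega) hz1 hz2 γ hγ v hv)
  have hbox := fun c => mem_boxE.mp (hμ c)
  obtain ⟨K, hK⟩ : ∃ K, K = 420000 * u := ⟨_, rfl⟩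
  obtain ⟨M0, hM0⟩ : ∃ M0, M0 = 210000 * u * (6 * b + 1) := ⟨_, rfl⟩
  obtain ⟨R, hR⟩ : ∃ R, R = 10500 * u := ⟨_, rfl⟩
  obtain ⟨S, hS⟩ : ∃ S, S = 7000 * u := ⟨_, rfl⟩
  obtain ⟨T, hT⟩ : ∃ T, T = 100000 * b ^ 2 := ⟨_, rfl⟩
  rw [← hR, ← hS, ← hT] at hbox
  have hKr : (K : ℝ) = 420000 * u := by rw [hK]; push_cast; ring
  have hRr : (R : ℝ) = 10500 * u := by rw [hR]; push_cast; ring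
  have hSr : (S : ℝ) = 7000 * u := by rw [hS]; push_cast; ring
  have hTr : (T : ℝ) = 100000 * (b : ℝ) ^ 2 := by rw [hT]; push_cast; ring
  have hM0r : (M0 : ℝ) = 210000 * u * (6 * b + 1) := by rw [hM0]; push_cast; ring
  set N := Fintype.card (Col (420000 * u) (6 * b + 1)) with hN
  have hNK : N = (K + 1) * M0 := by
    have h := Col.card (420000 * u) (6 * b + 1)
    rw [← hN, ← hK] at h
    have : K * (K + 1) * (6 * b + 1) = 2 * ((K + 1) * M0) := by rw [hM0, hK]; ring
    omega
  have hup0 : 0 < u := by omega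
  have hM1 : 0 < M0 := by rw [hM0]; positivity
  set Vm : ℝ := n * (T + 1) with hVm
  have hT0 : (0 : ℝ) ≤ T := by positivity
  have hn1 : (1 : ℝ) ≤ n := by linarith
  have hnVm : (n : ℝ) ≤ Vm := by rw [hVm]; exact le_mul_of_one_le_right (by positivity) (by linarith)
  have hVm1 : 1 ≤ Vm := by linarith
  have hbn' : 3 * Vm ≤ Real.exp b := by rw [hVm, hTr]; exact hbn
  have hanr : (a : ℝ) ≤ n := by exact_mod_cast han
  have hRn : (R : ℝ) ≤ n := by rw [hRr]; linarith
  have hSn : (S : ℝ) ≤ n := by rw [hSr]; linarith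
  have hrr : ∀ c, |((μ c).1 : ℝ)| ≤ R := fun c => by exact_mod_cast (hbox c).1
  have hsr : ∀ c, |((μ c).2.1 : ℝ)| ≤ S := fun c => by exact_mod_cast (hbox c).2.1
  have htr : ∀ c, |((μ c).2.2 : ℝ)| ≤ T := fun c => by exact_mod_cast (hbox c).2.2
  have hV : ∀ c, |(((μ c).1 + n * (μ c).2.2 : ℤ) : ℝ)| ≤ Vm := by
    intro c
    push_cast
    calc _ ≤ |((μ c).1 : ℝ)| + |(n : ℝ) * (μ c).2.2| := abs_add_le _ _
      _ ≤ n + n * T := by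
        rw [abs_mul, Nat.abs_cast]
        have := hrr c
        have := htr c
        have : (n : ℝ) * |((μ c).2.2 : ℝ)| ≤ n * T := by gcongr
        linarith
      _ = _ := by rw [hVm]; ring
  have hZ : ∀ c, |(((μ c).2.1 - a * (μ c).2.2 : ℤ) : ℝ)| ≤ Vm := by
    intro c
    push_cast
    calc _ ≤ |((μ c).2.1 : ℝ)| + |(a : ℝ) * (μ c).2.2| := abs_sub _ _
      _ ≤ n + n * T := by
        rw [abs_mul, Nat.abs_cast]
        have := hsr c
        have := htr c
        have : (a : ℝ) * |((μ c).2.2 : ℝ)| ≤ n * T := by gcongr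
        linarith
      _ = _ := by rw [hVm]; ring
  have hlam : ∀ c : Col (420000 * u) (6 * b + 1), |(c.l : ℤ) - 3 * b| ≤ ((3 * b : ℕ) : ℤ) := by
    intro c
    have : c.l < 6 * b + 1 := c.2.isLt
    rw [abs_le]; push_cast; constructor <;> omega
  have hE4 : 4 ≤ 4 * Real.goldenRatio ^ d := by
    have : 1 ≤ Real.goldenRatio ^ d := one_le_pow₀ Real.one_lt_goldenRatio.le
    linarith
  have hcK : ∀ c : Col (420000 * u) (6 * b + 1), c.i + c.j < K := by intro c; rw [hK]; exact c.ij
  have hlow := det_lower η R S T (3 * b) K (fun c => (μ c).1 + n * (μ c).2.2) (fun c => (μ c).2.1 - a * (μ c).2.2)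
    (fun c => (μ c).1) (fun c => (μ c).2.1) (fun c => (μ c).2.2) Col.i Col.j (fun c => (c.l : ℤ) - 3 * b)
    (fun c => (hbox c).1) (fun c => (hbox c).2.1) (fun c => (hbox c).2.2) hlam (4 * Real.goldenRatio ^ d) Vm hE4
    hη1 hη4 hηβ hVm1 hV hZ hcK hdet
  have hΛτ : ∀ (lam t : ℝ), |lam| ≤ 3 * b → |t| ≤ T → |lam * (t * Λ)| ≤ 1 / Real.exp 3 ^ M0 / 2 := by
    intro lam t h1 h2
    have h3 : Real.exp (-(630000 * (u : ℝ) * (6 * b + 1))) = 1 / Real.exp 3 ^ M0 := by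
      rw [← Real.exp_nat_mul, hM0r, Real.exp_neg, one_div]
      congr 2; ring
    rw [h3] at hΛ
    rw [abs_mul, abs_mul]
    have : |lam| * (|t| * |Λ|) ≤ 3 * b * (T * |Λ|) := by gcongr
    rw [hTr] at this
    linarith
  have hup := det_upper (ι := Col (420000 * u) (6 * b + 1)) K M0 (by omega) Col.i Col.j hcK (fun c => (((c.l : ℤ) - 3 * b : ℤ) : ℝ)) (3 * b)
    (fun c => by exact_mod_cast hlam c)
    (fun c => (((μ c).1 + n * (μ c).2.2 : ℤ) : ℝ)) (fun c => (((μ c).2.1 - a * (μ c).2.2 : ℤ) : ℝ))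
    (fun c => (μ c).1 * κ + (μ c).2.1 * l2 + (μ c).2.2 * (n * κ - a * l2))
    (fun c => (μ c).1 * κ + (μ c).2.1 * l2 + (μ c).2.2 * Real.log γ) κ l2 (by linarith) (by linarith)
    (by linarith) (fun c => by push_cast; ring) Vm (R * κ + S * l2 + 0.82 * T) hV hZ hVm1
    (fun c => by
      have hκ0 : 0 ≤ κ := by linarith
      have hl0 : 0 ≤ l2 := by linarith
      refine (abs_add_le _ _).trans ?_
      refine (add_le_add (abs_add_le _ _) le_rfl).trans ?_
      rw [abs_mul, abs_mul, abs_mul, abs_of_nonneg hκ0, abs_of_nonneg hl0]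
      have := hrr c
      have := hsr c
      have := htr c
      rw [mul_comm (0.82 : ℝ)]
      gcongr) (Real.exp 3) (Real.one_le_exp (by norm_num)) (by
      have hτ := exp3_lt
      have hW : R * κ + S * l2 + 0.82 * T ≤ 100000 * (u : ℝ) := by
        rw [hRr, hSr, hTr]
        have e1 : (10500 * (u : ℝ)) * κ ≤ (10500 * (u : ℝ)) * 1 := by gcongr; linarith
        have e2 : (7000 * (u : ℝ)) * l2 ≤ (7000 * (u : ℝ)) * 1 := by gcongr; linarith
        have e3 : 23 * (b : ℝ) ^ 2 ≤ u := by rw [hur, mul_comm]; gcongr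
        linarith
      calc _ ≤ Real.exp 3 * (100000 * (u : ℝ)) := by gcongr
        _ ≤ 20.0856 * (100000 * (u : ℝ)) := by gcongr
        _ ≤ n := by linarith
        _ ≤ Vm := hnVm)
    (fun c c' => by
      have : ((μ c).1 * κ + (μ c).2.1 * l2 + (μ c).2.2 * Real.log γ) - ((μ c).1 * κ + (μ c).2.1 * l2 + (μ c).2.2 * (n * κ - a * l2)) = (μ c).2.2 * Λ := by
        rw [hΛd]; ring
      rw [this]
      exact hΛτ _ _ (by exact_mod_cast hlam c') (htr c))
  have hmat : (Matrix.of fun (c c' : Col (420000 * u) (6 * b + 1)) => (((μ c).1 + n * (μ c).2.2 : ℤ) : ℝ) ^ c'.i * (((μ c).2.1 - a * (μ c).2.2 : ℤ) : ℝ) ^ c'.j *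
      Real.exp ((((c'.l : ℤ) - 3 * b : ℤ) : ℝ) * ((μ c).1 * κ + (μ c).2.1 * l2 + (μ c).2.2 * Real.log γ)))
      = Matrix.of fun (c c' : Col (420000 * u) (6 * b + 1)) => (((μ c).1 + n * (μ c).2.2 : ℤ) : ℝ) ^ c'.i * (((μ c).2.1 - a * (μ c).2.2 : ℤ) : ℝ) ^ c'.j *
      (Real.goldenRatio ^ (μ c).1 * 2 ^ (μ c).2.1 * (√5 / aeval Real.goldenRatio η) ^ (μ c).2.2) ^ ((c'.l : ℤ) - 3 * b) := by
    ext c c'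
    simp only [Matrix.of_apply]
    congr 1
    have hθ := thE_pos hγ (μ c)
    have hlog : (μ c).1 * κ + (μ c).2.1 * l2 + (μ c).2.2 * Real.log γ = Real.log (thE γ (μ c)) := by
      rw [thE, Real.log_mul (by positivity) (by positivity), Real.log_mul (by positivity) (by positivity),
        Real.log_zpow, Real.log_zpow, Real.log_zpow]
    rw [hlog, mul_comm, Real.exp_mul, Real.exp_log hθ, Real.rpow_intCast]
    rfl
  rw [hmat] at hup
  have hu0 : (0 : ℝ) < u := by linarith
  have hb0 : (0 : ℝ) < b := by linarith
  have heb : 1260000000 * u * 100000 * (b : ℝ) ^ 2 ≤ Real.exp b := by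
    refine le_trans ?_ hbn
    calc 1260000000 * (u : ℝ) * 100000 * (b : ℝ) ^ 2 = 3 * ((420000000 * u) * (100000 * (b : ℝ) ^ 2)) := by ring
      _ ≤ 3 * ((n : ℝ) * (100000 * b ^ 2 + 1)) := by gcongr; linarith
  have hub2 : (u : ℝ) ≤ u * b ^ 2 := le_mul_of_one_le_right hu0.le (one_le_pow₀ (by linarith))
  have hub1 : (b : ℝ) ≤ u * b ^ 2 := (le_self_pow₀ (by linarith) two_ne_zero).trans (le_mul_of_one_le_left (by positivity) (by linarith))
  have hKe : (K : ℝ) + 1 ≤ Real.exp b := by rw [hKr]; linarith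
  have hLe : 6 * (b : ℝ) + 1 ≤ Real.exp b := by linarith
  have hM0e : (M0 : ℝ) ≤ Real.exp (2 * b) := by
    rw [hM0r, two_mul, Real.exp_add]
    apply mul_le_mul _ hLe (by positivity) (by positivity)
    linarith
  have hNe : (N : ℝ) ≤ Real.exp (3 * b) := by
    rw [hNK]; push_cast
    rw [show 3 * (b : ℝ) = b + 2 * b by ring, Real.exp_add]
    exact mul_le_mul hKe hM0e (by positivity) (by positivity)
  have hQe : ((K * (M0 + K) : ℕ) + 1 : ℝ) ≤ Real.exp (4 * b) := by
    have h1 : ((K * (M0 + K) : ℕ) + 1 : ℝ) ≤ 2 * N := by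
      have hKM : K ≤ M0 := by
        rw [hK, hM0]
        calc 420000 * u = 210000 * u * 2 := by ring
          _ ≤ _ := by gcongr; omega
      have hM1 : 1 ≤ M0 := hM1
      have : K * (M0 + K) + 1 ≤ 2 * N := by
        rw [hNK]
        calc K * (M0 + K) + 1 ≤ K * (M0 + M0) + 2 * M0 := by gcongr; omega
          _ = _ := by ring
      exact_mod_cast this
    rw [show 4 * (b : ℝ) = b + 3 * b by ring, Real.exp_add]
    have h2 : (2 : ℝ) ≤ Real.exp b := by linarith
    exact h1.trans (mul_le_mul h2 hNe (by positivity) (by positivity))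
  have hVme : Vm ≤ Real.exp b := by linarith
  have hpe : ∀ (x : ℝ), 0 < x → ∀ k : ℕ, x ^ k = Real.exp (k * Real.log x) := by
    intro x hx k
    rw [Real.exp_nat_mul, Real.exp_log hx]
  have hl4 : Real.log 4 = 2 * l2 := by
    rw [show (4 : ℝ) = 2 ^ 2 by norm_num, Real.log_pow]; push_cast; rfl
  refine ml_contra N K M0 hNK (by rw [hNK]; positivity) ((Real.goldenRatio ^ R * 2 ^ S * (√5 * 4) ^ T) ^ (3 * b))
    (Vm ^ K * 2 ^ (2 * (S * (3 * b))) * (4 * Real.goldenRatio ^ d) ^ (2 * (T * (3 * b))))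
    ((K * (M0 + K) : ℕ) + 1 : ℝ) ((3 * Vm) ^ K * Real.exp (Real.exp 3 * (3 * b * (R * κ + S * l2 + 0.82 * T)))) _
    (3 * b * (R * κ + S * l2 + T * (Real.log √5 + 2 * l2)))
    (K * b + 2 * (S * (3 * b)) * l2 + 2 * (T * (3 * b)) * (2 * l2 + d * κ))
    (3 * b) (4 * b) (K * b + Real.exp 3 * (3 * b * (R * κ + S * l2 + 0.82 * T)))
    (by positivity) (by positivity) (by positivity) (by positivity) ?_ ?_ hNe hQe ?_ hlow hup ?_
  · rw [hpe _ (by positivity), Real.log_mul (by positivity) (by positivity), Real.log_mul (by positivity) (by positivity),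
      Real.log_pow, Real.log_pow, Real.log_pow, Real.log_mul (by positivity) (by positivity), hl4]
    push_cast
    exact le_rfl
  · rw [Real.exp_add, Real.exp_add]
    have e1 : Vm ^ K ≤ Real.exp (K * b) := by rw [Real.exp_nat_mul]; gcongr
    have e2 : (2 : ℝ) ^ (2 * (S * (3 * b))) = Real.exp (2 * (S * (3 * b)) * l2) := by
      rw [hpe _ (by norm_num)]; push_cast; rfl
    have e3 : (4 * Real.goldenRatio ^ d) ^ (2 * (T * (3 * b))) = Real.exp (2 * (T * (3 * b)) * (2 * l2 + d * κ)) := by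
      rw [hpe _ (by positivity), Real.log_mul (by positivity) (by positivity), Real.log_pow, hl4]; push_cast; rfl
    rw [e2, e3]
    gcongr
  · rw [Real.exp_add]
    have e1 : (3 * Vm) ^ K ≤ Real.exp (K * b) := by rw [Real.exp_nat_mul]; gcongr
    gcongr
  · have := ml_num b H d u κ l2 (Real.exp 3) (Real.log √5 + 2 * l2) T hbr (by positivity) (by exact_mod_cast hdH) hur hTr
      (by linarith) hκlt.le (by linarith) (by linarith) (Real.exp_pos _).le exp3_lt.le
      (by linarith)
    rw [hKr, hRr, hSr, hM0r]
    norm_num at this ⊢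
    linarith


theorem log_abs_le (z : ℝ) (h : |z - 1| ≤ 1 / 2) : |Real.log z| ≤ 2 * |z - 1| := by
  have h' := abs_le.mp h
  have hz : 0 < z := by linarith
  have h1 := Real.log_le_sub_one_of_pos hz
  have h2 := Real.one_sub_inv_le_log_of_pos hz
  have h3 := le_abs_self (z - 1)
  have h4 := neg_abs_le (z - 1)
  have h5 : z⁻¹ ≤ 2 := by
    rw [inv_le_comm₀ hz (by norm_num)]; linarith
  have h6 : -(2 * |z - 1|) ≤ 1 - z⁻¹ := by
    have : 1 - z⁻¹ = (z - 1) * z⁻¹ := by field_simp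
    rw [this]
    have h7 : |(z - 1) * z⁻¹| ≤ |z - 1| * 2 := by
      rw [abs_mul, abs_of_pos (inv_pos.mpr hz)]; gcongr
    have := neg_abs_le ((z - 1) * z⁻¹)
    linarith
  rw [abs_le]
  constructor <;> linarith [abs_nonneg (z - 1)]

theorem step_exp (b U y : ℝ) (hb : 87 ≤ b) (hU : 23 * b ^ 2 ≤ U) (hy : 9.2 * b * (420000 * U) < y) :
    600000 * b ^ 3 * (14 * Real.exp (-y)) ≤ Real.exp (-(630000 * U * (6 * b + 1))) ∧ 7 * Real.exp (-y) ≤ 1 / 2 := by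
  have hb0 : 0 < b := by linarith
  have hU0 : 0 < U := by nlinarith [sq_nonneg b]
  have hbU : 23 * b ^ 3 ≤ b * U := by
    have := mul_le_mul_of_nonneg_left hU hb0.le
    linarith
  have hUb : 87 * U ≤ b * U := by gcongr
  have hb3 : 1 ≤ b ^ 3 := one_le_pow₀ (by linarith)
  set w := y - 630000 * U * (6 * b + 1) with hw
  have hw1 : 1000000 * b ^ 3 ≤ w := by
    rw [hw]
    norm_num at hy
    linarith
  have hw0 : 0 ≤ w := by linarith
  have h1 := Real.quadratic_le_exp_of_nonneg hw0
  have hw2 : 1000000 * w ≤ w ^ 2 := by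
    rw [sq]; gcongr; linarith
  have h2 : 8400000 * b ^ 3 ≤ Real.exp w := by linarith
  have h3 : Real.exp (-y) = Real.exp (-w) * Real.exp (-(630000 * U * (6 * b + 1))) := by
    rw [← Real.exp_add]; congr 1; rw [hw]; ring
  have h4 : Real.exp w * Real.exp (-w) = 1 := by rw [← Real.exp_add]; simp
  have h5 : 8400000 * b ^ 3 * Real.exp (-w) ≤ 1 := by
    rw [← h4]; gcongr
  have hE := Real.exp_pos (-(630000 * U * (6 * b + 1)))
  have h7 : 600000 * b ^ 3 * (14 * Real.exp (-y)) ≤ Real.exp (-(630000 * U * (6 * b + 1))) := by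
    rw [h3]
    calc _ = (8400000 * b ^ 3 * Real.exp (-w)) * Real.exp (-(630000 * U * (6 * b + 1))) := by ring
      _ ≤ 1 * Real.exp (-(630000 * U * (6 * b + 1))) := by gcongr
      _ = _ := one_mul _
  refine ⟨h7, ?_⟩
  have h8 : Real.exp (-(630000 * U * (6 * b + 1))) ≤ 1 := by
    rw [Real.exp_le_one_iff]
    have : 0 ≤ 630000 * U * (6 * b + 1) := by positivity
    linarith
  have h9 : 600000 * 1 * (14 * Real.exp (-y)) ≤ 600000 * b ^ 3 * (14 * Real.exp (-y)) := by
    have := Real.exp_pos (-y)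
    gcongr
  linarith

open Polynomial in
theorem stepML (b n a d g m : ℕ) (hb : 87 ≤ b) (hgm : m + g = n) (han : a ≤ n)
    (η : ℤ[X]) (hη1 : 1 ≤ aeval Real.goldenRatio η) (hη4 : aeval Real.goldenRatio η ≤ 4)
    (hηβ : |aeval Real.goldenConj η| ≤ 4 * Real.goldenRatio ^ d)
    (hbn : 3 * ((n : ℝ) * (100000 * b ^ 2 + 1)) ≤ Real.exp b)
    (happ : |√5 * 2 ^ a - Real.goldenRatio ^ n * aeval Real.goldenRatio η| ≤ 7 * Real.goldenRatio ^ m) :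
    (g : ℝ) ≤ 8030000 * b ^ 3 * (d + 23) := by
  by_contra hcon
  push Not at hcon
  have hκgt := loggold_gt
  have hκlt := loggold_lt
  set κ := Real.log Real.goldenRatio with hκ
  have hbr : (87 : ℝ) ≤ b := by exact_mod_cast hb
  set U : ℝ := (b : ℝ) ^ 2 * (d + 23) with hU
  have hU0 : 0 < U := by positivity
  have hUb : 23 * (b : ℝ) ^ 2 ≤ U := by
    rw [hU, mul_comm]; gcongr
    have : (0 : ℝ) ≤ d := by positivity
    linarith
  have hg : 8030000 * b * U < g := by
    have : 8030000 * b * U = 8030000 * (b : ℝ) ^ 3 * (d + 23) := by rw [hU]; ring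
    rw [this]; exact hcon
  have hbU : 0 < b * U := by positivity
  have hbU2 : 87 * U ≤ b * U := by gcongr
  have hy : 9.2 * b * (420000 * U) < g * κ := by
    have h1 : 8030000 * b * U * 0.48121 < g * κ := by gcongr
    norm_num at h1 ⊢
    linarith
  have hgn : (g : ℝ) ≤ n := by
    have : g ≤ n := by omega
    exact_mod_cast this
  have hφ := Real.goldenRatio_pos
  set y := aeval Real.goldenRatio η with hyd
  have hy0 : 0 < y := by linarith
  have h5 : (0 : ℝ) < √5 := by positivity
  obtain ⟨s1, s2⟩ := step_exp b U (g * κ) hbr hUb hy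
  refine ML b (d + 23) n a d hb le_rfl han ?_ η hη1 hη4 hηβ hbn ?_
  · have : 420000000 * U ≤ n := by linarith
    rw [hU] at this
    exact_mod_cast this
  · push_cast
    rw [← hU]
    set z := √5 * 2 ^ a / (Real.goldenRatio ^ n * y) with hz
    have hz0 : 0 < z := by positivity
    have hlog : a * Real.log 2 - n * Real.log Real.goldenRatio + Real.log (√5 / y) = Real.log z := by
      have e1 : Real.log (√5 * 2 ^ a / (Real.goldenRatio ^ n * y)) = Real.log √5 + a * Real.log 2 - (n * Real.log Real.goldenRatio + Real.log y) := by
        rw [Real.log_div (by positivity) (by positivity), Real.log_mul h5.ne' (by positivity), Real.log_mul (by positivity) hy0.ne', Real.log_pow, Real.log_pow]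
      have e2 : Real.log (√5 / y) = Real.log √5 - Real.log y := Real.log_div h5.ne' hy0.ne'
      rw [hz, e1, e2]
      ring
    rw [hlog]
    have hzm : |z - 1| ≤ 7 * Real.exp (-(g * κ)) := by
      have e1 : z - 1 = (√5 * 2 ^ a - Real.goldenRatio ^ n * y) / (Real.goldenRatio ^ n * y) := by
        rw [hz]; field_simp
      have e2 : Real.exp (-(g * κ)) = (Real.goldenRatio ^ g)⁻¹ := by
        rw [Real.exp_neg, Real.exp_nat_mul, Real.exp_log hφ]
      rw [e1, abs_div, abs_of_pos (by positivity : 0 < Real.goldenRatio ^ n * y), e2, div_le_iff₀ (by positivity), ← hgm, pow_add]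
      rw [← hgm, pow_add] at happ
      refine happ.trans ?_
      have : 7 * (Real.goldenRatio ^ g)⁻¹ * (Real.goldenRatio ^ m * Real.goldenRatio ^ g * y) = 7 * Real.goldenRatio ^ m * y := by
        field_simp
      rw [this]
      apply le_mul_of_one_le_right (by positivity) hη1
    have hl := log_abs_le z (hzm.trans s2)
    refine le_trans ?_ s1
    gcongr
    linarith


theorem fib_le_two_pow (k : ℕ) : Nat.fib (k + 2) ≤ 2 ^ k ∧ Nat.fib (k + 1) ≤ 2 ^ k := by
  induction k with
  | zero => simp
  | succ k ih =>
    constructor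
    · rw [Nat.fib_add_two, pow_succ]; obtain ⟨h1, h2⟩ := ih; rw [show k + 1 + 1 = k + 2 from rfl]; omega
    · rw [pow_succ]; have := ih.1; rw [show k + 1 + 1 = k + 2 from rfl]; omega

theorem exp_nat_bd (k : ℕ) : Real.exp k < 2.7182818286 ^ k ∨ k = 0 := by
  rcases Nat.eq_zero_or_pos k with h | h
  · right; exact h
  · left
    rw [Real.exp_one_pow k |>.symm]
    exact pow_lt_pow_left₀ Real.exp_one_lt_d9 (Real.exp_pos 1).le h.ne'

theorem log_ge_of (k : ℕ) (hk : k ≠ 0) (x : ℝ) (hx : 0 < x) (j : ℕ) (h : (2.7182818286 : ℝ) ^ k ≤ x ^ j) :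
    (k : ℝ) ≤ j * Real.log x := by
  rw [← Real.log_pow, Real.le_log_iff_exp_le (by positivity)]
  rcases exp_nat_bd k with h1 | h1
  · linarith
  · exact absurd h1 hk

theorem triv_regime (n : ℕ) (hn1 : 350 < n) (hn : (n : ℝ) < 2.5e28) :
    0.481214 * (n : ℝ) < 3.29 * 10 ^ 24 * Real.log n ^ 2 := by
  have hn' : (350 : ℝ) < n := by exact_mod_cast hn1
  by_cases h : (n : ℝ) ≤ 2e26
  · have h1 : ((11 : ℕ) : ℝ) ≤ (2 : ℕ) * Real.log n := by
      apply log_ge_of 11 (by norm_num) n (by linarith)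
      calc (2.7182818286 : ℝ) ^ 11 ≤ 350 ^ 2 := by norm_num
        _ ≤ _ := by gcongr
    push_cast at h1
    nlinarith
  · push Not at h
    have h1 : ((121 : ℕ) : ℝ) ≤ (2 : ℕ) * Real.log n := by
      apply log_ge_of 121 (by norm_num) n (by linarith)
      calc (2.7182818286 : ℝ) ^ 121 ≤ 2e26 ^ 2 := by norm_num
        _ ≤ _ := by gcongr
    push_cast at h1
    nlinarith

theorem hbn_aux (x b : ℝ) (hx : 65 ≤ x) (h1 : 1.1 * x + 16 ≤ b) (h2 : b ≤ 1.1 * x + 17) :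
    3 * (Real.exp x * (100000 * b ^ 2 + 1)) ≤ Real.exp b := by
  set z := (b - 83) / 11 with hz
  have hb : b = 83 + 11 * z := by rw [hz]; ring
  have hz0 : 0 ≤ z := by rw [hz]; apply div_nonneg <;> linarith
  have hbx : x + 22 + z ≤ b := by linarith
  have hq := Real.quadratic_le_exp_of_nonneg hz0
  have h22 : (3e9 : ℝ) ≤ Real.exp 22 := by
    have : Real.exp 22 = Real.exp 1 ^ 22 := by rw [← Real.exp_nat_mul]; norm_num
    rw [this]
    calc (3e9 : ℝ) ≤ 2.7182818283 ^ 22 := by norm_num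
      _ ≤ _ := by gcongr; exact Real.exp_one_gt_d9.le
  have hm : 3 * (100000 * b ^ 2 + 1) ≤ Real.exp 22 * Real.exp z := by
    calc 3 * (100000 * b ^ 2 + 1) ≤ 3e9 * (1 + z + z ^ 2 / 2) := by
          rw [hb]; norm_num; nlinarith [sq_nonneg z]
      _ ≤ _ := by gcongr
  calc 3 * (Real.exp x * (100000 * b ^ 2 + 1)) = Real.exp x * (3 * (100000 * b ^ 2 + 1)) := by ring
    _ ≤ Real.exp x * (Real.exp 22 * Real.exp z) := by gcongr
    _ = Real.exp (x + 22 + z) := by rw [Real.exp_add, Real.exp_add]; ring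
    _ ≤ _ := Real.exp_le_exp.mpr hbx

theorem b_lt (x b : ℝ) (h2 : b ≤ 1.1 * x + 17) (h : Real.exp x ≤ 9.7e28 * b ^ 12) : b < 161 := by
  by_contra hc
  push Not at hc
  set z := b - 161 with hz
  have hz0 : 0 ≤ z := by linarith
  have hb : b = 161 * (1 + z / 161) := by rw [hz]; ring
  have h3 : b ^ 12 ≤ 161 ^ 12 * Real.exp (12 * (z / 161)) := by
    rw [hb, mul_pow]
    have h4 : 1 + z / 161 ≤ Real.exp (z / 161) := by linarith [Real.add_one_le_exp (z / 161)]
    have h5 : Real.exp (z / 161) ^ 12 = Real.exp (12 * (z / 161)) := by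
      rw [← Real.exp_nat_mul]; norm_num
    rw [← h5]
    gcongr
  have h6 : Real.exp 130 = Real.exp 1 ^ 130 := by rw [← Real.exp_nat_mul]; norm_num
  have h7 : 9.7e28 * 161 ^ 12 < Real.exp 130 := by
    rw [h6]
    calc (9.7e28 * 161 ^ 12 : ℝ) < 2.7182818283 ^ 130 := by norm_num
      _ ≤ _ := by gcongr; exact Real.exp_one_gt_d9.le
  have h8 : Real.exp (130 + 12 * (z / 161)) ≤ Real.exp x := by
    apply Real.exp_le_exp.mpr
    norm_num at h2
    linarith
  rw [Real.exp_add] at h8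
  have h9 := Real.exp_pos (12 * (z / 161))
  have h10 := mul_lt_mul_of_pos_right h7 h9
  norm_num at h h10 h3
  linarith


open Polynomial in
theorem etabd (d : ℕ) : 0 ≤ (Real.goldenRatio - 1) ^ d ∧ (Real.goldenRatio - 1) ^ d ≤ 1 ∧
    |(Real.goldenConj - 1) ^ d| = Real.goldenRatio ^ d := by
  have h1 := Real.one_lt_goldenRatio
  have h2 := Real.goldenRatio_lt_two
  refine ⟨by apply pow_nonneg; linarith, by apply pow_le_one₀ <;> linarith, ?_⟩
  have : Real.goldenConj - 1 = - Real.goldenRatio := by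
    have := Real.goldenRatio_add_goldenConj
    linarith
  rw [abs_pow, this, abs_neg, abs_of_pos (by linarith)]

theorem phipow (n m : ℕ) (h : m ≤ n) :
    Real.goldenRatio ^ n * (Real.goldenRatio - 1) ^ (n - m) = Real.goldenRatio ^ m := by
  obtain ⟨k, rfl⟩ := Nat.exists_eq_add_of_le h
  have h1 : Real.goldenRatio * (Real.goldenRatio - 1) = 1 := by
    have := Real.goldenRatio_sq
    linarith
  rw [Nat.add_sub_cancel_left, pow_add, mul_assoc, ← mul_pow, h1, one_pow, mul_one]

theorem psipow (n : ℕ) : |Real.goldenConj ^ n| ≤ 1 := by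
  rw [abs_pow]
  apply pow_le_one₀ (abs_nonneg _)
  rw [abs_le]
  constructor <;> linarith [Real.neg_one_lt_goldenConj, Real.goldenConj_neg]

theorem binet (n : ℕ) : √5 * (Nat.fib n : ℝ) = Real.goldenRatio ^ n - Real.goldenConj ^ n := by
  rw [Real.coe_fib_eq]
  field_simp

theorem chain_num (b d2 d3 d4 n : ℝ) (hbr : 87 ≤ b) (s1 : d2 ≤ 8030000 * b ^ 3 * (0 + 23))
    (s2 : d3 ≤ 8030000 * b ^ 3 * (d2 + 23)) (s3 : d4 ≤ 8030000 * b ^ 3 * (d3 + 23))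
    (s4 : n ≤ 8030000 * b ^ 3 * (d4 + 23)) : d3 ≤ 1.486e15 * b ^ 6 ∧ n ≤ 9.7e28 * b ^ 12 := by
  have hB : (1000 : ℝ) ≤ b ^ 3 := by
    calc (1000 : ℝ) ≤ 87 ^ 3 := by norm_num
      _ ≤ _ := by gcongr
  have e6 : b ^ 6 = b ^ 3 * b ^ 3 := by ring
  have e12 : b ^ 12 = b ^ 3 * b ^ 3 * b ^ 3 * b ^ 3 := by ring
  rw [e6, e12]
  generalize b ^ 3 = B at *
  have hB0 : 0 ≤ B := by linarith
  have B2 : 1000 * 1 ≤ B * B := by gcongr; linarith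
  have B3 : 1000 * 1 ≤ B * B * B := by gcongr <;> linarith
  have B4 : 0 ≤ B * B * B * B := by positivity
  have t1 : d2 + 23 ≤ 1.848e8 * B := by
    norm_num; linarith
  have t2 : d3 + 23 ≤ 1.486e15 * (B * B) := by
    have : 8030000 * B * (d2 + 23) ≤ 8030000 * B * (1.848e8 * B) := by gcongr
    norm_num at this ⊢; linarith
  have t3 : d4 + 23 ≤ 1.1934e22 * (B * B * B) := by
    have : 8030000 * B * (d3 + 23) ≤ 8030000 * B * (1.486e15 * (B * B)) := by gcongr
    norm_num at this ⊢; linarith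
  have t4 : 8030000 * B * (d4 + 23) ≤ 8030000 * B * (1.1934e22 * (B * B * B)) := by gcongr
  constructor
  · linarith
  · norm_num at t4 ⊢
    linarith

set_option maxHeartbeats 800000 in
open Polynomial in
theorem final_chain (n1 n2 n3 n4 a b : ℕ)
    (h12 : n2 ≤ n1) (h23 : n3 ≤ n2) (h34 : n4 ≤ n3) (han : a ≤ n1) (hb : 87 ≤ b)
    (hbn : 3 * ((n1 : ℝ) * (100000 * b ^ 2 + 1)) ≤ Real.exp b)
    (h : Nat.fib n1 + Nat.fib n2 + Nat.fib n3 + Nat.fib n4 = 2 ^ a) :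
    ((n1 : ℝ) - n3) ≤ 1.486e15 * (b : ℝ) ^ 6 ∧ (n1 : ℝ) ≤ 9.7e28 * (b : ℝ) ^ 12 := by
  have hbr : (87 : ℝ) ≤ b := by exact_mod_cast hb
  have hφ1 := Real.one_lt_goldenRatio
  have hR : √5 * 2 ^ a = Real.goldenRatio ^ n1 + Real.goldenRatio ^ n2 + Real.goldenRatio ^ n3 + Real.goldenRatio ^ n4
      - (Real.goldenConj ^ n1 + Real.goldenConj ^ n2 + Real.goldenConj ^ n3 + Real.goldenConj ^ n4) := by
    have h' : ((Nat.fib n1 : ℝ) + Nat.fib n2 + Nat.fib n3 + Nat.fib n4) = 2 ^ a := by exact_mod_cast h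
    rw [← h']
    linarith [binet n1, binet n2, binet n3, binet n4]
  have q1 := abs_le.mp (psipow n1)
  have q2 := abs_le.mp (psipow n2)
  have q3 := abs_le.mp (psipow n3)
  have q4 := abs_le.mp (psipow n4)
  have m23 : Real.goldenRatio ^ n3 ≤ Real.goldenRatio ^ n2 := pow_le_pow_right₀ hφ1.le h23
  have m34 : Real.goldenRatio ^ n4 ≤ Real.goldenRatio ^ n3 := pow_le_pow_right₀ hφ1.le h34
  have m4 : 1 ≤ Real.goldenRatio ^ n4 := one_le_pow₀ hφ1.le
  obtain ⟨u2, v2, w2⟩ := etabd (n1 - n2)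
  obtain ⟨u3, v3, w3⟩ := etabd (n1 - n3)
  obtain ⟨u4, v4, w4⟩ := etabd (n1 - n4)
  have p2 := phipow n1 n2 h12
  have p3 := phipow n1 n3 (by omega)
  have p4 := phipow n1 n4 (by omega)
  have k2 : 1 ≤ Real.goldenRatio ^ (n1 - n2) := one_le_pow₀ hφ1.le
  have k3 : Real.goldenRatio ^ (n1 - n2) ≤ Real.goldenRatio ^ (n1 - n3) := pow_le_pow_right₀ hφ1.le (by omega)
  have k4 : Real.goldenRatio ^ (n1 - n3) ≤ Real.goldenRatio ^ (n1 - n4) := pow_le_pow_right₀ hφ1.le (by omega)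
  have w2' := abs_le.mp w2.le
  have w3' := abs_le.mp w3.le
  have w4' := abs_le.mp w4.le
  have s1 := stepML b n1 a 0 (n1 - n2) n2 hb (by omega) han 1 (by simp) (by simp) (by simp) hbn
    (by rw [map_one, hR, abs_le]; constructor <;> linarith)
  have s2 := stepML b n1 a (n1 - n2) (n1 - n3) n3 hb (by omega) han (1 + (X - 1) ^ (n1 - n2))
    (by simp only [map_add, map_one, map_pow, map_sub, aeval_X]; linarith)
    (by simp only [map_add, map_one, map_pow, map_sub, aeval_X]; linarith)
    (by simp only [map_add, map_one, map_pow, map_sub, aeval_X]; rw [abs_le]; constructor <;> linarith) hbn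
    (by simp only [map_add, map_one, map_pow, map_sub, aeval_X]; rw [hR, mul_add, p2, mul_one, abs_le]; constructor <;> linarith)
  have s3 := stepML b n1 a (n1 - n3) (n1 - n4) n4 hb (by omega) han (1 + (X - 1) ^ (n1 - n2) + (X - 1) ^ (n1 - n3))
    (by simp only [map_add, map_one, map_pow, map_sub, aeval_X]; linarith)
    (by simp only [map_add, map_one, map_pow, map_sub, aeval_X]; linarith)
    (by simp only [map_add, map_one, map_pow, map_sub, aeval_X]; rw [abs_le]; constructor <;> linarith) hbn
    (by simp only [map_add, map_one, map_pow, map_sub, aeval_X]; rw [hR, mul_add, mul_add, p2, p3, mul_one, abs_le]; constructor <;> linarith)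
  have s4 := stepML b n1 a (n1 - n4) n1 0 hb (by omega) han (1 + (X - 1) ^ (n1 - n2) + (X - 1) ^ (n1 - n3) + (X - 1) ^ (n1 - n4))
    (by simp only [map_add, map_one, map_pow, map_sub, aeval_X]; linarith)
    (by simp only [map_add, map_one, map_pow, map_sub, aeval_X]; linarith)
    (by simp only [map_add, map_one, map_pow, map_sub, aeval_X]; rw [abs_le]; constructor <;> linarith) hbn
    (by simp only [map_add, map_one, map_pow, map_sub, aeval_X]; rw [hR, mul_add, mul_add, mul_add, p2, p3, p4, mul_one, pow_zero, abs_le]; constructor <;> linarith)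
  have hc : ((n1 : ℝ) - n3) = ((n1 - n3 : ℕ) : ℝ) := by rw [Nat.cast_sub (by omega)]
  rw [hc]
  rw [Nat.cast_zero] at s1
  exact chain_num b _ _ _ _ hbr s1 s2 s3 s4

theorem bound_n1_sub_n3
    (n1 n2 n3 n4 a : ℕ) (hn4 : 0 < n4) (ha : 0 < a) (hn1 : 350 < n1)
    (h12 : n2 ≤ n1) (h23 : n3 ≤ n2) (h34 : n4 ≤ n3)
    (h : Nat.fib n1 + Nat.fib n2 + Nat.fib n3 + Nat.fib n4 = 2 ^ a) :
    ((n1 : ℝ) - (n3 : ℝ)) * Real.log ((1 + Real.sqrt 5) / 2) <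
      3.29 * 10 ^ 24 * (Real.log n1) ^ 2 := by
  change ((n1 : ℝ) - (n3 : ℝ)) * Real.log Real.goldenRatio < _
  have hκ := loggold_lt
  have hd0 : (0 : ℝ) ≤ (n1 : ℝ) - n3 := by
    have : (n3 : ℝ) ≤ n1 := by exact_mod_cast h23.trans h12
    linarith
  have hL : ((n1 : ℝ) - (n3 : ℝ)) * Real.log Real.goldenRatio ≤ ((n1 : ℝ) - n3) * 0.481214 := by gcongr
  refine lt_of_le_of_lt hL ?_
  by_cases hn : (n1 : ℝ) < 2.5e28
  · have := triv_regime n1 hn1 hn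
    have h3 : (0 : ℝ) ≤ n3 := by positivity
    linarith
  push Not at hn
  have hn0 : (0 : ℝ) < n1 := by linarith
  have hx : (65 : ℝ) ≤ Real.log n1 := by
    have := log_ge_of 65 (by norm_num) n1 hn0 1 (by
      rw [pow_one]
      refine le_trans ?_ hn
      norm_num)
    push_cast at this
    linarith
  have hex := Real.exp_log hn0
  set x := Real.log n1 with hxd
  have han : a ≤ n1 := by
    obtain ⟨k, rfl⟩ : ∃ k, n1 = k + 2 := ⟨n1 - 2, by omega⟩
    have hf := (fib_le_two_pow k).1
    have f2 := Nat.fib_mono h12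
    have f3 := Nat.fib_mono h23
    have f4 := Nat.fib_mono h34
    have : 2 ^ a ≤ 2 ^ (k + 2) := by
      rw [← h, pow_add]; omega
    exact (Nat.pow_le_pow_iff_right (by norm_num)).mp this
  set b := ⌈1.1 * x⌉₊ + 16 with hb
  have hb1 : 1.1 * x + 16 ≤ (b : ℝ) := by
    rw [hb]; push_cast
    linarith [Nat.le_ceil (1.1 * x)]
  have hb2 : (b : ℝ) ≤ 1.1 * x + 17 := by
    rw [hb]; push_cast
    linarith [Nat.ceil_lt_add_one (show 0 ≤ 1.1 * x by linarith)]
  have hb87 : 87 ≤ b := by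
    have : (87 : ℝ) ≤ b := by norm_num at hb1; linarith
    exact_mod_cast this
  have hbn := hbn_aux x b hx hb1 hb2
  rw [hex] at hbn
  obtain ⟨c1, c2⟩ := final_chain n1 n2 n3 n4 a b h12 h23 h34 han hb87 hbn h
  rw [← hex] at c2
  have hb3 := b_lt x b hb2 c2
  have hb4 : (b : ℝ) ≤ 160 := by
    have : b < 161 := by exact_mod_cast hb3
    have : b ≤ 160 := by omega
    exact_mod_cast this
  have c3 : (b : ℝ) ^ 6 ≤ 160 ^ 6 := by gcongr
  have c4 : (65 : ℝ) ^ 2 ≤ x ^ 2 := by gcongr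
  norm_num at c1 c3 c4 ⊢
  linarith
end

section
/- If positive integers n1 ≥ n2 ≥ n3 ≥ n4 and a satisfy F_{n1} + F_{n2} + F_{n3} + F_{n4} = 2^a with n1 > 350, then 0 < a·(log 2 / log α) − n1 + (log √5 / log α) < 19 · α^{−(n1 − n2)}. -/
/-- If positive integers `n1 ≥ n2 ≥ n3 ≥ n4` and `a` satisfy
`F_{n1} + F_{n2} + F_{n3} + F_{n4} = 2^a` with `n1 > 350`, then
`0 < a·(log 2 / log α) − n1 + (log √5 / log α) < 19 · α^{−(n1 − n2)}`. -/
theorem reduction_inequality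
    (n1 n2 n3 n4 a : ℕ) (hn4 : 0 < n4) (ha : 0 < a) (hn1 : 350 < n1)
    (h12 : n2 ≤ n1) (h23 : n3 ≤ n2) (h34 : n4 ≤ n3)
    (h : Nat.fib n1 + Nat.fib n2 + Nat.fib n3 + Nat.fib n4 = 2 ^ a) :
    0 < (a : ℝ) * (Real.log 2 / Real.log ((1 + Real.sqrt 5) / 2)) - (n1 : ℝ) +
        Real.log (Real.sqrt 5) / Real.log ((1 + Real.sqrt 5) / 2) ∧
      (a : ℝ) * (Real.log 2 / Real.log ((1 + Real.sqrt 5) / 2)) - (n1 : ℝ) +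
        Real.log (Real.sqrt 5) / Real.log ((1 + Real.sqrt 5) / 2) <
        19 * ((1 + Real.sqrt 5) / 2) ^ (-((n1 : ℤ) - (n2 : ℤ))) := by
  have hs5 : Real.sqrt 5 ^ 2 = 5 := Real.sq_sqrt (by norm_num)
  have hs0 : (2.236 : ℝ) < Real.sqrt 5 := by
    apply Real.lt_sqrt_of_sq_lt; norm_num
  have hs1 : Real.sqrt 5 < (2.237 : ℝ) := by
    rw [Real.sqrt_lt' (by norm_num)]; norm_num
  have bin : ∀ n : ℕ, Real.sqrt 5 * (Nat.fib n : ℝ) =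
      ((1 + Real.sqrt 5) / 2) ^ n - ((1 - Real.sqrt 5) / 2) ^ n := by
    intro n
    have := Real.coe_fib_eq n
    simp only [Real.goldenRatio, Real.goldenConj] at this
    rw [this]; field_simp
  have hb : ∀ n : ℕ, |((1 - Real.sqrt 5) / 2) ^ n| ≤ 1 := by
    intro n
    rw [abs_pow]
    apply pow_le_one₀ (abs_nonneg _)
    rw [abs_le]; constructor <;> linarith
  have hT : Real.sqrt 5 * (Nat.fib n1 : ℝ) + Real.sqrt 5 * (Nat.fib n2 : ℝ) +
      Real.sqrt 5 * (Nat.fib n3 : ℝ) + Real.sqrt 5 * (Nat.fib n4 : ℝ) = 2 ^ a * Real.sqrt 5 := by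
    have h' : (Nat.fib n1 : ℝ) + Nat.fib n2 + Nat.fib n3 + Nat.fib n4 = 2 ^ a := by
      exact_mod_cast h
    rw [← h']; ring
  have hf2 : (1 : ℝ) ≤ Nat.fib n2 := by
    exact_mod_cast Nat.fib_pos.2 (by omega)
  have hf3 : (0 : ℝ) ≤ Nat.fib n3 := by positivity
  have hf4 : (0 : ℝ) ≤ Nat.fib n4 := by positivity
  have m3 : (Nat.fib n3 : ℝ) ≤ Nat.fib n2 := by exact_mod_cast Nat.fib_mono h23
  have m4 : (Nat.fib n4 : ℝ) ≤ Nat.fib n3 := by exact_mod_cast Nat.fib_mono h34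
  have b1 := bin n1
  have b2 := bin n2
  have c1 := abs_le.1 (hb n1)
  have c2 := abs_le.1 (hb n2)
  have hinv : 1 - ((1 + Real.sqrt 5) / 2)⁻¹ > (7 / 19 : ℝ) := by
    have : ((1 + Real.sqrt 5) / 2)⁻¹ < (12 / 19 : ℝ) := by
      rw [inv_lt_comm₀ (by linarith) (by norm_num)]; linarith
    linarith
  set s := Real.sqrt 5 with hs
  set α := (1 + s) / 2 with hα
  have hα1 : 1 < α := by rw [hα]; linarith
  have hα0 : 0 < α := by linarith
  have hL : 7 / 19 < Real.log α :=
    lt_of_lt_of_le hinv (Real.one_sub_inv_le_log_of_pos hα0)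
  have hL0 : 0 < Real.log α := by linarith
  have p2 : 1 ≤ α ^ n2 := one_le_pow₀ hα1.le
  have p1 : 0 < α ^ n1 := by positivity
  have hs00 : 0 < s := by linarith
  have e2 : s * 1 ≤ s * (Nat.fib n2 : ℝ) := mul_le_mul_of_nonneg_left hf2 hs00.le
  have e3 : s * (Nat.fib n3 : ℝ) ≤ s * (Nat.fib n2 : ℝ) := mul_le_mul_of_nonneg_left m3 hs00.le
  have e4 : s * (Nat.fib n4 : ℝ) ≤ s * (Nat.fib n3 : ℝ) := mul_le_mul_of_nonneg_left m4 hs00.le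
  have e3' : 0 ≤ s * (Nat.fib n3 : ℝ) := by positivity
  have e4' : 0 ≤ s * (Nat.fib n4 : ℝ) := by positivity
  have lo : α ^ n1 < 2 ^ a * s := by linarith
  have hi : 2 ^ a * s ≤ α ^ n1 + 7 * α ^ n2 := by linarith
  have hTpos : 0 < 2 ^ a * s := by positivity
  have logT : Real.log (2 ^ a * s) = a * Real.log 2 + Real.log s := by
    rw [Real.log_mul (by positivity) hs00.ne', Real.log_pow]
  have logA : Real.log (α ^ n1) = n1 * Real.log α := Real.log_pow _ _
  have l1 : Real.log (α ^ n1) < Real.log (2 ^ a * s) := Real.log_lt_log p1 lo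
  have l2 : Real.log (2 ^ a * s) - Real.log (α ^ n1) ≤ 7 * (α ^ n2 / α ^ n1) := by
    rw [← Real.log_div hTpos.ne' p1.ne']
    refine (Real.log_le_sub_one_of_pos (by positivity)).trans ?_
    rw [sub_le_iff_le_add, div_le_iff₀ p1]
    have : (7 * (α ^ n2 / α ^ n1) + 1) * α ^ n1 = α ^ n1 + 7 * α ^ n2 := by
      field_simp; ring
    rw [this]; exact hi
  have key : (a : ℝ) * (Real.log 2 / Real.log α) - (n1 : ℝ) + Real.log s / Real.log α =
      (Real.log (2 ^ a * s) - Real.log (α ^ n1)) / Real.log α := by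
    rw [logT, logA]; field_simp; ring
  have hz : α ^ (-((n1 : ℤ) - (n2 : ℤ))) = α ^ n2 / α ^ n1 := by
    rw [neg_sub, zpow_sub₀ hα0.ne', zpow_natCast, zpow_natCast]
  rw [key, hz]
  have q : 0 < α ^ n2 / α ^ n1 := by positivity
  refine ⟨div_pos (by linarith) hL0, ?_⟩
  rw [div_lt_iff₀ hL0]
  have := mul_lt_mul_of_pos_left hL q
  linarith
end
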